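/- Let f : J̃ → ℝ be Hölder continuous with P(f) > sup f + log N and let x ∈ J̃. Then for every weak*-closed subset K ⊆ M, limsup_{n→∞} (1/n) log [ (Σ_{y : T^n(y)=x, μ_{y,n}∈K} e^{f^n(y)}) / (Σ_{y : T^n(y)=x} e^{f^n(y)}) ] ≤ −ρ(K), with the convention that a sum over an empty index set is 0 and log 0 = −∞. -/

import Mathlib

open MeasureTheory Filter Topology Polynomial
open scoped OnePoint Classical ENNReal

noncomputable section

namespace SkewRational

/-- The Riemann sphere, modelled as the one-point compactification of `ℂ`. -/
abbrev Sphere : Type := OnePoint ℂ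

/-- The product space `X = Σ_N⁺ × ℂ̂`. -/
abbrev SymX (N : ℕ) : Type := (ℕ → Fin N) × Sphere

variable {N : ℕ}

/-- The left shift on `Σ_N⁺`. -/
def shiftW (w : ℕ → Fin N) : ℕ → Fin N := fun n => w (n + 1)

/-- Prepending a letter to an infinite word. -/
def consW (v : Fin N) (w : ℕ → Fin N) : ℕ → Fin N := fun n => if n = 0 then v else w (n - 1)

/-- Evaluation of the rational map `P/Q` (in irreducible form) on the Riemann sphere. -/
def ratEval (P Q : ℂ[X]) : Sphere → Sphere := fun z =>
  OnePoint.elim z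
    (if Q.natDegree < P.natDegree then (OnePoint.infty : Sphere)
     else if P.natDegree < Q.natDegree then ((0 : ℂ) : Sphere)
     else ((P.leadingCoeff / Q.leadingCoeff : ℂ) : Sphere))
    (fun a => if Q.eval a = 0 then (OnePoint.infty : Sphere) else ((P.eval a / Q.eval a : ℂ) : Sphere))

/-- The multiset of preimages (with multiplicity) of a point of the sphere under `P/Q`. -/
def fiber (P Q : ℂ[X]) (a : Sphere) : Multiset Sphere :=
  OnePoint.elim a
    ((Q.roots.map fun z => (z : Sphere)) +
      Multiset.replicate (max P.natDegree Q.natDegree - Q.natDegree) (OnePoint.infty : Sphere))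
    (fun b =>
      (((P - Polynomial.C b * Q).roots.map fun z => (z : Sphere)) +
        Multiset.replicate
          (max P.natDegree Q.natDegree - (P - Polynomial.C b * Q).natDegree) (OnePoint.infty : Sphere)))

variable (p q : Fin N → ℂ[X])

/-- The degree `d_i` of the rational map `R_i = p i / q i`. -/
def degR (i : Fin N) : ℕ := max (p i).natDegree (q i).natDegree

/-- `D = d₁ + ⋯ + d_N`. -/
def Dtot : ℕ := ∑ i, degR p q i

/-- Standing assumptions: `N ≥ 1`, each `R_i = p i / q i` in irreducible form, all degrees
at least `1`, and at least one degree at least `2`. -/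
def Good : Prop :=
  1 ≤ N ∧ (∀ i, IsCoprime (p i) (q i)) ∧ (∀ i, 1 ≤ degR p q i) ∧ (∃ i, 2 ≤ degR p q i)

/-- The skew-product map `T(w, z) = (σ w, R_{w 0} z)`. -/
def Tmap : SymX N → SymX N := fun x => (shiftW x.1, ratEval (p (x.1 0)) (q (x.1 0)) x.2)

/-- The multiset of preimages of a point under `T`, counted with multiplicity. -/
def preimT (x : SymX N) : Multiset (SymX N) :=
  ∑ v : Fin N, (fiber (p v) (q v) x.2).map fun z => (consW v x.1, z)

/-- The multiset of `n`-th order preimages under `T^n`, counted with multiplicity. -/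
def preimTn : ℕ → SymX N → Multiset (SymX N)
  | 0, x => {x}
  | n + 1, x => (preimT p q x).bind fun y => preimTn n y

/-- The chordal (spherical) metric on the Riemann sphere. -/
def sphDist : Sphere → Sphere → ℝ := fun z w =>
  OnePoint.elim z
    (OnePoint.elim w 0 fun b => 2 / Real.sqrt (1 + ‖b‖ ^ 2))
    (fun a =>
      OnePoint.elim w (2 / Real.sqrt (1 + ‖a‖ ^ 2))
        (fun b => 2 * dist a b / (Real.sqrt (1 + ‖a‖ ^ 2) * Real.sqrt (1 + ‖b‖ ^ 2))))

/-- The metric `d(w, w') = 2^{-n(w,w')}` on `Σ_N⁺`. -/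
def shiftDist (w w' : ℕ → Fin N) : ℝ :=
  if h : ∃ n, w n ≠ w' n then (2 : ℝ)⁻¹ ^ (Nat.find h + 1) else 0

/-- The metric on `X`: maximum of the two coordinate metrics. -/
def dX : SymX N → SymX N → ℝ := fun x y => max (shiftDist x.1 y.1) (sphDist x.2 y.2)

/-- Montel normality of a family of self-maps of the sphere on a set `U`. -/
def NormalOn (F : Set (Sphere → Sphere)) (U : Set Sphere) : Prop :=
  ∀ s : ℕ → Sphere → Sphere, (∀ n, s n ∈ F) →
    ∃ φ : ℕ → ℕ, StrictMono φ ∧ ∃ g : Sphere → Sphere,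
      ∀ K : Set Sphere, K ⊆ U → IsCompact K → ∀ ε : ℝ, 0 < ε →
        ∀ᶠ n in atTop, ∀ z ∈ K, sphDist (s (φ n) z) (g z) < ε

/-- The compositions `R_{w (n-1)} ∘ ⋯ ∘ R_{w 0}`. -/
def itComp (w : ℕ → Fin N) : ℕ → Sphere → Sphere
  | 0 => id
  | n + 1 => ratEval (p (w n)) (q (w n)) ∘ itComp w n

/-- The fibrewise Fatou set `F_w`. -/
def fatouW (w : ℕ → Fin N) : Set Sphere :=
  {z | ∃ U : Set Sphere, IsOpen U ∧ z ∈ U ∧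
    NormalOn {g | ∃ n, 1 ≤ n ∧ g = itComp p q w n} U}

/-- The fibrewise Julia set `J_w`. -/
def juliaW (w : ℕ → Fin N) : Set Sphere := (fatouW p q w)ᶜ

/-- The Julia set `J̃` of the skew-product map `T`. -/
def juliaSet : Set (SymX N) :=
  closure (⋃ w : ℕ → Fin N, {w} ×ˢ juliaW p q w)

/-- The critical points of `T`: `(w, z)` with `z` a critical point of `R_{w 0}`. -/
def critSet : Set (SymX N) :=
  {x | 2 ≤ (fiber (p (x.1 0)) (q (x.1 0))
        (ratEval (p (x.1 0)) (q (x.1 0)) x.2)).count x.2}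

/-- Assumption (A1): no super-attracting periodic point of `T` lies in the Julia set
(a periodic point is super-attracting exactly when its orbit meets the critical set,
i.e. the derivative of the return composition vanishes). -/
def NoSuperAttract : Prop :=
  ∀ x ∈ juliaSet p q, ∀ m : ℕ, 1 ≤ m → (Tmap p q)^[m] x = x →
    ∀ k < m, (Tmap p q)^[k] x ∉ critSet p q

instance : MeasurableSpace (SymX N) := borel _
instance : BorelSpace (SymX N) := ⟨rfl⟩

instance : MeasurableSpace ↥(juliaSet p q) := borel _
instance : BorelSpace ↥(juliaSet p q) := ⟨rfl⟩

/-! ### Fixed points counted with multiplicity -/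

/-- Formal composition of rational maps as pairs of polynomials: `compPair a b = a ∘ b`. -/
def compPair (a b : ℂ[X] × ℂ[X]) : ℂ[X] × ℂ[X] :=
  (∑ i ∈ Finset.range (max a.1.natDegree a.2.natDegree + 1),
      Polynomial.C (a.1.coeff i) * b.1 ^ i * b.2 ^ (max a.1.natDegree a.2.natDegree - i),
   ∑ i ∈ Finset.range (max a.1.natDegree a.2.natDegree + 1),
      Polynomial.C (a.2.coeff i) * b.1 ^ i * b.2 ^ (max a.1.natDegree a.2.natDegree - i))

/-- For a word `[v₁, …, v_m]`, the composite `R_{v_m} ∘ ⋯ ∘ R_{v₁}` as a pair of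
polynomials. -/
def wordPair : List (Fin N) → ℂ[X] × ℂ[X]
  | [] => (Polynomial.X, 1)
  | v :: t => compPair (wordPair t) (p v, q v)

/-- The multiset of fixed points (with multiplicity) on the sphere of the rational map given
by a pair of polynomials; a degree-`k` map has `k + 1` fixed points with multiplicity. -/
def fixMul (a : ℂ[X] × ℂ[X]) : Multiset Sphere :=
  ((a.1 - Polynomial.X * a.2).roots.map fun z => (z : Sphere)) +
    Multiset.replicate
      (max a.1.natDegree a.2.natDegree + 1 - (a.1 - Polynomial.X * a.2).natDegree) (OnePoint.infty : Sphere)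

/-- The periodic word `(v₁ ⋯ v_m v₁ ⋯ v_m ⋯)`. -/
def perW {m : ℕ} (hm : 0 < m) (v : Fin m → Fin N) : ℕ → Fin N :=
  fun n => v ⟨n % m, Nat.mod_lt n hm⟩

/-- The multiset `Fix_m(T)` of fixed points of `T^m`, counted with multiplicity. -/
def fixMultiset (m : ℕ) : Multiset (SymX N) :=
  if hm : 0 < m then
    ∑ v : Fin m → Fin N, (fixMul (wordPair p q (List.ofFn v))).map fun z => (perW hm v, z)
  else 0

/-! ### Thermodynamic formalism -/

/-- The ergodic (Birkhoff) sum `f^n`. -/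
def birk (f : SymX N → ℝ) (n : ℕ) (y : SymX N) : ℝ :=
  ∑ k ∈ Finset.range n, f ((Tmap p q)^[k] y)

/-- `(L_f^n 1)(x) = Σ_{T^n y = x} e^{f^n(y)}`. -/
def LSum (f : SymX N → ℝ) (n : ℕ) (x : SymX N) : ℝ :=
  ((preimTn p q n x).map fun y => Real.exp (birk p q f n y)).sum

/-- The pressure `P(f) = sup_{x ∈ J̃} limsup (1/n) log (L_f^n 1)(x)`. -/
def pressure (f : SymX N → ℝ) : ℝ :=
  ⨆ x : ↥(juliaSet p q), limsup (fun n : ℕ => (n : ℝ)⁻¹ * Real.log (LSum p q f n ↑x)) atTop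

/-- Extension by zero of a function on `J̃` to all of `X`; since `T⁻¹ J̃ = J̃`, the values
outside `J̃` are irrelevant in all expressions below. -/
def jextend (f : ↥(juliaSet p q) → ℝ) : SymX N → ℝ :=
  fun x => if hx : x ∈ juliaSet p q then f ⟨x, hx⟩ else 0

/-- Hölder continuity on `J̃` with respect to the metric `d_X`. -/
def HolderOnJ (f : ↥(juliaSet p q) → ℝ) : Prop :=
  ∃ C : ℝ, 0 < C ∧ ∃ α : ℝ, α ∈ Set.Ioc (0 : ℝ) 1 ∧
    ∀ x y : ↥(juliaSet p q), |f x - f y| ≤ C * dX (x : SymX N) (y : SymX N) ^ α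

/-- `Q(g) = P(f + g) − P(f)`. -/
def Qfun (f g : ↥(juliaSet p q) → ℝ) : ℝ :=
  pressure p q (jextend p q fun x => f x + g x) - pressure p q (jextend p q f)

/-- The Legendre transform `L(m) = sup_g (∫ g dm − Q(g)) ∈ [0, (OnePoint.infty : Sphere)]`. -/
def LLfun (f : ↥(juliaSet p q) → ℝ) (m : ProbabilityMeasure ↥(juliaSet p q)) : EReal :=
  ⨆ g : C(↥(juliaSet p q), ℝ),
    (((∫ x, g x ∂(m : Measure ↥(juliaSet p q))) - Qfun p q f g : ℝ) : EReal)

/-- `ρ(K) = inf_{m ∈ K} L(m)`. -/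
def rho (f : ↥(juliaSet p q) → ℝ) (K : Set (ProbabilityMeasure ↥(juliaSet p q))) : EReal :=
  ⨅ m ∈ K, LLfun p q f m

/-- Membership in `M_T`: `T`-invariance of a probability measure on `J̃`. -/
def MTinv (m : ProbabilityMeasure ↥(juliaSet p q)) : Prop :=
  ∀ A : Set (SymX N), MeasurableSet A →
    ((m : Measure ↥(juliaSet p q)).map Subtype.val) (Tmap p q ⁻¹' A) =
      ((m : Measure ↥(juliaSet p q)).map Subtype.val) A

/-- The orbital measure `μ_{y,n} = (1/n)(δ_y + δ_{Ty} + ⋯ + δ_{T^{n-1}y})`, viewed as a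
measure on `J̃`. -/
def orbMeas (y : SymX N) (n : ℕ) : Measure ↥(juliaSet p q) :=
  Measure.comap Subtype.val
    ((n : ℝ≥0∞)⁻¹ • ∑ k ∈ Finset.range n, Measure.dirac ((Tmap p q)^[k] y))

/-- The (unique, if it exists) probability-measure avatar of `μ` lies in `K`. -/
def inK (μ : Measure ↥(juliaSet p q)) (K : Set (ProbabilityMeasure ↥(juliaSet p q))) : Prop :=
  ∃ ν : ProbabilityMeasure ↥(juliaSet p q), (ν : Measure ↥(juliaSet p q)) = μ ∧ ν ∈ K

/-- The sequence `(1/n) log [Σ_{T^n y = x, μ_{y,n} ∈ K} e^{f^n(y)} / Σ_{T^n y = x} e^{f^n(y)}]`,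
valued in `EReal` with the convention `log 0 = ⊥`. -/
def preimLDSeq (f : ↥(juliaSet p q) → ℝ) (x : SymX N)
    (K : Set (ProbabilityMeasure ↥(juliaSet p q))) : ℕ → EReal := fun n =>
  if (((preimTn p q n x).filter fun y => inK p q (orbMeas p q y n) K).map
        fun y => Real.exp (birk p q (jextend p q f) n y)).sum = 0 then ⊥
  else
    (((n : ℝ)⁻¹ * Real.log
      (((((preimTn p q n x).filter fun y => inK p q (orbMeas p q y n) K).map
          fun y => Real.exp (birk p q (jextend p q f) n y)).sum) /
        LSum p q (jextend p q f) n x) : ℝ) : EReal)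

/-- `Fix_m(T) ∩ J̃` as a multiset. -/
def fixJ (m : ℕ) : Multiset (SymX N) := (fixMultiset p q m).filter fun y => y ∈ juliaSet p q

/-- `Σ_{(ω,ζ) ∈ Fix_m(T) ∩ J̃} e^{f^m(ω,ζ)}`. -/
def fixSum (f : SymX N → ℝ) (m : ℕ) : ℝ :=
  ((fixJ p q m).map fun y => Real.exp (birk p q f m y)).sum

/-- The periodic-point analogue of `preimLDSeq`, with the convention `log 0 = ⊥`. -/
def fixLDSeq (f : ↥(juliaSet p q) → ℝ)
    (K : Set (ProbabilityMeasure ↥(juliaSet p q))) : ℕ → EReal := fun m =>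
  if (((fixJ p q m).filter fun y => inK p q (orbMeas p q y m) K).map
        fun y => Real.exp (birk p q (jextend p q f) m y)).sum = 0 then ⊥
  else
    (((m : ℝ)⁻¹ * Real.log
      (((((fixJ p q m).filter fun y => inK p q (orbMeas p q y m) K).map
          fun y => Real.exp (birk p q (jextend p q f) m y)).sum) /
        fixSum p q (jextend p q f) m) : ℝ) : EReal)

/-! ### Inverse branches -/

/-- Projection of a subset of `X` to the sphere coordinate. -/
def projC (E : Set (SymX N)) : Set Sphere := Prod.snd '' E

/-- For a word `[v₁, …, v_m]`, the composite map `R_{v₁} ∘ R_{v₂} ∘ ⋯ ∘ R_{v_m}`. -/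
def mapWord (l : List (Fin N)) : Sphere → Sphere :=
  l.foldr (fun i f => ratEval (p i) (q i) ∘ f) id

/-- `γ_m(U)`: the total number of analytic inverse branches of `T^m` on `U`, counted over
all `m`-strings.  (A continuous section of a rational map off its critical values is
automatically holomorphic.) -/
def gammaCount (U : Set (SymX N)) (m : ℕ) : ℕ :=
  Nat.card ((v : Fin m → Fin N) ×
    { s : C(↥(projC U), Sphere) // ∀ z : ↥(projC U), mapWord p q (List.ofFn v) (s z) = ↑z })

/-- `C_n = ⋃_{k=1}^n T^k(C)`, the critical values of `T` of order up to `n`. -/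
def critValSet (n : ℕ) : Set (SymX N) :=
  ⋃ k ∈ Finset.Icc 1 n, (Tmap p q)^[k] '' critSet p q

/-- `τ`: the number of distinct critical values of `T` in `U` (projected to the sphere). -/
def tauCount (U : Set (SymX N)) : ℕ := (Prod.snd '' (Tmap p q '' critSet p q ∩ U)).ncard

/-! ### The averaging operator `G` -/

/-- `(G^m h)(x) = D^{-m} Σ_{T^m y = x} h(y)`. -/
def GmFun (h : SymX N → ℝ) (m : ℕ) (x : SymX N) : ℝ :=
  ((Dtot p q : ℝ) ^ m)⁻¹ * ((preimTn p q m x).map h).sum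

/-- The supremum norm on functions on `J̃`. -/
def supJ (f : ↥(juliaSet p q) → ℝ) : ℝ := ⨆ x, |f x|

theorem bloch {h : ℂ → ℂ} {z : ℂ} {R : ℝ} (hR : 0 < R) (hh : DifferentiableOn ℂ h (Metric.ball z R)) :
    ∃ w, Metric.ball w (R * ‖deriv h z‖ / 256) ⊆ h '' Metric.ball z R := by
  by_cases h0 : deriv h z = 0
  · exact ⟨0, by simp [h0]⟩
  have hd : DifferentiableOn ℂ (deriv h) (Metric.ball z R) := hh.deriv Metric.isOpen_ball
  set s := R / 2 with hs
  have hs0 : 0 < s := by positivity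
  have hsub : Metric.closedBall z s ⊆ Metric.ball z R :=
    Metric.closedBall_subset_ball (by linarith)
  obtain ⟨a, ha, hmax⟩ := (isCompact_closedBall z s).exists_isMaxOn
    (f := fun ζ => ‖deriv h ζ‖ * (s - dist ζ z)) ⟨z, by simp [hs0.le]⟩
    (((hd.continuousOn.mono hsub).norm).mul (by fun_prop))
  have hza := hmax (show z ∈ Metric.closedBall z s by simp [hs0.le])
  simp only [Set.mem_setOf_eq, dist_self, sub_zero] at hza
  have hnz : 0 < ‖deriv h z‖ := norm_pos_iff.2 h0
  have hpos : 0 < ‖deriv h a‖ * (s - dist a z) := lt_of_lt_of_le (by positivity) hza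
  have hda : 0 < ‖deriv h a‖ := by
    rcases (norm_nonneg (deriv h a)).eq_or_lt with h1 | h1
    · rw [← h1] at hpos; simp at hpos
    · exact h1
  have hsa : 0 < s - dist a z := by
    by_contra hc
    push Not at hc
    nlinarith
  set t := (s - dist a z) / 2 with ht
  have ht0 : 0 < t := by positivity
  have hbt : ∀ ζ ∈ Metric.ball a t, ζ ∈ Metric.closedBall z s ∧ ‖deriv h ζ‖ ≤ 2 * ‖deriv h a‖ := by
    intro ζ hζ
    rw [Metric.mem_ball] at hζ
    have h1 : dist ζ z ≤ dist ζ a + dist a z := dist_triangle _ _ _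
    have h2 : ζ ∈ Metric.closedBall z s := by rw [Metric.mem_closedBall]; linarith
    refine ⟨h2, ?_⟩
    have h3 := hmax h2
    simp only [Set.mem_setOf_eq] at h3
    have h4 : t ≤ s - dist ζ z := by linarith
    have h5 : ‖deriv h ζ‖ * t ≤ ‖deriv h a‖ * (2 * t) := by
      calc _ ≤ ‖deriv h ζ‖ * (s - dist ζ z) := by gcongr
        _ ≤ _ := by rw [show 2 * t = s - dist a z by rw [ht]; ring]; exact h3
    nlinarith
  have hbsub : Metric.ball a t ⊆ Metric.ball z R := fun ζ hζ => hsub (hbt ζ hζ).1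
  have hsch : ∀ ζ ∈ Metric.ball a t, ‖deriv h ζ - deriv h a‖ ≤ 3 * ‖deriv h a‖ / t * dist ζ a := by
    intro ζ hζ
    rw [← dist_eq_norm]
    refine Complex.dist_le_div_mul_dist_of_mapsTo_ball (hd.mono hbsub) ?_ hζ
    intro x hx
    rw [Metric.mem_closedBall, dist_eq_norm]
    linarith [norm_sub_le (deriv h x) (deriv h a), (hbt x hx).2]
  set r := t / 16 with hr
  have hr0 : 0 < r := by positivity
  have hrt : Metric.closedBall a r ⊆ Metric.ball a t := Metric.closedBall_subset_ball (by linarith)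
  have hlow : ∀ ζ ∈ Metric.closedBall a r, ‖deriv h a‖ / 2 * dist ζ a ≤ ‖h ζ - h a‖ := by
    intro ζ hζ
    have key := (convex_closedBall a r).norm_image_sub_le_of_norm_hasDerivWithin_le
      (f := fun ζ => h ζ - deriv h a * ζ) (f' := fun ζ => deriv h ζ - deriv h a)
      (C := ‖deriv h a‖ / 2) (x := a) (y := ζ) ?_ ?_ (by simp [hr0.le]) hζ
    · have e : h ζ - h a = (h ζ - deriv h a * ζ - (h a - deriv h a * a)) + deriv h a * (ζ - a) := by ring
      have h1 : ‖deriv h a * (ζ - a)‖ = ‖deriv h a‖ * dist ζ a := by rw [norm_mul, dist_eq_norm]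
      rw [← dist_eq_norm ζ a] at key
      have h2 := norm_sub_le_norm_add (deriv h a * (ζ - a)) (h ζ - deriv h a * ζ - (h a - deriv h a * a))
      rw [e, add_comm]
      linarith
    · intro x hx
      have : HasDerivAt h (deriv h x) x :=
        (hh.differentiableAt (Metric.isOpen_ball.mem_nhds (hbsub (hrt hx)))).hasDerivAt
      have h2 := this.sub ((hasDerivAt_id x).const_mul (deriv h a))
      simp only [mul_one] at h2
      exact h2.hasDerivWithinAt
    · intro x hx
      refine (hsch x (hrt hx)).trans ?_
      rw [Metric.mem_closedBall] at hx
      rw [div_mul_eq_mul_div, div_le_iff₀ ht0]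
      nlinarith
  have hfin := DiffContOnCl.ball_subset_image_closedBall (f := h) (z₀ := a) (r := r)
    (ε := ‖deriv h a‖ / 2 * r) ?_ hr0 ?_ ?_
  · refine ⟨h a, fun w hw => ?_⟩
    have : w ∈ Metric.ball (h a) (‖deriv h a‖ / 2 * r / 2) := by
      refine Metric.ball_subset_ball ?_ hw
      have h6 : s * ‖deriv h z‖ ≤ ‖deriv h a‖ * (2 * t) := by
        rw [show 2 * t = s - dist a z by rw [ht]; ring]; linarith
      have : ‖deriv h a‖ / 2 * r / 2 = ‖deriv h a‖ * t / 64 := by rw [hr]; ring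
      rw [this]
      rw [hs] at h6
      linarith
    obtain ⟨x, hx, rfl⟩ := hfin this
    exact ⟨x, hbsub (hrt hx), rfl⟩
  · exact (hh.mono (hrt.trans hbsub)).diffContOnCl_ball subset_rfl
  · intro x hx
    have := hlow x (Metric.sphere_subset_closedBall hx)
    rwa [Metric.mem_sphere.1 hx] at this
  · have : ∀ᶠ x in 𝓝[≠] a, h x ≠ h a := by
      have h1 : Metric.closedBall a r ∈ 𝓝[≠] a := nhdsWithin_le_nhds (Metric.closedBall_mem_nhds a hr0)
      filter_upwards [h1, self_mem_nhdsWithin] with x hx hne heq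
      have := hlow x hx
      rw [heq, sub_self, norm_zero] at this
      have h2 : 0 < dist x a := dist_pos.2 hne
      have : 0 < ‖deriv h a‖ / 2 * dist x a := by positivity
      linarith
    exact this.frequently.filter_mono nhdsWithin_le_nhds

theorem logBranch {f : ℂ → ℂ} {c : ℂ} {R : ℝ} (hR : 0 < R)
    (hf : DifferentiableOn ℂ f (Metric.ball c R)) (h0 : ∀ z ∈ Metric.ball c R, f z ≠ 0) :
    ∃ l : ℂ → ℂ, DifferentiableOn ℂ l (Metric.ball c R) ∧ l c = Complex.log (f c) ∧
      ∀ z ∈ Metric.ball c R, Complex.exp (l z) = f z := by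
  have hd : DifferentiableOn ℂ (deriv f) (Metric.ball c R) := hf.deriv Metric.isOpen_ball
  obtain ⟨l, hlc, hl⟩ := (hd.div hf h0).isExactOn_ball.with_val_at c (Complex.log (f c))
  have hcm : c ∈ Metric.ball c R := Metric.mem_ball_self hR
  have hD : ∀ z ∈ Metric.ball c R, HasDerivAt (fun z => f z * Complex.exp (-l z)) 0 z := by
    intro z hz
    have h1 : HasDerivAt f (deriv f z) z :=
      (hf.differentiableAt (Metric.isOpen_ball.mem_nhds hz)).hasDerivAt
    have h2 := h1.mul ((hl z hz).neg.cexp)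
    have h3 := h0 z hz
    have e : deriv f z * Complex.exp ((-l) z) + f z * (Complex.exp ((-l) z) * -(deriv f / f) z) = 0 := by
      have e : (deriv f / f) z = deriv f z / f z := rfl
      rw [e]
      field_simp
      ring
    rw [e] at h2
    exact h2
  refine ⟨l, fun z hz => (hl z hz).differentiableAt.differentiableWithinAt, hlc, fun z hz => ?_⟩
  have hc := Metric.isOpen_ball.is_const_of_deriv_eq_zero (convex_ball c R).isPreconnected
    (fun z hz => (hD z hz).differentiableAt.differentiableWithinAt)
    (fun z hz => (hD z hz).deriv) hz hcm
  simp only [hlc, Complex.exp_neg, Complex.exp_log (h0 c hcm)] at hc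
  rw [mul_inv_cancel₀ (h0 c hcm)] at hc
  field_simp at hc
  exact hc.symm

theorem cosh_net_aux (w : ℂ) (hw : 0 ≤ w.re) : ∃ u : ℂ, dist u w < 4 ∧ ∃ k : ℤ, Complex.cosh (2 * u) = 2 * k - 1 := by
  obtain ⟨n, hn⟩ : ∃ n : ℕ, n = ⌈Real.exp (2 * w.re)⌉₊ := ⟨_, rfl⟩
  have hn1 : Real.exp (2 * w.re) ≤ n := hn ▸ Nat.le_ceil _
  have hn2 : (n : ℝ) < Real.exp (2 * w.re) + 1 := hn ▸ Nat.ceil_lt_add_one (Real.exp_pos _).le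
  have he1 : 1 ≤ Real.exp (2 * w.re) := Real.one_le_exp (by linarith)
  have hn3 : (1 : ℝ) ≤ n := he1.trans hn1
  set A := Real.sqrt n with hA
  set B := Real.sqrt (n - 1) with hB
  have hA2 : A ^ 2 = n := Real.sq_sqrt (by linarith)
  have hB2 : B ^ 2 = n - 1 := Real.sq_sqrt (by linarith)
  have hA0 : 0 < A := Real.sqrt_pos.2 (by linarith)
  have hB0 : 0 ≤ B := Real.sqrt_nonneg _
  have hBA : B ≤ A := Real.sqrt_le_sqrt (by linarith)
  have hex : Real.exp (2 * w.re) = Real.exp w.re ^ 2 := by rw [sq, ← Real.exp_add]; ring_nf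
  have hp := Real.exp_pos w.re
  have hAx : Real.exp w.re ≤ A := by nlinarith
  have hAy : A ≤ 2 * Real.exp w.re := by nlinarith
  set a := Real.log (A + B) with ha
  have hea : Real.exp a = A + B := Real.exp_log (by positivity)
  have hea' : Real.exp (-a) = A - B := by
    rw [Real.exp_neg, hea]; field_simp; nlinarith
  have ha1 : w.re ≤ a := by
    rw [← Real.exp_le_exp, hea]; linarith
  have ha2 : a ≤ w.re + 2 := by
    rw [← Real.exp_le_exp, hea, Real.exp_add]
    have : (4 : ℝ) ≤ Real.exp 2 := by
      have h1 := Real.add_one_le_exp (1:ℝ)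
      have : Real.exp 2 = Real.exp 1 * Real.exp 1 := by rw [← Real.exp_add]; norm_num
      nlinarith
    nlinarith
  set m : ℤ := round (w.im / Real.pi) with hm
  have hpi := Real.pi_pos
  have him : |w.im - m * Real.pi| ≤ 2 - 1/1000 := by
    have := abs_sub_round (w.im / Real.pi)
    have e : w.im - m * Real.pi = (w.im / Real.pi - m) * Real.pi := by field_simp
    rw [e, abs_mul, abs_of_pos hpi]
    have := Real.pi_lt_d2
    nlinarith
  refine ⟨a + m * Real.pi * Complex.I, ?_, n, ?_⟩
  · rw [dist_eq_norm]
    refine (Complex.norm_le_abs_re_add_abs_im _).trans_lt ?_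
    simp only [Complex.sub_re, Complex.add_re, Complex.ofReal_re, Complex.mul_re, Complex.sub_im,
      Complex.add_im, Complex.ofReal_im, Complex.mul_im, Complex.intCast_re, Complex.intCast_im,
      Complex.I_re, Complex.I_im]
    rw [abs_of_nonneg (by linarith), abs_sub_comm]
    have : (↑m * Real.pi - 0 * 0) * 1 + (↑m * 0 + 0 * Real.pi) * 0 = m * Real.pi := by ring
    ring_nf at him ⊢
    linarith
  · have e : ∀ x : ℂ, Complex.exp (x + m * (2 * Real.pi * Complex.I)) = Complex.exp x := fun x => by
      rw [Complex.exp_add, Complex.exp_int_mul_two_pi_mul_I, mul_one]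
    have e1 : Complex.exp (2 * (a + m * Real.pi * Complex.I)) = (A + B : ℂ) ^ 2 := by
      rw [show (2 * (a + m * Real.pi * Complex.I) : ℂ) = (a + a) + m * (2 * Real.pi * Complex.I) by ring,
        e, Complex.exp_add, ← Complex.ofReal_exp, hea]
      push_cast; ring
    have e2 : Complex.exp (-(2 * (a + m * Real.pi * Complex.I))) = (A - B : ℂ) ^ 2 := by
      rw [Complex.exp_neg, e1, inv_eq_iff_eq_inv, eq_comm, inv_eq_iff_eq_inv, eq_comm]
      have : ((A : ℂ) + B) * (A - B) = 1 := by
        have : (A + B) * (A - B) = 1 := by nlinarith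
        exact_mod_cast this
      refine (inv_eq_of_mul_eq_one_left ?_)
      rw [← mul_pow, mul_comm, this, one_pow]
    rw [Complex.cosh, e1, e2]
    have h1 : (A : ℂ) ^ 2 = n := by exact_mod_cast hA2
    have h2 : (B : ℂ) ^ 2 = n - 1 := by exact_mod_cast hB2
    push_cast
    linear_combination h1 + h2

theorem cosh_net (w : ℂ) : ∃ u : ℂ, dist u w < 4 ∧ ∃ k : ℤ, Complex.cosh (2 * u) = 2 * k - 1 := by
  rcases le_total 0 w.re with h | h
  · exact cosh_net_aux w h
  · obtain ⟨u, h1, k, h2⟩ := cosh_net_aux (-w) (by simpa using h)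
    exact ⟨-u, by rw [← dist_neg_neg, neg_neg]; exact h1, k, by rw [mul_neg, Complex.cosh_neg, h2]⟩

theorem schottky1 : ∃ C : ℝ, 0 < C ∧ ∀ (f : ℂ → ℂ) (c : ℂ) (R : ℝ), 0 < R →
    DifferentiableOn ℂ f (Metric.ball c R) → (∀ z ∈ Metric.ball c R, f z ≠ 0 ∧ f z ≠ 1) →
    1 / 2 ≤ ‖f c‖ → ‖f c‖ ≤ 2 → ∀ z ∈ Metric.ball c (R / 2), ‖f z‖ ≤ C := by
  refine ⟨Real.exp (2 * Real.pi * ((Real.exp (2 * 2000) + 1) / 2)), by positivity, ?_⟩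
  intro f c R hR hf hom hlo hhi z hz
  have hcm : c ∈ Metric.ball c R := Metric.mem_ball_self hR
  obtain ⟨l, hld, hlc, hl⟩ := logBranch hR hf (fun z hz => (hom z hz).1)
  have hpi := Real.pi_gt_three
  have hpi4 := Real.pi_lt_d2
  have h2pi : (2 * Real.pi * Complex.I : ℂ) ≠ 0 := Complex.two_pi_I_ne_zero
  have hlog2 : Real.log 2 < 1 := by have := Real.log_two_lt_d9; linarith
  have hnormlog : ∀ (u : ℂ) (b : ℝ), 0 < b → b⁻¹ ≤ ‖u‖ → ‖u‖ ≤ b → ‖Complex.log u‖ ≤ Real.log b + 4 := by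
    intro u b hb h1 h2
    have hu : 0 < ‖u‖ := lt_of_lt_of_le (by positivity) h1
    refine (Complex.norm_le_abs_re_add_abs_im _).trans ?_
    have h3 : |(Complex.log u).re| ≤ Real.log b := by
      rw [Complex.log_re, abs_le, ← Real.log_inv]
      exact ⟨Real.log_le_log (by positivity) h1, Real.log_le_log hu h2⟩
    have h4 : |(Complex.log u).im| ≤ Real.pi := by
      rw [Complex.log_im]; exact Complex.abs_arg_le_pi u
    linarith
  set F : ℂ → ℂ := fun z => l z / (2 * Real.pi * Complex.I) with hF
  have hFd : DifferentiableOn ℂ F (Metric.ball c R) := hld.div_const _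
  have hFf : ∀ z ∈ Metric.ball c R, Complex.exp (F z * (2 * Real.pi * Complex.I)) = f z := by
    intro z hz; rw [← hl z hz]; simp only [hF]; rw [div_mul_cancel₀ _ h2pi]
  have hFint : ∀ z ∈ Metric.ball c R, ∀ k : ℤ, F z ≠ k := by
    intro z hz k hk
    apply (hom z hz).2
    rw [← hFf z hz, hk, Complex.exp_int_mul_two_pi_mul_I]
  have hFc : ‖F c‖ ≤ 1 := by
    have : ‖(2 * Real.pi * Complex.I : ℂ)‖ = 2 * Real.pi := by
      simp [abs_of_pos Real.pi_pos]
    simp only [hF]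
    rw [norm_div, this, div_le_one (by positivity), hlc]
    have := hnormlog (f c) 2 (by norm_num) (by simpa using hlo) hhi
    linarith
  obtain ⟨a, had, hac, ha⟩ := logBranch hR hFd (fun z hz => by simpa using hFint z hz 0)
  obtain ⟨b, hbd, hbc, hb⟩ := logBranch (f := fun z => F z - 1) hR (hFd.sub_const 1)
    (fun z hz => sub_ne_zero.2 (by simpa using hFint z hz 1))
  set A : ℂ → ℂ := fun z => Complex.exp (a z / 2)
  set B : ℂ → ℂ := fun z => Complex.exp (b z / 2)
  have hA2 : ∀ z ∈ Metric.ball c R, A z ^ 2 = F z := by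
    intro z hz; simp only [A]; rw [← ha z hz, sq, ← Complex.exp_add]; ring_nf
  have hB2 : ∀ z ∈ Metric.ball c R, B z ^ 2 = F z - 1 := by
    intro z hz; simp only [B]; rw [← hb z hz, sq, ← Complex.exp_add]; ring_nf
  have hAB : ∀ z ∈ Metric.ball c R, (A z - B z) * (A z + B z) = 1 := by
    intro z hz; linear_combination hA2 z hz - hB2 z hz
  have hHd : DifferentiableOn ℂ (fun z => A z - B z) (Metric.ball c R) :=
    (had.div_const 2).cexp.sub (hbd.div_const 2).cexp
  have hH0 : ∀ z ∈ Metric.ball c R, A z - B z ≠ 0 := by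
    intro z hz h; have := hAB z hz; rw [h, zero_mul] at this; exact zero_ne_one this
  obtain ⟨g, hgd, hgc, hg⟩ := logBranch hR hHd hH0
  have hgcosh : ∀ z ∈ Metric.ball c R, Complex.cosh (2 * g z) = 2 * F z - 1 := by
    intro z hz
    have e2 : Complex.exp (-(g z)) = A z + B z := by
      rw [Complex.exp_neg, hg z hz]; exact inv_eq_of_mul_eq_one_right (hAB z hz)
    rw [Complex.cosh, show -(2 * g z) = -(g z) + -(g z) by ring, two_mul (g z), Complex.exp_add,
      Complex.exp_add, hg z hz, e2]
    linear_combination hA2 z hz + hB2 z hz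
  have hgc5 : ‖g c‖ ≤ 10 := by
    have hAc : ‖A c‖ ≤ 1 := by
      have := congrArg norm (hA2 c hcm); rw [norm_pow] at this
      nlinarith [norm_nonneg (A c)]
    have hBc : ‖B c‖ ≤ 2 := by
      have := congrArg norm (hB2 c hcm); rw [norm_pow] at this
      have h1 := norm_sub_le (F c) 1
      rw [norm_one] at h1
      nlinarith [norm_nonneg (B c)]
    have h1 : ‖A c - B c‖ ≤ 3 := (norm_sub_le _ _).trans (by linarith)
    have h2 : ‖A c + B c‖ ≤ 3 := (norm_add_le _ _).trans (by linarith)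
    have h3 : (3 : ℝ)⁻¹ ≤ ‖A c - B c‖ := by
      have := congrArg norm (hAB c hcm)
      rw [norm_mul, norm_one] at this
      rw [inv_le_iff_one_le_mul₀ (by norm_num)]
      nlinarith [norm_nonneg (A c - B c)]
    rw [hgc]
    have := hnormlog _ 3 (by norm_num) h3 h1
    have h5 : Real.log 3 ≤ 2 := by
      have := Real.log_le_sub_one_of_pos (show (0:ℝ) < 3 by norm_num); linarith
    linarith
  have hzR : ∀ x ∈ Metric.ball c (R / 2), Metric.ball x (R / 2) ⊆ Metric.ball c R := by
    intro x hx
    apply Metric.ball_subset_ball'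
    rw [Metric.mem_ball] at hx; linarith
  have hgder : ∀ x ∈ Metric.ball c (R / 2), ‖deriv g x‖ ≤ 2048 / R := by
    intro x hx
    obtain ⟨w, hw⟩ := bloch (h := g) (z := x) (half_pos hR) (hgd.mono (hzR x hx))
    by_contra hcon
    push Not at hcon
    rw [div_lt_iff₀ hR] at hcon
    obtain ⟨u, hu, k, hk⟩ := cosh_net w
    obtain ⟨y, hy, hyu⟩ := hw (show u ∈ Metric.ball w (R / 2 * ‖deriv g x‖ / 256) by
      rw [Metric.mem_ball]; linarith)
    have hy' := hzR x hx hy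
    have h1 := hgcosh y hy'
    rw [hyu, hk] at h1
    exact hFint y hy' k (by linear_combination -h1 / 2)
  have hsub : Metric.ball c (R / 2) ⊆ Metric.ball c R := Metric.ball_subset_ball (by linarith)
  have hzR' := hsub hz
  have hgz : ‖g z‖ ≤ 2000 := by
    have := (convex_ball c (R / 2)).norm_image_sub_le_of_norm_deriv_le (f := g) (C := 2048 / R)
      (x := c) (y := z)
      (fun x hx => hgd.differentiableAt (Metric.isOpen_ball.mem_nhds (hsub hx))) hgder
      (Metric.mem_ball_self (half_pos hR)) hz
    have h1 : ‖z - c‖ ≤ R / 2 := by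
      rw [← dist_eq_norm]; exact (Metric.mem_ball.1 hz).le
    have h2 : 2048 / R * ‖z - c‖ ≤ 1024 := by
      rw [div_mul_eq_mul_div, div_le_iff₀ hR]; linarith
    have h3 := norm_le_norm_add_norm_sub (g c) (g z)
    rw [norm_sub_rev] at h3
    linarith
  have hcoshb : ‖Complex.cosh (2 * g z)‖ ≤ Real.exp (2 * 2000) := by
    rw [Complex.cosh, norm_div]
    have h1 : ‖(2:ℂ) * g z‖ ≤ 2 * 2000 := by rw [norm_mul]; norm_num; linarith
    have h2 := Complex.norm_exp_le_exp_norm (2 * g z)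
    have h3 := Complex.norm_exp_le_exp_norm (-(2 * g z))
    rw [norm_neg] at h3
    have h4 := Real.exp_le_exp.2 h1
    have h5 := norm_add_le (Complex.exp (2 * g z)) (Complex.exp (-(2 * g z)))
    rw [Complex.norm_two, div_le_iff₀ (by norm_num)]
    linarith
  have hFz : ‖F z‖ ≤ (Real.exp (2 * 2000) + 1) / 2 := by
    have e : F z = (Complex.cosh (2 * g z) + 1) / 2 := by rw [hgcosh z hzR']; ring
    rw [e, norm_div, Complex.norm_two]
    have := norm_add_le (Complex.cosh (2 * g z)) 1
    rw [norm_one] at this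
    gcongr
    linarith
  rw [← hFf z hzR']
  refine (Complex.norm_exp_le_exp_norm _).trans ?_
  rw [Real.exp_le_exp, norm_mul]
  have : ‖(2 * Real.pi * Complex.I : ℂ)‖ = 2 * Real.pi := by
    simp [abs_of_pos Real.pi_pos]
  rw [this, mul_comm]
  gcongr

theorem schottky : ∃ C : ℝ, 1 ≤ C ∧ ∀ (f : ℂ → ℂ) (c : ℂ) (R : ℝ), 0 < R →
    DifferentiableOn ℂ f (Metric.ball c R) → (∀ z ∈ Metric.ball c R, f z ≠ 0 ∧ f z ≠ 1) →
    ‖f c‖ ≤ 1 → ∀ z ∈ Metric.ball c (R / 2), ‖f z‖ ≤ C := by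
  obtain ⟨C, hC, h⟩ := schottky1
  refine ⟨C + 1, by linarith, ?_⟩
  intro f c R hR hf hom hc z hz
  by_cases h2 : 1 / 2 ≤ ‖f c‖
  · exact (h f c R hR hf hom h2 (by linarith) z hz).trans (by linarith)
  · push Not at h2
    have h3 := norm_sub_norm_le 1 (f c)
    have h4 := norm_sub_le 1 (f c)
    rw [norm_one] at h3 h4
    have := h (fun z => 1 - f z) c R hR (hf.const_sub 1) (fun z hz => ⟨?_, ?_⟩) (by linarith) (by linarith) z hz
    · have h5 := norm_sub_norm_le (f z) 1
      rw [norm_sub_rev, norm_one] at h5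
      linarith
    · exact sub_ne_zero.2 (Ne.symm (hom z hz).2)
    · intro h; exact (hom z hz).1 (by linear_combination -h)

/-- stereographic embedding -/
def emb : Sphere → WithLp 2 (ℂ × ℝ) := fun z =>
  OnePoint.elim z (WithLp.toLp 2 ((0 : ℂ), (1 : ℝ)))
    (fun a => WithLp.toLp 2 ((((2 / (1 + ‖a‖ ^ 2) : ℝ) : ℂ)) * a, (‖a‖ ^ 2 - 1) / (1 + ‖a‖ ^ 2)))

theorem sphDist_coe (a b : ℂ) : sphDist (a : Sphere) (b : Sphere) =
    2 * dist a b / (Real.sqrt (1 + ‖a‖ ^ 2) * Real.sqrt (1 + ‖b‖ ^ 2)) := rfl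

theorem sphDist_coe_infty (a : ℂ) : sphDist (a : Sphere) (OnePoint.infty : Sphere) =
    2 / Real.sqrt (1 + ‖a‖ ^ 2) := rfl

theorem sphDist_infty_coe (a : ℂ) : sphDist (OnePoint.infty : Sphere) (a : Sphere) =
    2 / Real.sqrt (1 + ‖a‖ ^ 2) := rfl

theorem sphDist_infty_infty : sphDist (OnePoint.infty : Sphere) (OnePoint.infty : Sphere) = 0 := rfl

theorem sphDist_comm (x y : Sphere) : sphDist x y = sphDist y x := by
  induction x using OnePoint.rec <;> induction y using OnePoint.rec
  · rfl
  · rfl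
  · rfl
  · rw [sphDist_coe, sphDist_coe, dist_comm, mul_comm (Real.sqrt _)]

theorem norm_sq_eq (a : ℂ) : ‖a‖ ^ 2 = a.re ^ 2 + a.im ^ 2 := by
  rw [← Complex.normSq_eq_norm_sq, Complex.normSq_apply]; ring

theorem dist_toLp (a c : ℂ) (b d : ℝ) : dist (WithLp.toLp 2 (a, b)) (WithLp.toLp 2 (c, d)) =
    Real.sqrt (‖a - c‖ ^ 2 + (b - d) ^ 2) := by
  rw [WithLp.prod_dist_eq_of_L2]
  show Real.sqrt (dist a c ^ 2 + dist b d ^ 2) = _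
  rw [dist_eq_norm, Real.dist_eq, sq_abs]

theorem dist_emb (x y : Sphere) : dist (emb x) (emb y) = sphDist x y := by
  have key : ∀ a : ℂ, dist (emb (a : Sphere)) (emb (OnePoint.infty : Sphere)) = 2 / Real.sqrt (1 + ‖a‖ ^ 2) := by
    intro a
    simp only [emb, OnePoint.elim_some, OnePoint.elim_infty]
    rw [dist_toLp]
    have h1 : (0 : ℝ) < 1 + ‖a‖ ^ 2 := by positivity
    rw [show (2 : ℝ) / Real.sqrt (1 + ‖a‖ ^ 2) = Real.sqrt (4 / (1 + ‖a‖ ^ 2)) by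
      rw [Real.sqrt_div (by norm_num), show (4 : ℝ) = 2 ^ 2 by norm_num, Real.sqrt_sq (by norm_num)]]
    congr 1
    rw [sub_zero, norm_mul, Complex.norm_real, Real.norm_eq_abs]
    rw [mul_pow, sq_abs]
    field_simp
    ring
  induction x using OnePoint.rec <;> induction y using OnePoint.rec
  · simp [sphDist_infty_infty]
  · rename_i a; rw [dist_comm, key, sphDist_infty_coe]
  · rename_i a; rw [key, sphDist_coe_infty]
  · rename_i a b
    rw [sphDist_coe]
    simp only [emb, OnePoint.elim_some]
    rw [dist_toLp]
    have h1 : (0 : ℝ) < 1 + ‖a‖ ^ 2 := by positivity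
    have h2 : (0 : ℝ) < 1 + ‖b‖ ^ 2 := by positivity
    rw [← Real.sqrt_mul h1.le, show 2 * dist a b / Real.sqrt ((1 + ‖a‖ ^ 2) * (1 + ‖b‖ ^ 2)) =
      Real.sqrt (4 * dist a b ^ 2 / ((1 + ‖a‖ ^ 2) * (1 + ‖b‖ ^ 2))) by
      rw [Real.sqrt_div (by positivity), show 4 * dist a b ^ 2 = (2 * dist a b) ^ 2 by ring,
        Real.sqrt_sq (by positivity)]]
    congr 1
    rw [dist_eq_norm]
    have h3 : ‖a‖ ^ 2 = a.re ^ 2 + a.im ^ 2 := norm_sq_eq a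
    have h4 : ‖b‖ ^ 2 = b.re ^ 2 + b.im ^ 2 := norm_sq_eq b
    rw [norm_sq_eq, norm_sq_eq (a - b)]
    rw [h3] at h1
    rw [h4] at h2
    simp only [Complex.sub_re, Complex.sub_im, Complex.mul_re, Complex.mul_im, Complex.ofReal_re,
      Complex.ofReal_im, h3, h4, zero_mul, sub_zero, add_zero]
    field_simp
    ring

theorem sphDist_eq_zero {x y : Sphere} (h : sphDist x y = 0) : x = y := by
  induction x using OnePoint.rec <;> induction y using OnePoint.rec
  · rfl
  · rename_i a
    rw [sphDist_infty_coe] at h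
    have : (0:ℝ) < 2 / Real.sqrt (1 + ‖a‖ ^ 2) := by positivity
    linarith
  · rename_i a
    rw [sphDist_coe_infty] at h
    have : (0:ℝ) < 2 / Real.sqrt (1 + ‖a‖ ^ 2) := by positivity
    linarith
  · rename_i a b
    rw [sphDist_coe] at h
    have h1 : (0:ℝ) < Real.sqrt (1 + ‖a‖ ^ 2) * Real.sqrt (1 + ‖b‖ ^ 2) := by positivity
    rw [div_eq_zero_iff] at h
    rcases h with h | h
    · have : dist a b = 0 := by linarith
      rw [dist_eq_zero.1 this]
    · exact absurd h h1.ne'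

theorem emb_inj : Function.Injective emb := by
  intro x y h
  apply sphDist_eq_zero
  rw [← dist_emb, h, dist_self]

theorem emb_cont : Continuous emb := by
  rw [OnePoint.continuous_iff]
  constructor
  · rw [Filter.coclosedCompact_eq_cocompact, ← Metric.cobounded_eq_cocompact,
      tendsto_iff_dist_tendsto_zero]
    simp only [dist_emb, sphDist_coe_infty]
    have h1 : Tendsto (fun a : ℂ => Real.sqrt (1 + ‖a‖ ^ 2)) (Bornology.cobounded ℂ) atTop := by
      refine tendsto_atTop_mono (fun a => ?_) tendsto_norm_cobounded_atTop
      exact Real.le_sqrt_of_sq_le (by linarith)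
    exact h1.const_div_atTop 2
  · have : Continuous fun a : ℂ => (((((2 / (1 + ‖a‖ ^ 2) : ℝ) : ℂ)) * a, (‖a‖ ^ 2 - 1) / (1 + ‖a‖ ^ 2)) : ℂ × ℝ) := by
      have h : ∀ a : ℂ, 1 + ‖a‖ ^ 2 ≠ 0 := fun a => by positivity
      refine Continuous.prodMk ?_ ?_
      · exact (Complex.continuous_ofReal.comp (continuous_const.div (by fun_prop) h)).mul continuous_id
      · exact Continuous.div (by fun_prop) (by fun_prop) h
    exact (WithLp.prod_continuous_toLp 2 ℂ ℝ).comp this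

theorem emb_isEmbedding : IsEmbedding emb := (emb_cont.isClosedEmbedding emb_inj).isEmbedding

/-- the chordal metric as a metric space structure compatible with the topology -/
@[reducible] def sphMetric : MetricSpace Sphere := emb_isEmbedding.comapMetricSpace emb

theorem sphDist_eq (x y : Sphere) : sphDist x y = @dist Sphere sphMetric.toDist x y := (dist_emb x y).symm

theorem sphDist_triangle (x y z : Sphere) : sphDist x z ≤ sphDist x y + sphDist y z := by
  simp only [← dist_emb]; exact dist_triangle _ _ _

theorem sphDist_nonneg (x y : Sphere) : 0 ≤ sphDist x y := by
  rw [← dist_emb]; exact dist_nonneg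

theorem sphDist_self (x : Sphere) : sphDist x x = 0 := by
  rw [← dist_emb, dist_self]

theorem sphDist_continuous : Continuous fun x : Sphere × Sphere => sphDist x.1 x.2 := by
  simp only [← dist_emb]
  exact (emb_cont.comp continuous_fst).dist (emb_cont.comp continuous_snd)

theorem sphDist_coe_le (a b : ℂ) : sphDist (a : Sphere) (b : Sphere) ≤ 2 * dist a b := by
  rw [sphDist_coe]
  apply div_le_self (by positivity)
  have h : ∀ x : ℂ, 1 ≤ Real.sqrt (1 + ‖x‖ ^ 2) := fun x => by
    rw [Real.one_le_sqrt]; nlinarith [sq_nonneg ‖x‖]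
  nlinarith [h a, h b]

theorem sphDist_coe_inv {a b : ℂ} (ha : a ≠ 0) (hb : b ≠ 0) :
    sphDist ((a⁻¹ : ℂ) : Sphere) ((b⁻¹ : ℂ) : Sphere) = sphDist (a : Sphere) (b : Sphere) := by
  rw [sphDist_coe, sphDist_coe, dist_inv_inv₀ ha hb]
  have h : ∀ x : ℂ, x ≠ 0 → Real.sqrt (1 + ‖x⁻¹‖ ^ 2) = Real.sqrt (1 + ‖x‖ ^ 2) / ‖x‖ := fun x hx => by
    have h0 : 0 < ‖x‖ := norm_pos_iff.2 hx
    rw [eq_div_iff h0.ne', ← Real.sqrt_sq h0.le, ← Real.sqrt_mul (by positivity), norm_inv, Real.sqrt_sq h0.le]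
    congr 1
    field_simp
    ring
  rw [h a ha, h b hb]
  have h0 : 0 < ‖a‖ := norm_pos_iff.2 ha
  have h1 : 0 < ‖b‖ := norm_pos_iff.2 hb
  field_simp

theorem ball_in_aux {b z : ℂ} {ρ : ℝ} (hz : z ∈ Metric.ball b (ρ / 8)) (hρ : 0 < ρ) :
    Metric.ball z (ρ / 4) ⊆ Metric.ball b (ρ / 2) := by
  apply Metric.ball_subset_ball'
  rw [Metric.mem_ball] at hz; linarith

theorem net_core {C κ : ℝ} (hκ : 0 < κ) {S0 : Finset ℂ}
    (hS : ∀ w : ℂ, ‖w‖ ≤ C → ∃ s ∈ S0, dist s w < κ) {φ : ℂ → ℂ} {b : ℂ} {ρ : ℝ} (hρ : 0 < ρ)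
    (hφ : DifferentiableOn ℂ φ (Metric.ball b (ρ / 2))) (hC : ∀ z ∈ Metric.ball b (ρ / 2), ‖φ z‖ ≤ C)
    (hav : ∀ z ∈ Metric.ball b (ρ / 2), φ z ∉ S0) {z z' : ℂ} (hz : z ∈ Metric.ball b (ρ / 8))
    (hz' : z' ∈ Metric.ball b (ρ / 8)) : dist (φ z) (φ z') ≤ 256 * κ := by
  have hsub : Metric.ball b (ρ / 8) ⊆ Metric.ball b (ρ / 2) := Metric.ball_subset_ball (by linarith)
  have hder : ∀ x ∈ Metric.ball b (ρ / 8), ‖deriv φ x‖ ≤ 1024 * κ / ρ := by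
    intro x hx
    have h1 := ball_in_aux hx hρ
    obtain ⟨w, hw⟩ := bloch (h := φ) (z := x) (show 0 < ρ / 4 by positivity) (hφ.mono h1)
    by_contra hcon
    push Not at hcon
    rw [div_lt_iff₀ hρ] at hcon
    have hr : κ < ρ / 4 * ‖deriv φ x‖ / 256 := by linarith
    obtain ⟨y, hy, hyw⟩ := hw (Metric.mem_ball_self (hκ.trans hr))
    obtain ⟨s, hs, hsw⟩ := hS w (hyw ▸ hC y (h1 hy))
    obtain ⟨y', hy', hys⟩ := hw (show s ∈ _ from Metric.mem_ball.2 (hsw.trans hr))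
    exact hav y' (h1 hy') (hys ▸ hs)
  have := (convex_ball b (ρ / 8)).norm_image_sub_le_of_norm_deriv_le (f := φ) (C := 1024 * κ / ρ)
      (fun x hx => hφ.differentiableAt (Metric.isOpen_ball.mem_nhds (hsub hx))) hder hz' hz
  rw [← dist_eq_norm, ← dist_eq_norm] at this
  refine this.trans ?_
  have h2 : dist z z' ≤ ρ / 4 := by
    have := dist_triangle_right z z' b
    rw [Metric.mem_ball] at hz hz'
    linarith
  rw [div_mul_eq_mul_div, div_le_iff₀ hρ]
  nlinarith

theorem inv_props {φ : ℂ → ℂ} {b : ℂ} {ρ : ℝ} 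
    (hφ : DifferentiableOn ℂ φ (Metric.ball b ρ)) (hom : ∀ z ∈ Metric.ball b ρ, φ z ≠ 0 ∧ φ z ≠ 1) :
    DifferentiableOn ℂ (fun z => (φ z)⁻¹) (Metric.ball b ρ) ∧
    ∀ z ∈ Metric.ball b ρ, (φ z)⁻¹ ≠ 0 ∧ (φ z)⁻¹ ≠ 1 := by
  refine ⟨hφ.inv (fun z hz => (hom z hz).1), fun z hz => ⟨inv_ne_zero (hom z hz).1, ?_⟩⟩
  rw [Ne, inv_eq_one]
  exact (hom z hz).2

theorem netLemma (η : ℝ) (hη : 0 < η) : ∃ S : Finset ℂ, 0 ∈ S ∧ 1 ∈ S ∧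
    ∀ (b : ℂ) (ρ : ℝ) (φ : ℂ → ℂ), 0 < ρ → DifferentiableOn ℂ φ (Metric.ball b ρ) →
      (∀ z ∈ Metric.ball b ρ, φ z ∉ S) →
      ∀ z ∈ Metric.ball b (ρ / 8), ∀ z' ∈ Metric.ball b (ρ / 8),
        sphDist (φ z : Sphere) (φ z' : Sphere) ≤ η := by
  obtain ⟨C, hC1, hC⟩ := schottky
  obtain ⟨κ, hκd⟩ : ∃ κ : ℝ, κ = η / 512 := ⟨_, rfl⟩
  have hκ : 0 < κ := by rw [hκd]; positivity
  obtain ⟨T, -, hTf, hT⟩ := (isCompact_closedBall (0 : ℂ) C).finite_cover_balls hκ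
  let S0 := hTf.toFinset
  have hS0 : ∀ w : ℂ, ‖w‖ ≤ C → ∃ s ∈ S0, dist s w < κ := by
    intro w hw
    have := hT (show w ∈ Metric.closedBall 0 C by simpa using hw)
    simp only [Set.mem_iUnion] at this
    obtain ⟨s, hs, hws⟩ := this
    exact ⟨s, by simpa [S0] using hs, by rw [dist_comm]; exact hws⟩
  refine ⟨{0, 1} ∪ S0 ∪ S0.image (fun s => s⁻¹), by simp, by simp, ?_⟩
  intro b ρ φ hρ hφ hav z hz z' hz'
  have hom : ∀ z ∈ Metric.ball b ρ, φ z ≠ 0 ∧ φ z ≠ 1 := by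
    intro z hz
    have := hav z hz
    simp only [Finset.mem_union, Finset.mem_insert, Finset.mem_singleton, not_or] at this
    exact this.1.1
  have hsub : Metric.ball b (ρ / 2) ⊆ Metric.ball b ρ := Metric.ball_subset_ball (by linarith)
  have hsub8 : Metric.ball b (ρ / 8) ⊆ Metric.ball b ρ := Metric.ball_subset_ball (by linarith)
  by_cases hb : ‖φ b‖ ≤ 1
  · have := net_core hκ hS0 hρ (hφ.mono hsub) (hC φ b ρ hρ hφ hom hb) (fun x hx => ?_) hz hz'
    · have h2 := sphDist_coe_le (φ z) (φ z')
      linarith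
    · have := hav x (hsub hx)
      simp only [Finset.mem_union, not_or] at this
      exact this.1.2
  · obtain ⟨hφi, homi⟩ := inv_props hφ hom
    have hbi : ‖(φ b)⁻¹‖ ≤ 1 := by
      rw [norm_inv]; exact inv_le_one_of_one_le₀ (not_le.1 hb).le
    have := net_core hκ hS0 hρ (hφi.mono hsub) (hC _ b ρ hρ hφi homi hbi) (fun x hx => ?_) hz hz'
    · have h2 := sphDist_coe_le ((φ z)⁻¹) ((φ z')⁻¹)
      rw [sphDist_coe_inv (hom z (hsub8 hz)).1 (hom z' (hsub8 hz')).1] at h2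
      linarith
    · have := hav x (hsub hx)
      simp only [Finset.mem_union, not_or] at this
      intro hmem
      exact this.2 (Finset.mem_image.2 ⟨_, hmem, inv_inv _⟩)

theorem lip_core {C : ℝ} {φ : ℂ → ℂ} {b : ℂ} {ρ : ℝ} (hρ : 0 < ρ)
    (hφ : DifferentiableOn ℂ φ (Metric.ball b (ρ / 2))) (hC : ∀ z ∈ Metric.ball b (ρ / 2), ‖φ z‖ ≤ C)
    {z z' : ℂ} (hz : z ∈ Metric.ball b (ρ / 8))
    (hz' : z' ∈ Metric.ball b (ρ / 8)) : dist (φ z) (φ z') ≤ 8 * C / ρ * dist z z' := by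
  have hd : dist z z' < ρ / 4 := by
    have := dist_triangle_right z z' b
    rw [Metric.mem_ball] at hz hz'
    linarith
  have h1 := ball_in_aux hz' hρ
  have := Complex.dist_le_div_mul_dist_of_mapsTo_ball (f := φ) (c := z') (R₁ := ρ / 4) (R₂ := 2 * C)
    (hφ.mono h1) (fun x hx => ?_) (z := z) hd
  · refine this.trans (le_of_eq ?_)
    field_simp
    ring
  · rw [Metric.mem_closedBall, dist_eq_norm]
    have h2 := hC x (h1 hx)
    have h3 := hC z' (h1 (Metric.mem_ball_self (by positivity)))
    linarith [norm_sub_le (φ x) (φ z')]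

theorem montelLip : ∃ C : ℝ, 0 < C ∧ 
    ∀ (b : ℂ) (ρ : ℝ) (φ : ℂ → ℂ), 0 < ρ → DifferentiableOn ℂ φ (Metric.ball b ρ) →
      (∀ z ∈ Metric.ball b ρ, φ z ≠ 0 ∧ φ z ≠ 1) →
      ∀ z ∈ Metric.ball b (ρ / 8), ∀ z' ∈ Metric.ball b (ρ / 8),
        sphDist (φ z : Sphere) (φ z' : Sphere) ≤ C / ρ * dist z z' := by
  obtain ⟨C, hC1, hC⟩ := schottky
  refine ⟨16 * C, by linarith, ?_⟩
  intro b ρ φ hρ hφ hom z hz z' hz'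
  have hsub : Metric.ball b (ρ / 2) ⊆ Metric.ball b ρ := Metric.ball_subset_ball (by linarith)
  have hsub8 : Metric.ball b (ρ / 8) ⊆ Metric.ball b ρ := Metric.ball_subset_ball (by linarith)
  have e : 16 * C / ρ * dist z z' = 2 * (8 * C / ρ * dist z z') := by ring
  rw [e]
  by_cases hb : ‖φ b‖ ≤ 1
  · have := lip_core hρ (hφ.mono hsub) (hC φ b ρ hρ hφ hom hb) hz hz'
    have h2 := sphDist_coe_le (φ z) (φ z')
    linarith
  · obtain ⟨hφi, homi⟩ := inv_props hφ hom
    have hbi : ‖(φ b)⁻¹‖ ≤ 1 := by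
      rw [norm_inv]; exact inv_le_one_of_one_le₀ (not_le.1 hb).le
    have := lip_core hρ (hφi.mono hsub) (hC _ b ρ hρ hφi homi hbi) hz hz'
    have h2 := sphDist_coe_le ((φ z)⁻¹) ((φ z')⁻¹)
    rw [sphDist_coe_inv (hom z (hsub8 hz)).1 (hom z' (hsub8 hz')).1] at h2
    linarith

/-- inversion on the sphere -/
def sinv : Sphere → Sphere := fun z =>
  OnePoint.elim z ((0 : ℂ) : Sphere) (fun a => if a = 0 then (OnePoint.infty : Sphere) else ((a⁻¹ : ℂ) : Sphere))

theorem sinv_infty : sinv (OnePoint.infty : Sphere) = ((0 : ℂ) : Sphere) := rfl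
theorem sinv_zero : sinv ((0 : ℂ) : Sphere) = (OnePoint.infty : Sphere) := by simp [sinv]
theorem sinv_coe {a : ℂ} (h : a ≠ 0) : sinv (a : Sphere) = ((a⁻¹ : ℂ) : Sphere) := by simp [sinv, h]

theorem sinv_sinv (z : Sphere) : sinv (sinv z) = z := by
  induction z using OnePoint.rec with
  | infty => rw [sinv_infty, sinv_zero]
  | coe a =>
    by_cases h : a = 0
    · rw [h, sinv_zero, sinv_infty]
    · rw [sinv_coe h, sinv_coe (inv_ne_zero h), inv_inv]

theorem sinv_inj : Function.Injective sinv := Function.LeftInverse.injective sinv_sinv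

theorem sphDist_sinv (x y : Sphere) : sphDist (sinv x) (sinv y) = sphDist x y := by
  have key : ∀ a : ℂ, sphDist (sinv a) (sinv (OnePoint.infty : Sphere)) = sphDist (a : Sphere) (OnePoint.infty : Sphere) := by
    intro a
    by_cases ha : a = 0
    · rw [ha, sinv_zero, sinv_infty, sphDist_comm]
    · rw [sinv_coe ha, sinv_infty, sphDist_coe, sphDist_coe_infty]
      have h0 : 0 < ‖a‖ := norm_pos_iff.2 ha
      have : Real.sqrt (1 + ‖a⁻¹‖ ^ 2) = Real.sqrt (1 + ‖a‖ ^ 2) / ‖a‖ := by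
        rw [eq_div_iff h0.ne', ← Real.sqrt_sq h0.le, ← Real.sqrt_mul (by positivity), norm_inv, Real.sqrt_sq h0.le]
        congr 1
        field_simp
        ring
      rw [this]
      simp
      field_simp
  have key2 : ∀ a : ℂ, sphDist (sinv a) (sinv ((0 : ℂ) : Sphere)) = sphDist (a : Sphere) ((0 : ℂ) : Sphere) := by
    intro a
    have := key a⁻¹
    by_cases ha : a = 0
    · rw [ha, sphDist_self, sphDist_self]
    · rw [← sinv_coe ha, sinv_sinv, sinv_infty] at this
      rw [sinv_zero, this]
  induction x using OnePoint.rec <;> induction y using OnePoint.rec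
  · rw [sphDist_self, sphDist_self]
  · rw [sphDist_comm, key, sphDist_comm]
  · rw [key]
  · rename_i a b
    by_cases ha : a = 0
    · rw [ha, sphDist_comm, key2, sphDist_comm]
    · by_cases hb : b = 0
      · rw [hb, key2]
      · rw [sinv_coe ha, sinv_coe hb, sphDist_coe_inv ha hb]

theorem sinv_cont : Continuous sinv := by
  let := sphMetric
  have : Isometry sinv := Isometry.of_dist_eq (fun x y => by
    rw [← sphDist_eq, ← sphDist_eq, sphDist_sinv])
  exact this.continuous

def sinvHomeo : Sphere ≃ₜ Sphere where
  toFun := sinv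
  invFun := sinv
  left_inv := sinv_sinv
  right_inv := sinv_sinv
  continuous_toFun := sinv_cont
  continuous_invFun := sinv_cont

/-- zeros of a polynomial viewed as degree `d` section -/
def Zd (d : ℕ) (h : ℂ[X]) : Multiset Sphere :=
  (h.roots.map fun z : ℂ => (z : Sphere)) + Multiset.replicate (d - h.natDegree) (OnePoint.infty : Sphere)

theorem fiber_infty (P Q : ℂ[X]) : fiber P Q (OnePoint.infty : Sphere) = Zd (max P.natDegree Q.natDegree) Q := by
  simp [fiber, Zd, Multiset.bind_def, Multiset.pure_def, Multiset.bind_singleton]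
theorem fiber_coe (P Q : ℂ[X]) (b : ℂ) : fiber P Q (b : Sphere) =
    Zd (max P.natDegree Q.natDegree) (P - C b * Q) := by
  simp [fiber, Zd, Multiset.bind_def, Multiset.pure_def, Multiset.bind_singleton]

theorem card_Zd {d : ℕ} {h : ℂ[X]} (hd : h.natDegree ≤ d) : (Zd d h).card = d := by
  have : h.roots.card = h.natDegree := by
    exact (IsAlgClosed.splits h).natDegree_eq_card_roots.symm
  rw [Zd, Multiset.card_add, Multiset.card_map, Multiset.card_replicate, this]; omega

theorem coe_mem_Zd {d : ℕ} {h : ℂ[X]} (h0 : h ≠ 0) {z : ℂ} : (z : Sphere) ∈ Zd d h ↔ h.eval z = 0 := by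
  rw [Zd, Multiset.mem_add, Multiset.mem_map]
  constructor
  · rintro (⟨y, hy, hyz⟩ | hz)
    · rw [OnePoint.coe_injective hyz] at hy
      exact (mem_roots'.1 hy).2
    · exact absurd (Multiset.eq_of_mem_replicate hz) (OnePoint.coe_ne_infty z)
  · intro hz
    exact Or.inl ⟨z, (mem_roots h0).2 hz, rfl⟩

theorem infty_mem_Zd {d : ℕ} {h : ℂ[X]} : (OnePoint.infty : Sphere) ∈ Zd d h ↔ h.natDegree < d := by
  rw [Zd, Multiset.mem_add, Multiset.mem_map, Multiset.mem_replicate]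
  constructor
  · rintro (⟨y, hy, hyz⟩ | hz)
    · exact absurd hyz (OnePoint.coe_ne_infty y)
    · omega
  · intro h; exact Or.inr ⟨by omega, rfl⟩

theorem Zd_mul {d e : ℕ} {h k : ℂ[X]} (h0 : h ≠ 0) (k0 : k ≠ 0) (hd : h.natDegree ≤ d) (hk : k.natDegree ≤ e) :
    Zd (d + e) (h * k) = Zd d h + Zd e k := by
  rw [Zd, Zd, Zd, roots_mul (mul_ne_zero h0 k0), natDegree_mul h0 k0,
    show d + e - (h.natDegree + k.natDegree) = (d - h.natDegree) + (e - k.natDegree) by omega,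
    Multiset.replicate_add, Multiset.map_add]
  abel

theorem Zd_reflect : ∀ (d : ℕ) (h : ℂ[X]), h ≠ 0 → h.natDegree ≤ d →
    Zd d (reflect d h) = (Zd d h).map sinv := by
  intro d
  induction d with
  | zero =>
    intro h h0 hd
    have e := natDegree_eq_zero.1 (Nat.le_zero.1 hd)
    obtain ⟨a, rfl⟩ := e
    simp [Zd, reflect_C]
  | succ d ih =>
    intro h h0 hd
    have hr0 : ∀ k : ℂ[X], k ≠ 0 → reflect d k ≠ 0 := fun k hk => by rwa [Ne, reflect_eq_zero_iff]
    have hrd : ∀ k : ℂ[X], k.natDegree ≤ d → (reflect d k).natDegree ≤ d := fun k hk => by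
      have := natDegree_reflect_le (N := d) (p := k)
      omega
    by_cases hd' : h.natDegree ≤ d
    · have e : reflect (d + 1) h = reflect d h * X := by
        have := reflect_mul h 1 hd' (show (1 : ℂ[X]).natDegree ≤ 1 by simp)
        rw [mul_one] at this
        rw [this]
        congr 1
        simp
      rw [e, Zd_mul (hr0 h h0) X_ne_zero (hrd h hd') (by simp), ih h h0 hd']
      have e2 := Zd_mul h0 (one_ne_zero (α := ℂ[X])) hd' (show (1 : ℂ[X]).natDegree ≤ 1 by simp)
      rw [mul_one] at e2
      rw [e2, Multiset.map_add]
      congr 1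
      simp [Zd, sinv_infty]
    · have hdeg : h.natDegree = d + 1 := by omega
      obtain ⟨a, ha⟩ := IsAlgClosed.exists_root h (by
        rw [degree_eq_natDegree h0, hdeg]; exact_mod_cast Nat.succ_ne_zero d)
      obtain ⟨k, hk⟩ := dvd_iff_isRoot.2 ha
      have k0 : k ≠ 0 := by rintro rfl; simp at hk; exact h0 hk
      have hX0 : (X - C a : ℂ[X]) ≠ 0 := X_sub_C_ne_zero a
      have hkd : k.natDegree ≤ d := by
        have := natDegree_mul hX0 k0
        rw [← hk, natDegree_X_sub_C] at this
        omega
      have e1 : reflect 1 (X - C a : ℂ[X]) = 1 - C a * X := by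
        ext i
        rw [coeff_reflect]
        rcases i with _ | _ | i
        · rw [revAt_le (by omega)]; simp [coeff_X, coeff_C, coeff_one]
        · rw [revAt_le (by omega)]; simp [coeff_X, coeff_C, coeff_one]
        · rw [revAt_eq_self_of_lt (by omega)]
          simp [coeff_X, coeff_C, coeff_one]
      have e : reflect (d + 1) h = (1 - C a * X) * reflect d k := by
        rw [hk, add_comm d 1, reflect_mul _ _ (by simp) hkd, e1]
      have hY0 : (1 - C a * X : ℂ[X]) ≠ 0 := by
        intro h; have := congrArg (fun f => coeff f 0) h; simp at this
      have hY1 : (1 - C a * X : ℂ[X]).natDegree ≤ 1 := by compute_degree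
      rw [e, hk, add_comm d 1, Zd_mul hY0 (hr0 k k0) hY1 (hrd k hkd), Zd_mul hX0 k0 (by simp) hkd,
        ih k k0 hkd, Multiset.map_add]
      congr 1
      by_cases ha0 : a = 0
      · subst ha0
        simp [Zd, sinv_zero]
      · have e3 : (1 - C a * X : ℂ[X]) = C (-a) * (X - C a⁻¹) := by
          rw [mul_sub, ← C_mul]; simp [ha0]
          ring
        have : natDegree (C (-a) * (X - C a⁻¹) : ℂ[X]) = 1 := by
          rw [natDegree_C_mul (neg_ne_zero.2 ha0), natDegree_X_sub_C]
        rw [e3, Zd, Zd, this, roots_C_mul _ (neg_ne_zero.2 ha0), roots_X_sub_C, roots_X_sub_C, natDegree_X_sub_C]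
        simp [sinv_coe ha0]

/-- nonconstant rational map in irreducible form -/
def RatMap (P Q : ℂ[X]) : Prop := IsCoprime P Q ∧ 1 ≤ max P.natDegree Q.natDegree

theorem RatMap.symm {P Q : ℂ[X]} (h : RatMap P Q) : RatMap Q P := ⟨h.1.symm, by rw [max_comm]; exact h.2⟩

theorem RatMap.sub_ne {P Q : ℂ[X]} (h : RatMap P Q) (b : ℂ) : P - C b * Q ≠ 0 := by
  intro h0
  have e : P = C b * Q := sub_eq_zero.1 h0
  obtain ⟨⟨u, v, huv⟩, hd⟩ := h
  have hQ : IsUnit Q := by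
    refine IsUnit.of_mul_eq_one (u * C b + v) ?_
    rw [e] at huv; rw [← huv]; ring
  have h1 := natDegree_eq_zero_of_isUnit hQ
  have h2 : P.natDegree ≤ 0 := by
    rw [e]; refine (natDegree_C_mul_le b Q).trans h1.le
  omega

theorem RatMap.left_ne {P Q : ℂ[X]} (h : RatMap P Q) : P ≠ 0 := by
  have := h.sub_ne 0
  simpa using this

theorem RatMap.right_ne {P Q : ℂ[X]} (h : RatMap P Q) : Q ≠ 0 := h.symm.left_ne

theorem natDegree_sub_le' (P Q : ℂ[X]) (b : ℂ) : (P - C b * Q).natDegree ≤ max P.natDegree Q.natDegree :=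
  (natDegree_sub_le _ _).trans (max_le_max le_rfl (natDegree_C_mul_le b Q))

theorem RatMap.card_fiber {P Q : ℂ[X]} (_ : RatMap P Q) (a : Sphere) :
    (fiber P Q a).card = max P.natDegree Q.natDegree := by
  induction a using OnePoint.rec with
  | infty => rw [fiber_infty, card_Zd (le_max_right _ _)]
  | coe b => rw [fiber_coe, card_Zd (natDegree_sub_le' P Q b)]

theorem natDegree_lt_iff_coeff {d : ℕ} {h : ℂ[X]} (hd : h.natDegree ≤ d) (h1 : 1 ≤ d) :
    h.natDegree < d ↔ h.coeff d = 0 := by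
  constructor
  · exact fun h => coeff_eq_zero_of_natDegree_lt h
  · intro hc
    rcases hd.lt_or_eq with h2 | h2
    · exact h2
    · rw [← h2, coeff_natDegree, leadingCoeff_eq_zero] at hc
      rw [hc, natDegree_zero] at h2
      omega

theorem ratEval_coe (P Q : ℂ[X]) (z : ℂ) : ratEval P Q (z : Sphere) =
    if Q.eval z = 0 then (OnePoint.infty : Sphere) else ((P.eval z / Q.eval z : ℂ) : Sphere) := rfl

theorem RatMap.ratEval_infty {P Q : ℂ[X]} (h : RatMap P Q) : ratEval P Q (OnePoint.infty : Sphere) =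
    if Q.coeff (max P.natDegree Q.natDegree) = 0 then (OnePoint.infty : Sphere)
    else ((P.coeff (max P.natDegree Q.natDegree) / Q.coeff (max P.natDegree Q.natDegree) : ℂ) : Sphere) := by
  have e : ratEval P Q (OnePoint.infty : Sphere) = (if Q.natDegree < P.natDegree then (OnePoint.infty : Sphere)
     else if P.natDegree < Q.natDegree then ((0 : ℂ) : Sphere)
     else ((P.leadingCoeff / Q.leadingCoeff : ℂ) : Sphere)) := rfl
  have hQ : Q.leadingCoeff ≠ 0 := leadingCoeff_ne_zero.2 h.right_ne
  rw [e]
  rcases lt_trichotomy Q.natDegree P.natDegree with h1 | h1 | h1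
  · rw [if_pos h1, max_eq_left h1.le, if_pos (coeff_eq_zero_of_natDegree_lt h1)]
  · rw [if_neg (by omega), if_neg (by omega), ← h1, max_self, coeff_natDegree, if_neg hQ]
    simp only [leadingCoeff, h1]
  · rw [if_neg (by omega), if_pos h1, max_eq_right h1.le, coeff_natDegree, if_neg hQ, coeff_eq_zero_of_natDegree_lt h1, zero_div]

theorem RatMap.mem_fiber {P Q : ℂ[X]} (h : RatMap P Q) (z a : Sphere) :
    z ∈ fiber P Q a ↔ ratEval P Q z = a := by
  set d := max P.natDegree Q.natDegree with hd
  have hd1 : 1 ≤ d := h.2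
  induction a using OnePoint.rec with
  | infty =>
    rw [fiber_infty]
    induction z using OnePoint.rec with
    | infty =>
      rw [infty_mem_Zd, natDegree_lt_iff_coeff (le_max_right _ _) hd1, h.ratEval_infty]
      split_ifs with h1 <;> simp [h1]
    | coe z =>
      rw [coe_mem_Zd h.right_ne, ratEval_coe]
      split_ifs with h1 <;> simp [h1]
  | coe b =>
    rw [fiber_coe]
    induction z using OnePoint.rec with
    | infty =>
      rw [infty_mem_Zd, natDegree_lt_iff_coeff (natDegree_sub_le' P Q b) hd1, h.ratEval_infty, coeff_sub, coeff_C_mul]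
      split_ifs with h1
      · rw [h1]
        simp only [mul_zero, sub_zero]
        refine iff_of_false ?_ (OnePoint.infty_ne_coe b)
        intro h2
        have e1 := (natDegree_lt_iff_coeff (le_max_left P.natDegree Q.natDegree) hd1).2 h2
        have e2 := (natDegree_lt_iff_coeff (le_max_right P.natDegree Q.natDegree) hd1).2 h1
        have := max_lt e1 e2
        exact lt_irrefl _ this
      · rw [OnePoint.coe_eq_coe, div_eq_iff h1, sub_eq_zero]
    | coe z =>
      rw [coe_mem_Zd (h.sub_ne b), ratEval_coe, eval_sub, eval_mul, eval_C]
      split_ifs with h1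
      · rw [h1]
        simp only [mul_zero, sub_zero]
        refine iff_of_false ?_ (OnePoint.infty_ne_coe b)
        intro h2
        obtain ⟨u, v, huv⟩ := h.1
        have := congrArg (eval z) huv
        simp [h1, h2] at this
      · rw [OnePoint.coe_eq_coe, div_eq_iff h1, sub_eq_zero]

theorem Zd_C_mul (d : ℕ) (h : ℂ[X]) {c : ℂ} (hc : c ≠ 0) : Zd d (C c * h) = Zd d h := by
  rw [Zd, Zd, roots_C_mul h hc, natDegree_C_mul hc]

theorem fiber_swap (P Q : ℂ[X]) (a : Sphere) : fiber Q P a = fiber P Q (sinv a) := by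
  induction a using OnePoint.rec with
  | infty => rw [sinv_infty, fiber_infty, fiber_coe, max_comm]; simp
  | coe b =>
    by_cases hb : b = 0
    · rw [hb, sinv_zero, fiber_infty, fiber_coe, max_comm]; simp
    · rw [sinv_coe hb, fiber_coe, fiber_coe, max_comm,
        show P - C b⁻¹ * Q = C (-b⁻¹) * (Q - C b * P) by
          rw [mul_sub, ← mul_assoc, ← C_mul]
          simp [hb]
          ring]
      rw [Zd_C_mul _ _ (by simp [hb])]

theorem RatMap.ratEval_swap {P Q : ℂ[X]} (h : RatMap P Q) (z : Sphere) :
    ratEval Q P z = sinv (ratEval P Q z) := by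
  rw [← h.symm.mem_fiber, fiber_swap, sinv_sinv, h.mem_fiber]


theorem sinv_mem_map {s : Multiset Sphere} {z : Sphere} : z ∈ s.map sinv ↔ sinv z ∈ s := by
  rw [Multiset.mem_map]
  constructor
  · rintro ⟨y, hy, rfl⟩; rwa [sinv_sinv]
  · intro h; exact ⟨_, h, sinv_sinv z⟩

theorem RatMap.disj {P Q : ℂ[X]} (h : RatMap P Q) (z : Sphere)
    (h1 : z ∈ Zd (max P.natDegree Q.natDegree) P) (h2 : z ∈ Zd (max P.natDegree Q.natDegree) Q) : False := by
  have e1 : z ∈ fiber P Q ((0 : ℂ) : Sphere) := by rw [fiber_coe]; simpa using h1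
  have e2 : z ∈ fiber P Q (OnePoint.infty : Sphere) := by rwa [fiber_infty]
  rw [h.mem_fiber] at e1 e2
  rw [e1] at e2
  exact OnePoint.coe_ne_infty _ e2

theorem natDegree_reflect_le' {d : ℕ} {h : ℂ[X]} (hd : h.natDegree ≤ d) : (Polynomial.reflect d h).natDegree ≤ d := by
  have := natDegree_reflect_le (N := d) (p := h)
  omega

theorem RatMap.reflect {P Q : ℂ[X]} (h : RatMap P Q) :
    RatMap (reflect (max P.natDegree Q.natDegree) P) (reflect (max P.natDegree Q.natDegree) Q) ∧
    max (Polynomial.reflect (max P.natDegree Q.natDegree) P).natDegree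
      (Polynomial.reflect (max P.natDegree Q.natDegree) Q).natDegree = max P.natDegree Q.natDegree := by
  have hdisj := h.disj
  have hd1 := h.2
  have hPd := le_max_left P.natDegree Q.natDegree
  have hQd := le_max_right P.natDegree Q.natDegree
  revert hdisj hd1 hPd hQd
  generalize max P.natDegree Q.natDegree = d
  intro hdisj hd1 hPd hQd
  have rP0 : Polynomial.reflect d P ≠ 0 := by rw [Ne, reflect_eq_zero_iff]; exact h.left_ne
  have rQ0 : Polynomial.reflect d Q ≠ 0 := by rw [Ne, reflect_eq_zero_iff]; exact h.right_ne
  have key : ∀ z : Sphere, z ∈ Zd d (Polynomial.reflect d P) → z ∈ Zd d (Polynomial.reflect d Q) → False := by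
    intro z h1 h2
    rw [Zd_reflect d P h.left_ne hPd, sinv_mem_map] at h1
    rw [Zd_reflect d Q h.right_ne hQd, sinv_mem_map] at h2
    exact hdisj _ h1 h2
  have hmax : max (Polynomial.reflect d P).natDegree (Polynomial.reflect d Q).natDegree = d := by
    refine le_antisymm (max_le (natDegree_reflect_le' hPd) (natDegree_reflect_le' hQd)) ?_
    by_contra hlt
    push Not at hlt
    exact key (OnePoint.infty : Sphere) (infty_mem_Zd.2 ((le_max_left _ _).trans_lt hlt))
      (infty_mem_Zd.2 ((le_max_right _ _).trans_lt hlt))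
  refine ⟨⟨?_, by rw [hmax]; exact hd1⟩, hmax⟩
  rw [Polynomial.isCoprime_iff_aeval_ne_zero_of_isAlgClosed ℂ ℂ]
  intro a
  by_contra hc
  push Not at hc
  simp only [coe_aeval_eq_eval] at hc
  exact key a ((coe_mem_Zd rP0).2 hc.1) ((coe_mem_Zd rQ0).2 hc.2)

theorem RatMap.fiber_reflect {P Q : ℂ[X]} (h : RatMap P Q) (a : Sphere) :
    fiber (Polynomial.reflect (max P.natDegree Q.natDegree) P)
      (Polynomial.reflect (max P.natDegree Q.natDegree) Q) a = (fiber P Q a).map sinv := by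
  have e := h.reflect.2
  induction a using OnePoint.rec with
  | infty => rw [fiber_infty, fiber_infty, e, Zd_reflect _ _ h.right_ne (le_max_right _ _)]
  | coe b => rw [fiber_coe, fiber_coe, e, ← Zd_reflect _ _ (h.sub_ne b) (natDegree_sub_le' P Q b), reflect_sub,
      reflect_C_mul]

theorem RatMap.ratEval_reflect {P Q : ℂ[X]} (h : RatMap P Q) (z : Sphere) :
    ratEval (Polynomial.reflect (max P.natDegree Q.natDegree) P)
      (Polynomial.reflect (max P.natDegree Q.natDegree) Q) z = ratEval P Q (sinv z) := by
  rw [← h.reflect.1.mem_fiber, h.fiber_reflect, sinv_mem_map, h.mem_fiber]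

/-- identity or inversion -/
def IsChart (e : Sphere → Sphere) : Prop := e = id ∨ e = sinv

theorem IsChart.invol {e : Sphere → Sphere} (h : IsChart e) (z : Sphere) : e (e z) = z := by
  rcases h with rfl | rfl
  · rfl
  · exact sinv_sinv z

theorem IsChart.cont {e : Sphere → Sphere} (h : IsChart e) : Continuous e := by
  rcases h with rfl | rfl
  · exact continuous_id
  · exact sinv_cont

theorem IsChart.inj {e : Sphere → Sphere} (h : IsChart e) : Function.Injective e :=
  Function.LeftInverse.injective h.invol

/-- chart reduction -/
theorem RatMap.chart {P Q : ℂ[X]} (h : RatMap P Q) (c : Sphere) :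
    ∃ (P' Q' : ℂ[X]) (c' : ℂ) (e₁ e₂ : Sphere → Sphere), RatMap P' Q' ∧ Q'.eval c' ≠ 0 ∧
      IsChart e₁ ∧ IsChart e₂ ∧ e₁ c' = c ∧ (∀ z, ratEval P' Q' z = e₂ (ratEval P Q (e₁ z))) ∧
      (∀ a, fiber P' Q' (e₂ a) = (fiber P Q a).map e₁) := by
  have step : ∀ {P Q : ℂ[X]} (_ : RatMap P Q) (c : ℂ),
    ∃ (P' Q' : ℂ[X]) (e₂ : Sphere → Sphere), RatMap P' Q' ∧ Q'.eval c ≠ 0 ∧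
      IsChart e₂ ∧ (∀ z, ratEval P' Q' z = e₂ (ratEval P Q z)) ∧
      (∀ a, fiber P' Q' (e₂ a) = (fiber P Q a)) := by
    intro P Q h c
    by_cases hc : Q.eval c = 0
    · refine ⟨Q, P, sinv, h.symm, ?_, Or.inr rfl, h.ratEval_swap, fun a => ?_⟩
      · intro h2
        obtain ⟨u, v, huv⟩ := h.1
        have := congrArg (eval c) huv
        simp [hc, h2] at this
      · rw [fiber_swap, sinv_sinv]
    · exact ⟨P, Q, id, h, hc, Or.inl rfl, fun _ => rfl, fun _ => rfl⟩
  induction c using OnePoint.rec with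
  | coe c =>
    obtain ⟨P', Q', e₂, h1, h2, h3, h4, h5⟩ := step h c
    exact ⟨P', Q', c, id, e₂, h1, h2, Or.inl rfl, h3, rfl, h4, fun a => by rw [h5]; simp⟩
  | infty =>
    obtain ⟨P', Q', e₂, h1, h2, h3, h4, h5⟩ := step h.reflect.1 0
    refine ⟨P', Q', 0, sinv, e₂, h1, h2, Or.inr rfl, h3, sinv_zero, fun z => ?_, fun a => ?_⟩
    · rw [h4, h.ratEval_reflect]
    · rw [h5, h.fiber_reflect]

theorem ratEval_eventually {P Q : ℂ[X]} {c : ℂ} (hc : Q.eval c ≠ 0) :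
    ∀ᶠ z in 𝓝 c, Q.eval z ≠ 0 ∧ ratEval P Q (z : Sphere) = ((P.eval z / Q.eval z : ℂ) : Sphere) := by
  have : ∀ᶠ z in 𝓝 c, Q.eval z ≠ 0 := Q.continuous.continuousAt.eventually_ne hc
  filter_upwards [this] with z hz
  exact ⟨hz, by rw [ratEval_coe, if_neg hz]⟩

theorem anal_div {P Q : ℂ[X]} {c : ℂ} (hc : Q.eval c ≠ 0) :
    AnalyticAt ℂ (fun z => P.eval z / Q.eval z) c := by
  have h : ∀ R : ℂ[X], AnalyticAt ℂ (fun z => R.eval z) c := fun R =>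
    R.differentiable.analyticAt c
  exact (h P).div (h Q) hc

theorem RatMap.nhds_aux {P Q : ℂ[X]} (h : RatMap P Q) {c : ℂ} (hc : Q.eval c ≠ 0) :
    ContinuousAt (ratEval P Q) c ∧ 𝓝 (ratEval P Q c) ≤ map (ratEval P Q) (𝓝 (c : Sphere)) := by
  have hev := ratEval_eventually (P := P) hc
  have e0 : ratEval P Q (c : Sphere) = ((P.eval c / Q.eval c : ℂ) : Sphere) := by
    rw [ratEval_coe, if_neg hc]
  have hE : (ratEval P Q ∘ ((↑) : ℂ → Sphere)) =ᶠ[𝓝 c] ((↑) : ℂ → Sphere) ∘ (fun z => P.eval z / Q.eval z) := by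
    filter_upwards [hev] with z hz using hz.2
  constructor
  · rw [OnePoint.continuousAt_coe]
    refine ContinuousAt.congr ?_ hE.symm
    exact OnePoint.continuous_coe.continuousAt.comp (anal_div hc).continuousAt
  · rw [OnePoint.nhds_coe_eq, Filter.map_map, Filter.map_congr hE, e0, OnePoint.nhds_coe_eq, ← Filter.map_map]
    refine Filter.map_mono ?_
    rcases (anal_div (P := P) hc).eventually_constant_or_nhds_le_map_nhds with h1 | h1
    · exfalso
      have h2 : ∀ᶠ z in 𝓝 c, (P - C (P.eval c / Q.eval c) * Q).eval z = 0 := by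
        filter_upwards [h1, hev] with z hz hz2
        rw [eval_sub, eval_mul, eval_C, ← hz, div_mul_cancel₀ _ hz2.1, sub_self]
      have h3 : (P - C (P.eval c / Q.eval c) * Q) = 0 := by
        refine Polynomial.eq_zero_of_infinite_isRoot _ ?_
        exact infinite_of_mem_nhds c h2
      exact h.sub_ne _ h3
    · exact h1

theorem RatMap.nhds_eq {P Q : ℂ[X]} (h : RatMap P Q) (c : Sphere) :
    ContinuousAt (ratEval P Q) c ∧ 𝓝 (ratEval P Q c) ≤ map (ratEval P Q) (𝓝 c) := by
  obtain ⟨P', Q', c', e₁, e₂, h', hc', he₁, he₂, hcc, hev, -⟩ := h.chart c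
  obtain ⟨h1, h2⟩ := h'.nhds_aux hc'
  have E : ratEval P Q = e₂ ∘ ratEval P' Q' ∘ e₁ := by
    funext z; simp only [Function.comp, hev, he₁.invol, he₂.invol]
  have hcc' : e₁ c = c' := by rw [← hcc, he₁.invol]
  let H₁ : Sphere ≃ₜ Sphere := ⟨⟨e₁, e₁, he₁.invol, he₁.invol⟩, he₁.cont, he₁.cont⟩
  let H₂ : Sphere ≃ₜ Sphere := ⟨⟨e₂, e₂, he₂.invol, he₂.invol⟩, he₂.cont, he₂.cont⟩
  have m1 : map e₁ (𝓝 c) = 𝓝 (c' : Sphere) := by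
    rw [← hcc']; exact H₁.map_nhds_eq c
  constructor
  · rw [E]
    refine he₂.cont.continuousAt.comp (ContinuousAt.comp ?_ he₁.cont.continuousAt)
    rw [hcc']; exact h1
  · rw [E, ← Filter.map_map, ← Filter.map_map, m1]
    simp only [Function.comp, hcc']
    have m2 : map e₂ (𝓝 (ratEval P' Q' c')) = 𝓝 (e₂ (ratEval P' Q' c')) := H₂.map_nhds_eq _
    rw [← m2]
    exact Filter.map_mono h2

theorem RatMap.cont {P Q : ℂ[X]} (h : RatMap P Q) : Continuous (ratEval P Q) :=
  continuous_iff_continuousAt.2 fun c => (h.nhds_eq c).1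

theorem RatMap.openMap {P Q : ℂ[X]} (h : RatMap P Q) : IsOpenMap (ratEval P Q) :=
  isOpenMap_iff_nhds_le.2 fun c => (h.nhds_eq c).2

theorem RatMap.surj {P Q : ℂ[X]} (h : RatMap P Q) : Function.Surjective (ratEval P Q) := by
  intro a
  have : 0 < (fiber P Q a).card := by rw [h.card_fiber]; exact h.2
  obtain ⟨z, hz⟩ := Multiset.card_pos_iff_exists_mem.1 this
  exact ⟨z, (h.mem_fiber z a).1 hz⟩

/-- local multiplicity -/
def cnt (P Q : ℂ[X]) (c : Sphere) : ℕ := (fiber P Q (ratEval P Q c)).count c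

/-- Wronskian -/
def wron (P Q : ℂ[X]) : ℂ[X] := derivative P * Q - P * derivative Q

theorem RatMap.wron_ne {P Q : ℂ[X]} (h : RatMap P Q) : wron P Q ≠ 0 := by
  intro h0
  have : wronskian P Q = 0 := by rw [wronskian, ← neg_zero, ← h0, wron]; ring
  have h1 := h.1.wronskian_eq_zero_iff.1 this
  have h2 := derivative_eq_zero.1 h1.1
  have h3 := derivative_eq_zero.1 h1.2
  have := h.2
  omega

theorem RatMap.cnt_coe {P Q : ℂ[X]} (h : RatMap P Q) {c : ℂ} (hc : Q.eval c ≠ 0) :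
    2 ≤ cnt P Q c ↔ (wron P Q).eval c = 0 := by
  have e0 : ratEval P Q (c : Sphere) = ((P.eval c / Q.eval c : ℂ) : Sphere) := by
    rw [ratEval_coe, if_neg hc]
  set b := P.eval c / Q.eval c with hb
  have e1 : cnt P Q c = (P - C b * Q).rootMultiplicity c := by
    rw [cnt, e0, fiber_coe, Zd, Multiset.count_add, Multiset.count_map_eq_count' _ _ OnePoint.coe_injective, count_roots,
      Multiset.count_replicate, if_neg (OnePoint.infty_ne_coe c), add_zero]
  have hPb : P.eval c = b * Q.eval c := by rw [hb, div_mul_cancel₀ _ hc]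
  rw [e1, show (2 ≤ (P - C b * Q).rootMultiplicity c ↔ 1 < (P - C b * Q).rootMultiplicity c) from Iff.rfl,
    one_lt_rootMultiplicity_iff_isRoot (h.sub_ne b)]
  simp only [IsRoot.def, eval_sub, eval_mul, eval_C, derivative_sub, derivative_mul, derivative_C, wron, hPb]
  constructor
  · rintro ⟨-, h2⟩
    simp at h2
    linear_combination (eval c Q) * h2
  · intro h2
    refine ⟨by ring, ?_⟩
    apply mul_left_cancel₀ hc
    simp only [eval_add, eval_mul, eval_zero, eval_C, zero_mul, zero_add, mul_zero]
    linear_combination h2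

theorem RatMap.finite_crit {P Q : ℂ[X]} (h : RatMap P Q) : {c : Sphere | 2 ≤ cnt P Q c}.Finite := by
  have : {c : Sphere | 2 ≤ cnt P Q c} ⊆ {(OnePoint.infty : Sphere)} ∪ ((↑) : ℂ → Sphere) ''
      ((wron P Q).rootSet ℂ ∪ Q.rootSet ℂ) := by
    intro c hc
    induction c using OnePoint.rec with
    | infty => left; rfl
    | coe c =>
      right
      refine ⟨c, ?_, rfl⟩
      by_cases h1 : Q.eval c = 0
      · right; rw [mem_rootSet]; exact ⟨h.right_ne, by simpa using h1⟩
      · left; rw [mem_rootSet]; exact ⟨h.wron_ne, by simpa using (h.cnt_coe h1).1 hc⟩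
  refine Set.Finite.subset ?_ this
  exact (Set.finite_singleton _).union (((rootSet_finite _ _).union (rootSet_finite _ _)).image _)

theorem card_le_one_of {α : Type*} [DecidableEq α] {s : Multiset α} (h1 : ∀ x ∈ s, s.count x ≤ 1) (h2 : ∀ x ∈ s, ∀ y ∈ s, x = y) :
    s.card ≤ 1 := by
  have hn : s.Nodup := by
    rw [Multiset.nodup_iff_count_le_one]
    intro a
    by_cases ha : a ∈ s
    · exact h1 a ha
    · rw [Multiset.count_eq_zero_of_notMem ha]; omega
  have : s.toFinset.card ≤ 1 := Finset.card_le_one.2 (by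
    intro a ha b hb
    exact h2 a (Multiset.mem_toFinset.1 ha) b (Multiset.mem_toFinset.1 hb))
  rwa [Multiset.toFinset_card_of_nodup hn] at this

theorem RatMap.cnt_pos {P Q : ℂ[X]} (h : RatMap P Q) (c : Sphere) : 1 ≤ cnt P Q c := by
  rw [cnt, Nat.succ_le_iff, Multiset.count_pos, h.mem_fiber]

theorem RatMap.strict {P Q : ℂ[X]} (h : RatMap P Q) {c : ℂ} (hc : Q.eval c ≠ 0) (hcr : cnt P Q c < 2) :
    ∃ d : ℂ, d ≠ 0 ∧ HasStrictDerivAt (fun z => P.eval z / Q.eval z) d c := by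
  have hw : (wron P Q).eval c ≠ 0 := by
    intro h0; have := (h.cnt_coe hc).2 h0; omega
  refine ⟨(wron P Q).eval c / (Q.eval c) ^ 2, div_ne_zero hw (pow_ne_zero _ hc), ?_⟩
  have := (P.hasStrictDerivAt c).div (Q.hasStrictDerivAt c) hc
  have e : (wron P Q).eval c = eval c (derivative P) * eval c Q - eval c P * eval c (derivative Q) := by
    simp only [wron, eval_sub, eval_mul]
  rw [e]
  exact this

theorem RatMap.locInj {P Q : ℂ[X]} (h : RatMap P Q) {c : ℂ} (hc : Q.eval c ≠ 0) (hcr : cnt P Q c < 2) :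
    ∃ U ∈ 𝓝 c, ∀ x ∈ U, Q.eval x ≠ 0 ∧ cnt P Q x < 2 ∧ ∀ y ∈ U, P.eval x / Q.eval x = P.eval y / Q.eval y → x = y := by
  obtain ⟨d, hd, hs⟩ := h.strict hc hcr
  have hw : (wron P Q).eval c ≠ 0 := by
    intro h0; have := (h.cnt_coe hc).2 h0; omega
  have hev := ratEval_eventually (P := P) hc
  have hw' : ∀ᶠ z in 𝓝 c, (wron P Q).eval z ≠ 0 := (wron P Q).continuous.continuousAt.eventually_ne hw
  have hinj : ∃ U ∈ 𝓝 c, Set.InjOn (fun z => P.eval z / Q.eval z) U := by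
    let F := (hs.hasStrictFDerivAt_equiv hd).toOpenPartialHomeomorph _
    refine ⟨F.source, F.open_source.mem_nhds (hs.hasStrictFDerivAt_equiv hd).mem_toOpenPartialHomeomorph_source, F.injOn⟩
  obtain ⟨U, hU, hUi⟩ := hinj
  refine ⟨U ∩ {z | (wron P Q).eval z ≠ 0 ∧ Q.eval z ≠ 0}, inter_mem hU ?_, ?_⟩
  · filter_upwards [hev, hw'] with z h1 h2 using ⟨h2, h1.1⟩
  · rintro x ⟨hx, hx1, hx2⟩
    refine ⟨hx2, ?_, fun y hy hxy => hUi hx hy.1 hxy⟩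
    by_contra h3
    push Not at h3
    exact hx1 ((h.cnt_coe hx2).1 h3)

theorem RatMap.locCard {P Q : ℂ[X]} (h : RatMap P Q) (c : Sphere) (hcr : cnt P Q c < 2) :
    ∃ U ∈ 𝓝 c, ∀ a, ((fiber P Q a).filter (· ∈ U)).card ≤ 1 := by
  obtain ⟨P', Q', c', e₁, e₂, h', hc', he₁, he₂, hcc, hev, hfib⟩ := h.chart c
  have hcnt : ∀ z, cnt P' Q' z = cnt P Q (e₁ z) := by
    intro z
    rw [cnt, cnt, hev, hfib]
    conv_lhs => rw [← he₁.invol z]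
    rw [Multiset.count_map_eq_count' _ _ he₁.inj, he₁.invol]
  have hcr' : cnt P' Q' c' < 2 := by rw [hcnt, hcc]; exact hcr
  obtain ⟨U, hU, hU2⟩ := h'.locInj hc' hcr'
  have hcc' : e₁ c = c' := by rw [← hcc, he₁.invol]
  refine ⟨e₁ ⁻¹' (((↑) : ℂ → Sphere) '' U), ?_, ?_⟩
  · refine he₁.cont.continuousAt ?_
    rw [hcc', OnePoint.nhds_coe_eq]
    exact Filter.image_mem_map hU
  · intro a
    apply card_le_one_of
    · rintro x hx
      obtain ⟨hx1, u, hu, hux⟩ := Multiset.mem_filter.1 hx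
      have : (fiber P Q a).count x ≤ 1 := by
        rw [h.mem_fiber] at hx1
        have := (hU2 u hu).2.1
        rw [hcnt, hux, he₁.invol, cnt, hx1] at this
        omega
      exact (Multiset.count_le_of_le _ (Multiset.filter_le _ _)).trans this
    · rintro x hx y hy
      obtain ⟨hx1, u, hu, hux⟩ := Multiset.mem_filter.1 hx
      obtain ⟨hy1, v, hv, hvy⟩ := Multiset.mem_filter.1 hy
      rw [h.mem_fiber] at hx1 hy1
      have e1 := hev u
      have e2 := hev v
      rw [hux, he₁.invol, hx1, ← hux, ratEval_coe, if_neg (hU2 u hu).1] at e1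
      rw [hvy, he₁.invol, hy1, ← hvy, ratEval_coe, if_neg (hU2 v hv).1] at e2
      have := (hU2 u hu).2.2 v hv (OnePoint.coe_injective (e1.trans e2.symm))
      apply he₁.inj
      rw [← hux, ← hvy, this]

theorem eq_of_card_le_one {α : Type*} {s : Multiset α} (h : s.card ≤ 1) {x y : α} (hx : x ∈ s) (hy : y ∈ s) : x = y := by
  rcases Nat.le_one_iff_eq_zero_or_eq_one.1 h with h | h
  · rw [Multiset.card_eq_zero.1 h] at hx; simp at hx
  · obtain ⟨a, rfl⟩ := Multiset.card_eq_one.1 h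
    rw [Multiset.mem_singleton] at hx hy
    rw [hx, hy]

theorem RatMap.cov {P Q : ℂ[X]} (h : RatMap P Q) :
    IsCoveringMapOn (ratEval P Q) (ratEval P Q '' {c | 2 ≤ cnt P Q c})ᶜ := by
  refine h.cont.isClosedMap.isCoveringMapOn_of_isLocalHomeomorphOn ?_ ?_
  · intro x _
    refine Set.Finite.subset (fiber P Q x).toFinset.finite_toSet ?_
    intro z hz
    simpa [h.mem_fiber] using hz
  · rw [isLocalHomeomorphOn_iff_isOpenEmbedding_restrict]
    intro x hx
    have hx2 : cnt P Q x < 2 := by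
      by_contra hc
      push Not at hc
      exact hx ⟨x, hc, rfl⟩
    obtain ⟨U, hU, hU2⟩ := h.locCard x hx2
    refine ⟨interior U, isOpen_interior.mem_nhds (mem_interior_iff_mem_nhds.2 hU), ?_⟩
    rw [isOpenEmbedding_iff_continuous_injective_isOpenMap]
    refine ⟨h.cont.comp continuous_subtype_val, ?_, h.openMap.comp isOpen_interior.isOpenMap_subtype_val⟩
    rintro ⟨a, ha⟩ ⟨b, hb⟩ hab
    have hab : ratEval P Q a = ratEval P Q b := hab
    have := eq_of_card_le_one (hU2 (ratEval P Q b))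
      (Multiset.mem_filter.2 ⟨(h.mem_fiber a _).2 hab, interior_subset ha⟩)
      (Multiset.mem_filter.2 ⟨(h.mem_fiber b _).2 rfl, interior_subset hb⟩)
    exact Subtype.ext this

theorem RatMap.lift_diff {P Q : ℂ[X]} (h : RatMap P Q) {B : Set ℂ} (hB : IsOpen B) {φ ψ : ℂ → ℂ}
    (hφ : DifferentiableOn ℂ φ B) (hψ : ContinuousOn ψ B)
    (hE : ∀ z ∈ B, ratEval P Q (ψ z : Sphere) = (φ z : Sphere))
    (hav : ∀ z ∈ B, cnt P Q (ψ z : Sphere) < 2) : DifferentiableOn ℂ ψ B := by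
  intro z hz
  have hQ : ∀ y ∈ B, Q.eval (ψ y) ≠ 0 ∧ P.eval (ψ y) / Q.eval (ψ y) = φ y := by
    intro y hy
    have := hE y hy
    rw [ratEval_coe] at this
    split_ifs at this with h1
    · exact absurd this (OnePoint.infty_ne_coe _)
    · exact ⟨h1, OnePoint.coe_injective this⟩
  obtain ⟨d, hd, hs⟩ := h.strict (hQ z hz).1 (hav z hz)
  have hl := hs.eventually_left_inverse hd
  have hc : ContinuousAt ψ z := hψ.continuousAt (hB.mem_nhds hz)
  have hl2 := hc.eventually hl
  have ht := (hs.to_localInverse hd).hasDerivAt.differentiableAt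
  simp only [(hQ z hz).2] at ht
  have := ht.comp z ((hφ z hz).differentiableAt (hB.mem_nhds hz))
  refine (this.congr_of_eventuallyEq ?_).differentiableWithinAt
  filter_upwards [hl2, hB.mem_nhds hz] with y h1 h2
  rw [(hQ y h2).2] at h1
  exact h1.symm

/-- finite value of a sphere point -/
def toC (z : Sphere) : ℂ := OnePoint.elim z 0 id

theorem toC_coe (z : ℂ) : toC (z : Sphere) = z := rfl
theorem coe_toC {z : Sphere} (h : z ≠ (OnePoint.infty : Sphere)) : ((toC z : ℂ) : Sphere) = z := by
  induction z using OnePoint.rec with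
  | infty => exact absurd rfl h
  | coe z => rfl

theorem RatMap.lift {P Q : ℂ[X]} (h : RatMap P Q) {b : ℂ} {ρ : ℝ} (hρ : 0 < ρ) {φ : ℂ → ℂ}
    (hφ : DifferentiableOn ℂ φ (Metric.ball b ρ))
    (hcr : ∀ z ∈ Metric.ball b ρ, ∀ c, 2 ≤ cnt P Q c → ratEval P Q c ≠ φ z)
    (hinf : ∀ z ∈ Metric.ball b ρ, ratEval P Q (OnePoint.infty : Sphere) ≠ φ z) :
    ∃ Λ : Finset (ℂ → ℂ), (∀ ψ ∈ Λ, DifferentiableOn ℂ ψ (Metric.ball b ρ)) ∧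
      (∀ z ∈ Metric.ball b ρ, fiber P Q (φ z) = Λ.val.map (fun ψ => (ψ z : Sphere))) ∧
      (∀ z ∈ Metric.ball b ρ, ∀ ψ ∈ Λ, ∀ ψ' ∈ Λ, ψ z = ψ' z → ψ = ψ') := by
  set B := Metric.ball b ρ with hBdef
  have hbB : b ∈ B := Metric.mem_ball_self hρ
  have : ContractibleSpace B := (convex_ball b ρ).contractibleSpace ⟨b, hbB⟩
  have : LocallyPathConnectedSpace B := Metric.isOpen_ball.locallyPathConnectedSpace
  let fA : C(B, Sphere) := ⟨fun z => ((φ z : ℂ) : Sphere),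
    OnePoint.continuous_coe.comp (hφ.continuousOn.comp_continuous continuous_subtype_val (fun z => z.2))⟩
  have hs : ∀ a : B, fA a ∈ (ratEval P Q '' {c | 2 ≤ cnt P Q c})ᶜ := by
    rintro ⟨z, hz⟩ ⟨c, hc, hc2⟩
    exact hcr z hz c hc hc2
  have hlift : ∀ (a : B) (e : Sphere), ratEval P Q e = fA a → ∃! F : C(B, Sphere), F a = e ∧ ratEval P Q ∘ F = fA :=
    fun a e he => h.cov.existsUnique_continuousMap_lifts fA he hs
  have hnd : ∀ z ∈ B, (fiber P Q (φ z)).Nodup := by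
    intro z hz
    rw [Multiset.nodup_iff_count_le_one]
    intro a
    by_cases ha : a ∈ fiber P Q (φ z)
    · rw [h.mem_fiber] at ha
      have : ¬ 2 ≤ cnt P Q a := fun h2 => hcr z hz a h2 ha
      rw [cnt, ha] at this
      omega
    · rw [Multiset.count_eq_zero_of_notMem ha]; omega
  choose! F hF using fun e (he : ratEval P Q e = fA ⟨b, hbB⟩) => (hlift ⟨b, hbB⟩ e he).exists
  have hFuniq : ∀ e e', ratEval P Q e = fA ⟨b, hbB⟩ → ratEval P Q e' = fA ⟨b, hbB⟩ →
      ∀ a : B, F e a = F e' a → e = e' := by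
    intro e e' he he' a ha
    have h1 := (hlift a (F e a) (congrFun (hF e he).2 a)).unique ⟨rfl, (hF e he).2⟩ ⟨ha.symm, (hF e' he').2⟩
    rw [← (hF e he).1, ← (hF e' he').1, h1]
  have hFinf : ∀ e, ratEval P Q e = fA ⟨b, hbB⟩ → ∀ a : B, F e a ≠ (OnePoint.infty : Sphere) := by
    intro e he a h1
    have := congrFun (hF e he).2 a
    simp only [Function.comp, h1] at this
    exact hinf a a.2 this
  let ψ : Sphere → ℂ → ℂ := fun e z => if hz : z ∈ B then toC (F e ⟨z, hz⟩) else 0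
  have hψ : ∀ e, ratEval P Q e = fA ⟨b, hbB⟩ → ∀ z (hz : z ∈ B), (ψ e z : Sphere) = F e ⟨z, hz⟩ := by
    intro e he z hz
    simp only [ψ, dif_pos hz]
    exact coe_toC (hFinf e he _)
  have hmem : ∀ e ∈ (fiber P Q (φ b)).toFinset, ratEval P Q e = fA ⟨b, hbB⟩ := by
    intro e he
    rw [Multiset.mem_toFinset, h.mem_fiber] at he
    exact he
  have hψinj : ∀ e ∈ (fiber P Q (φ b)).toFinset, ∀ e' ∈ (fiber P Q (φ b)).toFinset, ∀ z ∈ B, ψ e z = ψ e' z → e = e' := by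
    intro e he e' he' z hz hee
    refine hFuniq e e' (hmem e he) (hmem e' he') ⟨z, hz⟩ ?_
    rw [← hψ e (hmem e he) z hz, ← hψ e' (hmem e' he') z hz, hee]
  have hψE : ∀ e ∈ (fiber P Q (φ b)).toFinset, ∀ z ∈ B, ratEval P Q (ψ e z) = φ z := by
    intro e he z hz
    rw [hψ e (hmem e he) z hz]
    exact congrFun (hF e (hmem e he)).2 ⟨z, hz⟩
  refine ⟨(fiber P Q (φ b)).toFinset.image ψ, ?_, ?_, ?_⟩
  · intro g hg
    obtain ⟨e, he, rfl⟩ := Finset.mem_image.1 hg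
    refine h.lift_diff Metric.isOpen_ball hφ ?_ (hψE e he) ?_
    · rw [continuousOn_iff_continuous_domRestrict, OnePoint.isOpenEmbedding_coe.isEmbedding.continuous_iff]
      refine (F e).continuous.congr ?_
      intro z
      exact (hψ e (hmem e he) z z.2).symm
    · intro z hz
      by_contra hc
      push Not at hc
      exact hcr z hz _ hc (hψE e he z hz)
  · intro z hz
    have e1 : ((fiber P Q (φ b)).toFinset.image ψ).val = (fiber P Q (φ b)).toFinset.val.map ψ := by
      rw [Finset.image_val, Multiset.dedup_eq_self.2]
      refine Multiset.Nodup.map_on ?_ (Finset.nodup _)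
      intro x hx y hy hxy
      exact hψinj x hx y hy b hbB (by rw [hxy])
    rw [e1, Multiset.map_map, Multiset.toFinset_val, Multiset.dedup_eq_self.2 (hnd b hbB)]
    symm
    refine Multiset.eq_of_le_of_card_le ?_ ?_
    · rw [Multiset.le_iff_subset]
      · intro x hx
        obtain ⟨e, he, rfl⟩ := Multiset.mem_map.1 hx
        rw [h.mem_fiber]
        exact hψE e (Multiset.mem_toFinset.2 he) z hz
      · refine Multiset.Nodup.map_on ?_ (hnd b hbB)
        intro x hx y hy hxy
        exact hψinj x (Multiset.mem_toFinset.2 hx) y (Multiset.mem_toFinset.2 hy) z hz (OnePoint.coe_injective hxy)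
    · rw [Multiset.card_map, h.card_fiber, h.card_fiber]
  · intro z hz g hg g' hg' hgg
    obtain ⟨e, he, rfl⟩ := Finset.mem_image.1 hg
    obtain ⟨e', he', rfl⟩ := Finset.mem_image.1 hg'
    rw [hψinj e he e' he' z hz hgg]

variable {p q} in
theorem Good.rat (hg : Good p q) (i : Fin N) : RatMap (p i) (q i) := ⟨hg.2.1 i, hg.2.2.1 i⟩

theorem shift_cons (v : Fin N) (w : ℕ → Fin N) : shiftW (consW v w) = w := by
  funext n; simp [shiftW, consW]
theorem cons_zero (v : Fin N) (w : ℕ → Fin N) : consW v w 0 = v := by simp [consW]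
theorem cons_succ (v : Fin N) (w : ℕ → Fin N) (n : ℕ) : consW v w (n + 1) = w n := by simp [consW]
theorem cons_shift (w : ℕ → Fin N) : consW (w 0) (shiftW w) = w := by
  funext n; rcases n with _ | n <;> simp [shiftW, consW]
theorem cons_cont (v : Fin N) : Continuous (consW v) := by
  refine continuous_pi fun n => ?_
  rcases n with _ | n
  · simp only [cons_zero]; exact continuous_const
  · simp only [cons_succ]; exact continuous_apply n
theorem shift_cont : Continuous (shiftW : (ℕ → Fin N) → (ℕ → Fin N)) :=
  continuous_pi fun n => continuous_apply (n + 1)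

theorem Tmap_cons (v : Fin N) (w : ℕ → Fin N) (z : Sphere) :
    Tmap p q (consW v w, z) = (w, ratEval (p v) (q v) z) := by
  simp only [Tmap, shift_cons, cons_zero]

variable {p q} in
theorem Tmap_cont (hg : Good p q) : Continuous (Tmap p q) := by
  refine (shift_cont.comp continuous_fst).prodMk ?_
  rw [continuous_iff_continuousAt]
  rintro ⟨w, z⟩
  have hc : Continuous fun x : SymX N => x.1 0 := (continuous_apply 0).comp continuous_fst
  have h1 : ∀ᶠ x : SymX N in 𝓝 (w, z), x.1 0 = w 0 :=
    ((isOpen_discrete ({w 0} : Set (Fin N))).preimage hc).mem_nhds (Set.mem_singleton (w 0))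
  refine ContinuousAt.congr (f := fun x : SymX N => ratEval (p (w 0)) (q (w 0)) x.2) ?_ ?_
  · exact ((hg.rat _).cont.comp continuous_snd).continuousAt
  · filter_upwards [h1] with x hx
    rw [hx]

variable {p q} in
theorem Tmap_open (hg : Good p q) : IsOpenMap (Tmap p q) := by
  intro O hO
  have : Tmap p q '' O = ⋃ v : Fin N, (Prod.map id (ratEval (p v) (q v))) ''
      ((fun x : SymX N => ((consW v x.1, x.2) : SymX N)) ⁻¹' O) := by
    ext y
    simp only [Set.mem_image, Set.mem_iUnion, Set.mem_preimage]
    constructor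
    · rintro ⟨⟨w, z⟩, hx, rfl⟩
      exact ⟨w 0, (shiftW w, z), by simpa only [cons_shift] using hx, rfl⟩
    · rintro ⟨v, ⟨w, z⟩, hx, rfl⟩
      exact ⟨_, hx, Tmap_cons p q v w z⟩
  rw [this]
  refine isOpen_iUnion fun v => ?_
  refine (IsOpenMap.id.prodMap (hg.rat v).openMap) _ (hO.preimage ?_)
  exact ((cons_cont v).comp continuous_fst).prodMk continuous_snd

variable {p q} in
theorem mem_preimT (hg : Good p q) (x y : SymX N) : y ∈ preimT p q x ↔ Tmap p q y = x := by
  rw [preimT, Multiset.mem_sum]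
  constructor
  · rintro ⟨v, -, hv⟩
    obtain ⟨z, hz, rfl⟩ := Multiset.mem_map.1 hv
    rw [(hg.rat v).mem_fiber] at hz
    rw [Tmap_cons, hz]
  · rintro rfl
    refine ⟨y.1 0, Finset.mem_univ _, Multiset.mem_map.2 ⟨y.2, ?_, ?_⟩⟩
    · rw [(hg.rat _).mem_fiber]; rfl
    · simp only [Tmap, cons_shift]

variable {p q} in
theorem card_preimT (hg : Good p q) (x : SymX N) : (preimT p q x).card = Dtot p q := by
  rw [preimT, Multiset.card_sum, Dtot]
  refine Finset.sum_congr rfl fun v _ => ?_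
  rw [Multiset.card_map, (hg.rat v).card_fiber]; rfl

theorem preimTn_add (a b : ℕ) (x : SymX N) :
    preimTn p q (a + b) x = (preimTn p q a x).bind (preimTn p q b) := by
  induction a generalizing x with
  | zero => simp [preimTn]
  | succ a ih =>
    rw [Nat.succ_add]
    simp only [preimTn]
    rw [Multiset.bind_assoc]
    congr 1
    funext y
    exact ih y

theorem preimTn_one (x : SymX N) : preimTn p q 1 x = preimT p q x := by
  simp only [preimTn]
  rw [Multiset.bind_singleton, Multiset.map_id']

theorem preimTn_succ' (n : ℕ) (x : SymX N) :
    preimTn p q (n + 1) x = (preimTn p q n x).bind (preimT p q) := by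
  rw [preimTn_add]; congr 1; funext y; exact preimTn_one p q y

variable {p q} in
theorem mem_preimTn (hg : Good p q) (n : ℕ) (x y : SymX N) : y ∈ preimTn p q n x ↔ (Tmap p q)^[n] y = x := by
  induction n generalizing x with
  | zero => simp [preimTn]
  | succ n ih =>
    rw [preimTn, Multiset.mem_bind, Function.iterate_succ_apply']
    constructor
    · rintro ⟨u, hu, hy⟩
      rw [(ih u).1 hy, (mem_preimT hg x u).1 hu]
    · intro h
      exact ⟨_, (mem_preimT hg x _).2 h, (ih _).2 rfl⟩

variable {p q} in
theorem card_preimTn (hg : Good p q) (n : ℕ) (x : SymX N) : (preimTn p q n x).card = Dtot p q ^ n := by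
  induction n generalizing x with
  | zero => simp [preimTn]
  | succ n ih =>
    rw [preimTn, Multiset.card_bind, Multiset.map_congr rfl (g := fun _ => Dtot p q ^ n) (f := Multiset.card ∘ fun y => preimTn p q n y) (fun y _ => ih y),
      Multiset.map_const', Multiset.sum_replicate, card_preimT hg, smul_eq_mul, pow_succ, mul_comm]

theorem birk_add (f : SymX N → ℝ) (a b : ℕ) (y : SymX N) :
    birk p q f (a + b) y = birk p q f b ((Tmap p q)^[a] y) + birk p q f a y := by
  rw [birk, birk, birk, Finset.sum_range_add, add_comm]
  congr 1
  refine Finset.sum_congr rfl fun k _ => ?_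
  rw [← Function.iterate_add_apply, add_comm]

variable {p q} in
theorem LSum_add (hg : Good p q) (f : SymX N → ℝ) (a b : ℕ) (x : SymX N) :
    LSum p q f (a + b) x = ((preimTn p q a x).map fun y => Real.exp (birk p q f a y) * LSum p q f b y).sum := by
  rw [LSum, preimTn_add, Multiset.map_bind, Multiset.sum_bind]
  congr 1
  refine Multiset.map_congr rfl fun y _ => ?_
  rw [LSum, ← Multiset.sum_map_mul_left]
  congr 1
  refine Multiset.map_congr rfl fun z hz => ?_
  rw [mem_preimTn hg] at hz
  rw [← Real.exp_add, add_comm a b, birk_add, hz]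

theorem LSum_zero (f : SymX N → ℝ) (x : SymX N) : LSum p q f 0 x = 1 := by
  simp [LSum, preimTn, birk]

variable {p q} in
theorem Dtot_pos (hg : Good p q) : 1 ≤ Dtot p q := by
  obtain ⟨i, hi⟩ := hg.2.2.2
  have := Finset.single_le_sum (f := degR p q) (fun _ _ => Nat.zero_le _) (Finset.mem_univ i)
  rw [Dtot]; omega

theorem msum_le {α : Type*} {s : Multiset α} {g : α → ℝ} {c : ℝ} (h : ∀ x ∈ s, g x ≤ c) :
    (s.map g).sum ≤ s.card * c := by
  have := Multiset.sum_le_card_nsmul (s.map g) c (by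
    intro x hx; obtain ⟨y, hy, rfl⟩ := Multiset.mem_map.1 hx; exact h y hy)
  simpa using this

theorem le_msum {α : Type*} {s : Multiset α} {g : α → ℝ} {c : ℝ} (h : ∀ x ∈ s, c ≤ g x) :
    s.card * c ≤ (s.map g).sum := by
  have := Multiset.card_nsmul_le_sum (s := s.map g) (a := c) (by
    intro x hx; obtain ⟨y, hy, rfl⟩ := Multiset.mem_map.1 hx; exact h y hy)
  simpa using this

theorem msum_mono {α : Type*} {s : Multiset α} {g g' : α → ℝ} (h : ∀ x ∈ s, g x ≤ g' x) :
    (s.map g).sum ≤ (s.map g').sum := Multiset.sum_map_le_sum_map _ _ h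

theorem msum_nonneg {α : Type*} {s : Multiset α} {g : α → ℝ} (h : ∀ x ∈ s, 0 ≤ g x) :
    0 ≤ (s.map g).sum := by
  refine Multiset.sum_nonneg fun x hx => ?_
  obtain ⟨y, hy, rfl⟩ := Multiset.mem_map.1 hx; exact h y hy

theorem le_msum_mem {α : Type*} {s : Multiset α} {g : α → ℝ} (h : ∀ x ∈ s, 0 ≤ g x) {y : α} (hy : y ∈ s) :
    g y ≤ (s.map g).sum := by
  obtain ⟨t, rfl⟩ := Multiset.exists_cons_of_mem hy
  rw [Multiset.map_cons, Multiset.sum_cons]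
  have : 0 ≤ (t.map g).sum := msum_nonneg fun x hx => h x (Multiset.mem_cons_of_mem hx)
  linarith

theorem birk_abs {f : SymX N → ℝ} {M : ℝ} (hf : ∀ x, |f x| ≤ M) (n : ℕ) (y : SymX N) :
    |birk p q f n y| ≤ n * M := by
  rw [birk]
  refine (Finset.abs_sum_le_sum_abs _ _).trans ?_
  have := Finset.sum_le_card_nsmul (Finset.range n) (fun k => |f ((Tmap p q)^[k] y)|) M (fun k _ => hf _)
  simpa using this

variable {p q} in
theorem LSum_le (hg : Good p q) {f : SymX N → ℝ} {M : ℝ} (hf : ∀ x, |f x| ≤ M) (n : ℕ) (x : SymX N) :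
    LSum p q f n x ≤ (Dtot p q * Real.exp M) ^ n := by
  have := msum_le (s := preimTn p q n x) (g := fun y => Real.exp (birk p q f n y)) (c := Real.exp (n * M))
    (fun y _ => Real.exp_le_exp.2 ((le_abs_self _).trans (birk_abs p q hf n y)))
  rw [card_preimTn hg] at this
  rw [LSum, mul_pow, ← Real.exp_nat_mul]
  push_cast at this
  exact this

variable {p q} in
theorem le_LSum (hg : Good p q) {f : SymX N → ℝ} {M : ℝ} (hf : ∀ x, |f x| ≤ M) (n : ℕ) (x : SymX N) :
    (Dtot p q * Real.exp (-M)) ^ n ≤ LSum p q f n x := by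
  have := le_msum (s := preimTn p q n x) (g := fun y => Real.exp (birk p q f n y)) (c := Real.exp (n * (-M)))
    (fun y _ => Real.exp_le_exp.2 (by have := (abs_le.1 (birk_abs p q hf n y)).1; linarith))
  rw [card_preimTn hg] at this
  rw [LSum, mul_pow, ← Real.exp_nat_mul]
  push_cast at this
  exact this

variable {p q} in
theorem LSum_pos (hg : Good p q) (f : SymX N → ℝ) (n : ℕ) (x : SymX N) : 0 < LSum p q f n x := by
  have : 0 < (preimTn p q n x).card := by
    rw [card_preimTn hg]; exact pow_pos (Dtot_pos hg) n
  obtain ⟨y, hy⟩ := Multiset.card_pos_iff_exists_mem.1 this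
  exact (Real.exp_pos _).trans_le (le_msum_mem (s := preimTn p q n x)
    (g := fun y => Real.exp (birk p q f n y)) (fun _ _ => (Real.exp_pos _).le) hy)

theorem itComp_succ' (w : ℕ → Fin N) (n : ℕ) :
    itComp p q w (n + 1) = itComp p q (shiftW w) n ∘ ratEval (p (w 0)) (q (w 0)) := by
  induction n with
  | zero => rfl
  | succ n ih => rw [itComp, ih]; rfl

theorem Tmap_iter (n : ℕ) (x : SymX N) :
    (Tmap p q)^[n] x = (fun k => x.1 (k + n), itComp p q x.1 n x.2) := by
  induction n generalizing x with
  | zero => rfl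
  | succ n ih =>
    rw [Function.iterate_succ_apply', ih]
    simp only [Tmap, itComp, Function.comp, zero_add, Prod.mk.injEq, and_true]
    funext k
    simp only [shiftW]
    rw [show k + 1 + n = k + (n + 1) by omega]

variable {p q} in
theorem fatou_fwd (hg : Good p q) {w : ℕ → Fin N} {z : Sphere} (hz : z ∈ fatouW p q w) :
    ratEval (p (w 0)) (q (w 0)) z ∈ fatouW p q (shiftW w) := by
  obtain ⟨U, hU, hzU, hN⟩ := hz
  obtain ⟨C, hC, hzC, hCU⟩ := exists_compact_subset hU hzU
  set R := ratEval (p (w 0)) (q (w 0)) with hR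
  have hR' : ∀ v ∈ R '' interior C, ∃ u ∈ C, R u = v := by
    rintro v ⟨u, hu, rfl⟩; exact ⟨u, interior_subset hu, rfl⟩
  choose! τ hτ1 hτ2 using hR'
  refine ⟨R '' interior C, (hg.rat _).openMap _ isOpen_interior, ⟨z, hzC, rfl⟩, ?_⟩
  intro s hs
  obtain ⟨φ, hφ, g, hgK⟩ := hN (fun n => s n ∘ R) (by
    intro n
    obtain ⟨k, hk, he⟩ := hs n
    exact ⟨k + 1, by omega, by rw [itComp_succ', he]⟩)
  refine ⟨φ, hφ, fun v => g (τ v), ?_⟩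
  intro K hK _ ε hε
  filter_upwards [hgK C hCU hC ε hε] with n hn v hv
  have := hn (τ v) (hτ1 v (hK hv))
  simpa only [Function.comp, hτ2 v (hK hv)] using this

variable {p q} in
theorem fatou_bwd (hg : Good p q) {w : ℕ → Fin N} {z : Sphere}
    (hz : ratEval (p (w 0)) (q (w 0)) z ∈ fatouW p q (shiftW w)) : z ∈ fatouW p q w := by
  obtain ⟨V, hV, hzV, hN⟩ := hz
  set R := ratEval (p (w 0)) (q (w 0)) with hR
  have hRc : Continuous R := (hg.rat _).cont
  refine ⟨R ⁻¹' V, hV.preimage hRc, hzV, ?_⟩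
  intro s hs
  by_cases hfr : ∃ᶠ n in atTop, s n = R
  · obtain ⟨φ, hφ, hφ2⟩ := Filter.extraction_of_frequently_atTop hfr
    refine ⟨φ, hφ, R, ?_⟩
    intro K _ _ ε hε
    refine Eventually.of_forall fun n z _ => ?_
    rw [hφ2 n, sphDist_self]; exact hε
  · rw [Filter.not_frequently] at hfr
    obtain ⟨n0, hn0⟩ := Filter.eventually_atTop.1 hfr
    have : ∀ n, ∃ t : Sphere → Sphere, (∃ k, 1 ≤ k ∧ t = itComp p q (shiftW w) k) ∧ s (n + n0) = t ∘ R := by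
      intro n
      obtain ⟨k, hk, he⟩ := hs (n + n0)
      rcases k with _ | _ | k
      · omega
      · exact absurd he (hn0 _ (by omega))
      · exact ⟨itComp p q (shiftW w) (k + 1), ⟨k + 1, by omega, rfl⟩, by rw [he, itComp_succ']⟩
    choose t ht1 ht2 using this
    obtain ⟨φ, hφ, g, hgK⟩ := hN t ht1
    refine ⟨fun n => φ n + n0, fun a b hab => by have := hφ hab; simp only; omega, g ∘ R, ?_⟩
    intro K hK hKc ε hε
    filter_upwards [hgK (R '' K) (by rintro _ ⟨u, hu, rfl⟩; exact hK hu) (hKc.image hRc) ε hε] with n hn u hu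
    rw [ht2]
    exact hn _ ⟨u, hu, rfl⟩

variable {p q} in
theorem julia_bwd (hg : Good p q) {y : SymX N} (hy : Tmap p q y ∈ juliaSet p q) : y ∈ juliaSet p q := by
  have h1 : Tmap p q ⁻¹' (juliaSet p q) ⊆ closure (Tmap p q ⁻¹' (⋃ w : ℕ → Fin N, {w} ×ˢ juliaW p q w)) :=
    (Tmap_open hg).preimage_closure_subset_closure_preimage
  refine closure_mono ?_ (h1 hy)
  rintro ⟨w, z⟩ hx
  simp only [Set.mem_preimage, Set.mem_iUnion, Set.mem_prod, Set.mem_singleton_iff] at hx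
  obtain ⟨w', rfl, hz⟩ := hx
  simp only [Set.mem_iUnion, Set.mem_prod, Set.mem_singleton_iff]
  exact ⟨w, rfl, fun hF => hz (fatou_fwd hg hF)⟩

variable {p q} in
theorem julia_fwd (hg : Good p q) {y : SymX N} (hy : y ∈ juliaSet p q) : Tmap p q y ∈ juliaSet p q := by
  refine map_mem_closure (Tmap_cont hg) hy ?_
  rintro ⟨w, z⟩ hx
  simp only [Set.mem_iUnion, Set.mem_prod, Set.mem_singleton_iff] at hx
  obtain ⟨w', rfl, hz⟩ := hx
  simp only [Set.mem_iUnion, Set.mem_prod, Set.mem_singleton_iff]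
  exact ⟨_, rfl, fun hF => hz (fatou_bwd hg hF)⟩

variable {p q} in
theorem julia_bwd_iter (hg : Good p q) (n : ℕ) {y : SymX N} (hy : (Tmap p q)^[n] y ∈ juliaSet p q) :
    y ∈ juliaSet p q := by
  induction n with
  | zero => exact hy
  | succ n ih => rw [Function.iterate_succ_apply'] at hy; exact ih (julia_bwd hg hy)

variable {p q} in
theorem julia_fwd_iter (hg : Good p q) (n : ℕ) {y : SymX N} (hy : y ∈ juliaSet p q) :
    (Tmap p q)^[n] y ∈ juliaSet p q := by
  induction n with
  | zero => exact hy
  | succ n ih => rw [Function.iterate_succ_apply']; exact julia_fwd hg ih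

variable {p q} in
theorem preimTn_mem (hg : Good p q) {n : ℕ} {x y : SymX N} (hx : x ∈ juliaSet p q) (hy : y ∈ preimTn p q n x) :
    y ∈ juliaSet p q := by
  rw [mem_preimTn hg] at hy
  exact julia_bwd_iter hg n (hy ▸ hx)

theorem julia_compact : IsCompact (juliaSet p q) := isClosed_closure.isCompact

theorem itComp_congr {w w' : ℕ → Fin N} {n : ℕ} (h : ∀ i < n, w i = w' i) : itComp p q w n = itComp p q w' n := by
  induction n with
  | zero => rfl
  | succ n ih => rw [itComp, itComp, ih fun i hi => h i (by omega), h n (by omega)]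

/-- prefix of length j from w, then u -/
def preW (w : ℕ → Fin N) (j : ℕ) (u : ℕ → Fin N) : ℕ → Fin N := fun n => if n < j then w n else u (n - j)

variable {p q} in
theorem periodic_mem (hg : Good p q) {w : ℕ → Fin N} {c : Sphere} {j : ℕ} (hj : 1 ≤ j)
    (hx : (w, c) ∈ juliaSet p q) (hret : itComp p q w j c = c) :
    ((fun n => w (n % j)), c) ∈ juliaSet p q ∧
      (Tmap p q)^[j] ((fun n => w (n % j)), c) = ((fun n => w (n % j)), c) := by
  constructor
  · have h1 : ∀ k, ((preW w j)^[k] w, c) ∈ juliaSet p q := by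
      intro k
      induction k with
      | zero => exact hx
      | succ k ih =>
        rw [Function.iterate_succ_apply']
        apply julia_bwd_iter hg j
        rw [Tmap_iter]
        have e1 : itComp p q (preW w j ((preW w j)^[k] w)) j = itComp p q w j :=
          itComp_congr p q fun i hi => by simp [preW, hi]
        have e2 : (fun n => (preW w j ((preW w j)^[k] w)) (n + j)) = (preW w j)^[k] w := by
          funext n; simp [preW]
        simp only [e1, e2, hret]
        exact ih
    have h2 : ∀ k n, n < k * j → (preW w j)^[k] w n = w (n % j) := by
      intro k
      induction k with
      | zero => intro n hn; omega
      | succ k ih =>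
        intro n hn
        rw [Function.iterate_succ_apply']
        by_cases h : n < j
        · simp [preW, h, Nat.mod_eq_of_lt h]
        · rw [preW, if_neg h, ih _ (by rw [Nat.succ_mul] at hn; omega)]
          rw [Nat.mod_eq_sub_mod (by omega : j ≤ n)]
    refine (isClosed_closure : IsClosed (juliaSet p q)).mem_of_tendsto (b := atTop) (f := fun k : ℕ => ((preW w j)^[k] w, c)) ?_
      (Eventually.of_forall h1)
    refine Tendsto.prodMk_nhds ?_ tendsto_const_nhds
    rw [tendsto_pi_nhds]
    intro n
    refine tendsto_const_nhds.congr' ?_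
    filter_upwards [eventually_gt_atTop n] with k hk
    exact (h2 k n (by nlinarith)).symm
  · rw [Tmap_iter]
    have e1 : itComp p q (fun n => w (n % j)) j = itComp p q w j :=
      itComp_congr p q fun i hi => by simp [Nat.mod_eq_of_lt hi]
    simp only [e1, hret, Nat.add_mod_right]

theorem critSet_iff (x : SymX N) : x ∈ critSet p q ↔ 2 ≤ cnt (p (x.1 0)) (q (x.1 0)) x.2 := Iff.rfl

variable {p q} in
theorem no_return (hg : Good p q) (hA1 : NoSuperAttract p q) {x : SymX N} (hx : x ∈ juliaSet p q)
    (hc : x ∈ critSet p q) {j : ℕ} (hj : 1 ≤ j) : ((Tmap p q)^[j] x).2 ≠ x.2 := by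
  intro h
  rw [Tmap_iter] at h
  obtain ⟨h1, h2⟩ := periodic_mem hg (w := x.1) (c := x.2) hj hx h
  refine hA1 _ h1 j hj h2 0 hj ?_
  rw [critSet_iff] at hc ⊢
  simpa using hc

/-- the finite set of all critical points -/
def critPts : Set Sphere := ⋃ v : Fin N, {c | 2 ≤ cnt (p v) (q v) c}

variable {p q} in
theorem critPts_fin (hg : Good p q) : (critPts p q).Finite :=
  Set.finite_iUnion fun v => (hg.rat v).finite_crit

def emul (x : SymX N) : ℕ := if x ∈ critSet p q then Dtot p q else 1

variable {p q} in
theorem emul_prod (hg : Good p q) (hA1 : NoSuperAttract p q) {x : SymX N} (hx : x ∈ juliaSet p q) (m : ℕ) :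
    ∏ k ∈ Finset.range m, emul p q ((Tmap p q)^[k] x) ≤ Dtot p q ^ (critPts_fin hg).toFinset.card := by
  simp only [emul]
  rw [Finset.prod_ite, Finset.prod_const, Finset.prod_const, one_pow, mul_one]
  refine Nat.pow_le_pow_right (Dtot_pos hg) ?_
  refine Finset.card_le_card_of_injOn (fun k => ((Tmap p q)^[k] x).2) ?_ ?_
  · intro k hk
    simp only [Finset.coe_filter, Finset.mem_range, Set.mem_ofPred_eq] at hk
    simp only [Set.Finite.coe_toFinset]
    exact Set.mem_iUnion.2 ⟨_, (critSet_iff p q _).1 hk.2⟩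
  · have key : ∀ a b : ℕ, a < b → (Tmap p q)^[a] x ∈ critSet p q → ((Tmap p q)^[a] x).2 ≠ ((Tmap p q)^[b] x).2 := by
      intro a b hab ha h
      refine no_return hg hA1 (julia_fwd_iter hg a hx) ha (j := b - a) (by omega) ?_
      rw [← Function.iterate_add_apply, show b - a + a = b by omega, h]
    intro a ha b hb hab
    simp only [Finset.coe_filter, Finset.mem_range, Set.mem_ofPred_eq] at ha hb
    rcases lt_trichotomy a b with h | h | h
    · exact absurd hab (key a b h ha.2)
    · exact h
    · exact absurd hab.symm (key b a h hb.2)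

variable {p q} in
theorem filt_preimT (_hg : Good p q) (v : Fin N) (U : Set Sphere) (y : SymX N) :
    ((preimT p q y).filter fun u => u.1 0 = v ∧ u.2 ∈ U).card = ((fiber (p v) (q v) y.2).filter (· ∈ U)).card := by
  rw [preimT, ← Multiset.countP_eq_card_filter, ← Multiset.coe_countPAddMonoidHom, map_sum]
  rw [Finset.sum_eq_single v]
  · rw [Multiset.coe_countPAddMonoidHom, Multiset.countP_map]
    congr 1
    refine Multiset.filter_congr fun z _ => ?_
    simp [cons_zero]
  · intro b _ hb
    rw [Multiset.coe_countPAddMonoidHom, Multiset.countP_map]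
    rw [Multiset.card_eq_zero, Multiset.filter_eq_nil]
    intro z _
    simp [cons_zero, hb]
  · simp

theorem msum_ite {α : Type*} (s : Multiset α) (P : α → Prop) [DecidablePred P] (c : ℕ) :
    (s.map fun a => if P a then c else 0).sum = (s.filter P).card * c := by
  induction s using Multiset.induction_on with
  | empty => simp
  | cons a s ih =>
    rw [Multiset.map_cons, Multiset.sum_cons, ih]
    by_cases h : P a <;> simp [h]; ring

variable {p q} in
theorem locM (hg : Good p q) (m : ℕ) (w : ℕ → Fin N) (c : Sphere) :
    ∃ U ∈ 𝓝 c, ∀ y, ((preimTn p q m y).filter fun u => (∀ i < m, u.1 i = w i) ∧ u.2 ∈ U).card ≤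
      ∏ k ∈ Finset.range m, emul p q ((Tmap p q)^[k] (w, c)) := by
  induction m generalizing w c with
  | zero =>
    refine ⟨Set.univ, univ_mem, fun y => ?_⟩
    simp [preimTn]
  | succ m ih =>
    obtain ⟨U', hU', h'⟩ := ih (shiftW w) (ratEval (p (w 0)) (q (w 0)) c)
    have hV : ∃ V ∈ 𝓝 c, ∀ a, ((fiber (p (w 0)) (q (w 0)) a).filter (· ∈ V)).card ≤ emul p q (w, c) := by
      by_cases hc : 2 ≤ cnt (p (w 0)) (q (w 0)) c
      · obtain ⟨V, hVu⟩ : ∃ V : Set Sphere, V = Set.univ := ⟨_, rfl⟩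
        refine ⟨V, hVu ▸ univ_mem, fun a => ?_⟩
        have : (w, c) ∈ critSet p q := hc
        rw [emul, if_pos this]
        refine (Multiset.card_le_card (Multiset.filter_le _ _)).trans ?_
        rw [(hg.rat _).card_fiber]
        exact Finset.single_le_sum (f := degR p q) (fun _ _ => Nat.zero_le _) (Finset.mem_univ (w 0))
      · obtain ⟨V, hV, hV'⟩ := (hg.rat (w 0)).locCard c (by omega)
        refine ⟨V, hV, fun a => ?_⟩
        have : (w, c) ∉ critSet p q := hc
        rw [emul, if_neg this]
        exact hV' a
    obtain ⟨V, hV, hVc⟩ := hV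
    have hc : Continuous (ratEval (p (w 0)) (q (w 0))) := (hg.rat _).cont
    obtain ⟨W, hW, hWV, hWU⟩ : ∃ W ∈ 𝓝 c, W ⊆ V ∧ W ⊆ ratEval (p (w 0)) (q (w 0)) ⁻¹' U' :=
      ⟨_, inter_mem hV (hc.continuousAt hU'), Set.inter_subset_left, Set.inter_subset_right⟩
    refine ⟨W, hW, fun y => ?_⟩
    rw [preimTn_succ', Multiset.filter_bind, Multiset.card_bind, Finset.prod_range_succ']
    have hb : ∀ u' ∈ preimTn p q m y, (Multiset.card ∘ fun a => Multiset.filter (fun u => (∀ i < m + 1, u.1 i = w i) ∧ u.2 ∈ W) (preimT p q a)) u'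
        ≤ if ((∀ i < m, u'.1 i = shiftW w i) ∧ u'.2 ∈ U') then emul p q (w, c) else 0 := by
      intro u' _
      simp only [Function.comp]
      split_ifs with h
      · refine le_trans ?_ (hVc u'.2)
        rw [← filt_preimT hg]
        refine Multiset.card_le_card (Multiset.monotone_filter_right _ ?_)
        rintro u ⟨h1, h2⟩
        exact ⟨h1 0 (by omega), hWV h2⟩
      · rw [Nat.le_zero, Multiset.card_eq_zero, Multiset.filter_eq_nil]
        rintro u hu ⟨h1, h3⟩
        rw [mem_preimT hg] at hu
        subst hu
        apply h
        refine ⟨fun i hi => h1 (i + 1) (by omega), ?_⟩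
        simp only [Tmap, h1 0 (by omega)]
        exact hWU h3
    refine (Multiset.sum_map_le_sum_map _ _ hb).trans ?_
    rw [msum_ite]
    exact Nat.mul_le_mul_right _ (h' y)

theorem filter_union_card {α ι : Type*} (s : Multiset α) (I : Finset ι) (P : ι → α → Prop) (Q : α → Prop)
    (hQ : ∀ a, Q a → ∃ i ∈ I, P i a) :
    (s.filter Q).card ≤ ∑ i ∈ I, (s.filter (P i)).card := by
  induction s using Multiset.induction_on with
  | empty => simp
  | cons a s ih =>
    have e : ∀ Q : α → Prop, ((a ::ₘ s).filter Q).card = (if Q a then 1 else 0) + (s.filter Q).card := by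
      intro Q; by_cases h : Q a <;> simp [h]; ring
    rw [e, Finset.sum_congr rfl fun i _ => e (P i), Finset.sum_add_distrib]
    refine add_le_add ?_ ih
    split_ifs with h
    · obtain ⟨i, hi, hP⟩ := hQ a h
      calc 1 = if P i a then 1 else 0 := by rw [if_pos hP]
        _ ≤ _ := Finset.single_le_sum (f := fun i => if P i a then 1 else 0) (fun _ _ => Nat.zero_le _) hi
    · exact Nat.zero_le _

theorem cyl_open (m : ℕ) (l : Fin m → Fin N) : IsOpen {w : ℕ → Fin N | ∀ i : Fin m, w i = l i} := by
  have : {w : ℕ → Fin N | ∀ i : Fin m, w i = l i} = ⋂ i : Fin m, (fun w : ℕ → Fin N => w i) ⁻¹' {l i} := by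
    ext w; simp
  rw [this]
  exact isOpen_iInter_of_finite fun i => (isOpen_discrete _).preimage (continuous_apply _)

variable {p q} in
theorem exc (hg : Good p q) (hA1 : NoSuperAttract p q) : ∃ M : ℕ, 0 < M ∧ ∀ (F : Finset Sphere) (m : ℕ),
    ∃ O : Set (SymX N), IsOpen O ∧ (∀ w, ∀ c ∈ F, (w, c) ∈ juliaSet p q → (w, c) ∈ O) ∧
      ∀ y, ((preimTn p q m y).filter (· ∈ O)).card ≤ N ^ m * F.card * M := by
  refine ⟨Dtot p q ^ (critPts_fin hg).toFinset.card, Nat.pow_pos (Dtot_pos hg), fun F m => ?_⟩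
  have hU : ∀ (lc : (Fin m → Fin N) × Sphere), ∃ U : Set Sphere, IsOpen U ∧
      ((∃ w : ℕ → Fin N, (∀ i : Fin m, w i = lc.1 i) ∧ (w, lc.2) ∈ juliaSet p q) → lc.2 ∈ U) ∧
      ∀ y, ((preimTn p q m y).filter fun u => (∀ i : Fin m, u.1 i = lc.1 i) ∧ u.2 ∈ U).card ≤
        Dtot p q ^ (critPts_fin hg).toFinset.card := by
    intro lc
    by_cases h : ∃ w : ℕ → Fin N, (∀ i : Fin m, w i = lc.1 i) ∧ (w, lc.2) ∈ juliaSet p q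
    · obtain ⟨w, hw, hJ⟩ := h
      obtain ⟨U, hU, hc⟩ := locM hg m w lc.2
      obtain ⟨U', hU'U, hU', hcU'⟩ := mem_nhds_iff.1 hU
      refine ⟨U', hU', fun _ => hcU', fun y => ?_⟩
      refine le_trans (Multiset.card_le_card (Multiset.monotone_filter_right _ ?_)) ((hc y).trans (emul_prod hg hA1 hJ m))
      rintro u ⟨h1, h2⟩
      exact ⟨fun i hi => by rw [h1 ⟨i, hi⟩, ← hw ⟨i, hi⟩], hU'U h2⟩
    · obtain ⟨V, hV⟩ : ∃ V : Set Sphere, V = ∅ := ⟨_, rfl⟩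
      refine ⟨V, hV ▸ isOpen_empty, fun h' => absurd h' h, fun y => ?_⟩
      rw [Multiset.filter_eq_nil.2]
      · exact Nat.zero_le _
      · rintro u _ ⟨_, h2⟩; rw [hV] at h2; exact h2
  choose U hU1 hU2 hU3 using hU
  obtain ⟨O, hO⟩ : ∃ O : Set (SymX N), O = {u : SymX N | ∃ lc ∈ (Finset.univ ×ˢ F : Finset ((Fin m → Fin N) × Sphere)), (∀ i : Fin m, u.1 i = lc.1 i) ∧ u.2 ∈ U lc} := ⟨_, rfl⟩
  refine ⟨O, ?_, ?_, ?_⟩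
  · have : O = ⋃ lc ∈ (Finset.univ ×ˢ F : Finset ((Fin m → Fin N) × Sphere)), ({w : ℕ → Fin N | ∀ i : Fin m, w i = lc.1 i} ×ˢ U lc) := by
      rw [hO]; ext u; simp only [Set.mem_iUnion, Set.mem_ofPred_eq, Set.mem_prod, exists_prop]
    rw [this]
    exact isOpen_biUnion fun lc _ => (cyl_open m lc.1).prod (hU1 lc)
  · intro w c hc hJ
    rw [hO]
    exact ⟨(fun i => w i, c), by simpa using hc, fun _ => rfl, hU2 (fun i => w i, c) ⟨w, fun _ => rfl, hJ⟩⟩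
  · intro y
    refine (filter_union_card _ (Finset.univ ×ˢ F : Finset ((Fin m → Fin N) × Sphere))
      (fun lc u => (∀ i : Fin m, u.1 i = lc.1 i) ∧ u.2 ∈ U lc) _ (by intro u hu; rw [hO] at hu; exact hu)).trans ?_
    refine (Finset.sum_le_card_nsmul _ _ (Dtot p q ^ (critPts_fin hg).toFinset.card) fun lc _ => ?_).trans ?_
    · refine le_trans (le_of_eq ?_) (hU3 lc y); congr!
    · simp [Finset.card_product]

theorem ascoliSeq {K : Set ℂ} (hK : IsCompact K) (F : ℕ → ℂ → Sphere)
    (hc : ∀ ε : ℝ, 0 < ε → ∃ δ : ℝ, 0 < δ ∧ ∀ n, ∀ z ∈ K, ∀ z' ∈ K, dist z z' < δ → sphDist (F n z) (F n z') < ε) :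
    ∃ φ : ℕ → ℕ, StrictMono φ ∧ ∃ g : ℂ → Sphere, ∀ ε : ℝ, 0 < ε →
      ∀ᶠ n in atTop, ∀ z ∈ K, sphDist (F (φ n) z) (g z) < ε := by
  let := sphMetric
  have : CompactSpace K := isCompact_iff_compactSpace.1 hK
  have hcont : ∀ n, Continuous fun z : K => F n z := by
    intro n
    rw [Metric.continuous_iff]
    intro b ε hε
    obtain ⟨δ, hδ, h⟩ := hc ε hε
    refine ⟨δ, hδ, fun a hab => ?_⟩
    rw [← sphDist_eq]
    exact h n a a.2 b b.2 hab
  let G : ℕ → BoundedContinuousFunction K Sphere := fun n => BoundedContinuousFunction.mkOfCompact ⟨_, hcont n⟩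
  have hA := BoundedContinuousFunction.arzela_ascoli (β := Sphere) Set.univ isCompact_univ (Set.range G) (fun _ _ _ => Set.mem_univ _) (by
    intro x
    rw [Metric.equicontinuousAt_iff]
    intro ε hε
    obtain ⟨δ, hδ, h⟩ := hc ε hε
    refine ⟨δ, hδ, ?_⟩
    rintro a ha ⟨_, n, rfl⟩
    rw [← sphDist_eq]
    refine h n _ x.2 _ a.2 ?_
    rw [dist_comm]; exact ha)
  obtain ⟨g, -, φ, hφ, hlim⟩ := hA.isSeqCompact (x := G) (fun n => subset_closure ⟨n, rfl⟩)
  refine ⟨φ, hφ, fun z => if h : z ∈ K then g ⟨z, h⟩ else OnePoint.infty, fun ε hε => ?_⟩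
  rw [Metric.tendsto_nhds] at hlim
  filter_upwards [hlim ε hε] with n hn z hz
  rw [dif_pos hz, sphDist_eq]
  exact lt_of_le_of_lt (BoundedContinuousFunction.dist_coe_le_dist (f := G (φ n)) (g := g) ⟨z, hz⟩) hn

def HolAt (F : ℂ → Sphere) (z : ℂ) : Prop :=
  ∃ e : Sphere → Sphere, IsChart e ∧ ∃ φ : ℂ → ℂ, AnalyticAt ℂ φ z ∧ ∀ᶠ u in 𝓝 z, F u = e (φ u)

theorem HolAt.rechart {F : ℂ → Sphere} {z : ℂ} (h : HolAt F z) {e : Sphere → Sphere} (he : IsChart e) {c : ℂ}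
    (hc : F z = e c) : ∃ φ : ℂ → ℂ, AnalyticAt ℂ φ z ∧ φ z = c ∧ ∀ᶠ u in 𝓝 z, F u = e (φ u) := by
  obtain ⟨e', he', φ, hφ, hF⟩ := h
  have hz := hF.self_of_nhds
  by_cases hee : e' = e
  · subst hee
    refine ⟨φ, hφ, ?_, hF⟩
    rw [hc] at hz
    exact (OnePoint.coe_injective (he.inj hz)).symm
  · have hsw : ∀ x, e' x = e (sinv x) := by
      rcases he with rfl | rfl <;> rcases he' with rfl | rfl
      · exact absurd rfl hee
      · intro x; rfl
      · intro x; simp [sinv_sinv]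
      · exact absurd rfl hee
    rw [hsw, hc] at hz
    have h1 := he.inj hz
    have h0 : φ z ≠ 0 := by
      intro h0; rw [h0, sinv_zero] at h1; exact OnePoint.coe_ne_infty _ h1
    rw [sinv_coe h0] at h1
    refine ⟨fun u => (φ u)⁻¹, hφ.inv h0, (OnePoint.coe_injective h1).symm, ?_⟩
    filter_upwards [hF, hφ.continuousAt.eventually_ne h0] with u hu hu0
    rw [hu, hsw, sinv_coe hu0]

theorem HolAt.comp {F : ℂ → Sphere} {z : ℂ} (h : HolAt F z) {P Q : ℂ[X]} (hR : RatMap P Q) :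
    HolAt (fun u => ratEval P Q (F u)) z := by
  obtain ⟨P', Q', c', e₁, e₂, hR', hQ, he1, he2, hec, hev, -⟩ := hR.chart (F z)
  obtain ⟨φ, hφ, hφc, hF⟩ := h.rechart he1 hec.symm
  refine ⟨e₂, he2, fun u => P'.eval (φ u) / Q'.eval (φ u), ?_, ?_⟩
  · have : AnalyticAt ℂ (fun z => P'.eval z / Q'.eval z) (φ z) := anal_div (hφc ▸ hQ)
    exact this.comp hφ
  · have h2 : ∀ᶠ u in 𝓝 z, Q'.eval (φ u) ≠ 0 ∧ ratEval P' Q' (φ u : Sphere) = ((P'.eval (φ u) / Q'.eval (φ u) : ℂ) : Sphere) := by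
      have := ratEval_eventually (P := P') (Q := Q') (c := φ z) (hφc ▸ hQ)
      exact hφ.continuousAt.eventually this
    filter_upwards [hF, h2] with u hu h2
    rw [← h2.2, hev, he2.invol, hu]

theorem HolAt.diff {F : ℂ → Sphere} {z : ℂ} (h : HolAt F z) (hz : F z ≠ OnePoint.infty) :
    DifferentiableAt ℂ (fun u => toC (F u)) z := by
  obtain ⟨φ, hφ, -, hF⟩ := h.rechart (e := id) (Or.inl rfl) (c := toC (F z)) (coe_toC hz).symm
  refine hφ.differentiableAt.congr_of_eventuallyEq ?_
  filter_upwards [hF] with u hu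
  rw [hu]; rfl

theorem HolAt.of_chart {e : Sphere → Sphere} (he : IsChart e) (z : ℂ) : HolAt (fun u => e u) z :=
  ⟨e, he, id, analyticAt_id, Eventually.of_forall fun _ => rfl⟩

theorem ratInj {P Q : ℂ[X]} (h : RatMap P Q) (hd : max P.natDegree Q.natDegree = 1) : Function.Injective (ratEval P Q) := by
  intro x y hxy
  have hc := h.card_fiber (ratEval P Q x)
  rw [hd, Multiset.card_eq_one] at hc
  obtain ⟨a, ha⟩ := hc
  have h1 : x ∈ fiber P Q (ratEval P Q x) := (h.mem_fiber _ _).2 rfl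
  have h2 : y ∈ fiber P Q (ratEval P Q x) := (h.mem_fiber _ _).2 hxy.symm
  rw [ha, Multiset.mem_singleton] at h1 h2
  rw [h1, h2]

def Mob (μ : Sphere → Sphere) : Prop :=
  Continuous μ ∧ Function.Injective μ ∧ ∀ F z, HolAt F z → HolAt (fun u => μ (F u)) z

theorem Mob.comp {μ ν : Sphere → Sphere} (h : Mob μ) (h' : Mob ν) : Mob (μ ∘ ν) :=
  ⟨h.1.comp h'.1, h.2.1.comp h'.2.1, fun F z hF => h.2.2 _ z (h'.2.2 F z hF)⟩

theorem mob_rat {P Q : ℂ[X]} (h : RatMap P Q) (hd : max P.natDegree Q.natDegree = 1) : Mob (ratEval P Q) :=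
  ⟨h.cont, ratInj h hd, fun _ _ hF => hF.comp h⟩

theorem mobius {a b c : Sphere} (hab : a ≠ b) (hac : a ≠ c) (hbc : b ≠ c) :
    ∃ μ, Mob μ ∧ μ a = ((0 : ℂ) : Sphere) ∧ μ b = ((1 : ℂ) : Sphere) ∧ μ c = OnePoint.infty := by
  have h1 : ∃ μ, Mob μ ∧ μ c = OnePoint.infty := by
    induction c using OnePoint.rec with
    | infty => exact ⟨id, ⟨continuous_id, Function.injective_id, fun _ _ h => h⟩, rfl⟩
    | coe c =>
      have hd : max (1 : ℂ[X]).natDegree (X - C c).natDegree = 1 := by simp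
      refine ⟨ratEval 1 (X - C c), mob_rat ⟨isCoprime_one_left, hd.ge⟩ hd, ?_⟩
      rw [ratEval_coe, if_pos (by simp)]
  obtain ⟨μ, hμ, hμc⟩ := h1
  have ha : μ a ≠ OnePoint.infty := fun h => hac (hμ.2.1 (h.trans hμc.symm))
  have hb : μ b ≠ OnePoint.infty := fun h => hbc (hμ.2.1 (h.trans hμc.symm))
  have hab' : μ a ≠ μ b := fun h => hab (hμ.2.1 h)
  rw [← coe_toC ha, ← coe_toC hb] at hab'
  set α := toC (μ a)
  set β := toC (μ b)
  have hne : β - α ≠ 0 := fun h => hab' (by rw [sub_eq_zero.1 h])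
  have hd : max (X - C α : ℂ[X]).natDegree (C (β - α)).natDegree = 1 := by simp
  have hR : RatMap (X - C α) (C (β - α)) := ⟨⟨0, C (β - α)⁻¹, by rw [zero_mul, zero_add, ← C_mul, inv_mul_cancel₀ hne, C_1]⟩, hd.ge⟩
  refine ⟨ratEval (X - C α) (C (β - α)) ∘ μ, (mob_rat hR hd).comp hμ, ?_, ?_, ?_⟩
  · rw [Function.comp, ← coe_toC ha, ratEval_coe, if_neg (by simpa using hne)]
    simp [α]
  · rw [Function.comp, ← coe_toC hb, ratEval_coe, if_neg (by simpa using hne)]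
    have : toC (μ b) - α ≠ 0 := hne
    simp [div_self this, β]
  · rw [Function.comp, hμc]
    simp [ratEval]

theorem Mob.unif {μ : Sphere → Sphere} (h : Mob μ) {ε : ℝ} (hε : 0 < ε) :
    ∃ δ : ℝ, 0 < δ ∧ ∀ x y, sphDist (μ x) (μ y) < δ → sphDist x y < ε := by
  have hK : IsCompact {x : Sphere × Sphere | ε ≤ sphDist x.1 x.2} :=
    (isClosed_le continuous_const sphDist_continuous).isCompact
  rcases Set.eq_empty_or_nonempty {x : Sphere × Sphere | ε ≤ sphDist x.1 x.2} with he | hne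
  · refine ⟨1, one_pos, fun x y _ => ?_⟩
    by_contra hcon
    have : (x, y) ∈ {x : Sphere × Sphere | ε ≤ sphDist x.1 x.2} := not_lt.1 hcon
    rw [he] at this; exact this
  · have hcont : Continuous fun x : Sphere × Sphere => sphDist (μ x.1) (μ x.2) :=
      sphDist_continuous.comp ((h.1.comp continuous_fst).prodMk (h.1.comp continuous_snd))
    obtain ⟨u, hu, hmin⟩ := hK.exists_isMinOn hne hcont.continuousOn
    refine ⟨sphDist (μ u.1) (μ u.2), ?_, fun x y hxy => ?_⟩
    · refine lt_of_le_of_ne (sphDist_nonneg _ _) fun h0 => ?_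
      have h1 := h.2.1 (sphDist_eq_zero h0.symm)
      have : ε ≤ sphDist u.1 u.2 := hu
      rw [h1, sphDist_self] at this
      linarith
    · by_contra hcon
      exact absurd (hmin (show (x, y) ∈ _ from not_lt.1 hcon)) (not_le.2 hxy)

variable {p q} in
theorem HolAt.itComp (hg : Good p q) {F : ℂ → Sphere} {z : ℂ} (h : HolAt F z) (w : ℕ → Fin N) (n : ℕ) :
    HolAt (fun u => itComp p q w n (F u)) z := by
  induction n with
  | zero => exact h
  | succ n ih => exact ih.comp (hg.rat _)

theorem exists_chart (ζ : Sphere) : ∃ (e : Sphere → Sphere) (c : ℂ), IsChart e ∧ e c = ζ := by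
  induction ζ using OnePoint.rec with
  | infty => exact ⟨sinv, 0, Or.inr rfl, sinv_zero⟩
  | coe c => exact ⟨id, c, Or.inl rfl, rfl⟩

variable {p q} in
theorem montelFatou (hg : Good p q) {w : ℕ → Fin N} {ζ : Sphere} {V : Set Sphere} (hV : IsOpen V) (hζ : ζ ∈ V)
    {a b c : Sphere} (hab : a ≠ b) (hac : a ≠ c) (hbc : b ≠ c)
    (hav : ∀ n, ∀ z ∈ V, SkewRational.itComp p q w n z ≠ a ∧ SkewRational.itComp p q w n z ≠ b ∧ SkewRational.itComp p q w n z ≠ c) :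
    ζ ∈ fatouW p q w := by
  obtain ⟨μ, hμ, hμa, hμb, hμc⟩ := mobius hab hac hbc
  obtain ⟨e, ζ0, he, heζ⟩ := exists_chart ζ
  have hEc : Continuous fun u : ℂ => e (u : Sphere) := he.cont.comp OnePoint.continuous_coe
  obtain ⟨ρ, hρ, hball⟩ := Metric.isOpen_iff.1 (hV.preimage hEc) ζ0 (by simpa [heζ] using hζ)
  have himg : ∀ S : Set ℂ, (fun u : ℂ => e (u : Sphere)) '' S = e ⁻¹' ((fun u : ℂ => (u : Sphere)) '' S) := by
    intro S; ext x
    constructor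
    · rintro ⟨u, hu, rfl⟩; exact ⟨u, hu, (he.invol _).symm⟩
    · rintro ⟨u, hu, h⟩; exact ⟨u, hu, by simp only [h, he.invol]⟩
  refine ⟨(fun u : ℂ => e (u : Sphere)) '' Metric.ball ζ0 (ρ / 16), ?_, ⟨ζ0, Metric.mem_ball_self (by positivity), heζ⟩, ?_⟩
  · rw [himg]
    exact (OnePoint.isOpenEmbedding_coe.isOpenMap _ Metric.isOpen_ball).preimage he.cont
  obtain ⟨C, hC, hlip⟩ := montelLip
  intro s hs
  choose k hk1 hk using hs
  obtain ⟨φ, hφ, g, hlim⟩ := ascoliSeq (isCompact_closedBall ζ0 (ρ / 16)) (fun n u => s n (e u)) (by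
    intro ε hε
    obtain ⟨δ, hδ, hu⟩ := hμ.unif hε
    refine ⟨δ / (C / ρ), by positivity, fun n z hz z' hz' hd => ?_⟩
    apply hu
    have hsub : Metric.closedBall ζ0 (ρ / 16) ⊆ Metric.ball ζ0 (ρ / 8) := Metric.closedBall_subset_ball (by linarith)
    have hsub' : Metric.ball ζ0 (ρ / 8) ⊆ Metric.ball ζ0 ρ := Metric.ball_subset_ball (by linarith)
    have hav' : ∀ u ∈ Metric.ball ζ0 ρ, μ (s n (e u)) ≠ OnePoint.infty ∧ μ (s n (e u)) ≠ ((0 : ℂ) : Sphere) ∧ μ (s n (e u)) ≠ ((1 : ℂ) : Sphere) := by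
      intro u hu
      obtain ⟨h1, h2, h3⟩ := hav (k n) _ (hball hu)
      rw [hk n]
      exact ⟨fun h => h3 (hμ.2.1 (h.trans hμc.symm)), fun h => h1 (hμ.2.1 (h.trans hμa.symm)), fun h => h2 (hμ.2.1 (h.trans hμb.symm))⟩
    have hhol : ∀ u, HolAt (fun u => μ (s n (e u))) u := fun u => by
      rw [hk n]
      exact hμ.2.2 _ _ ((HolAt.of_chart he u).itComp hg w (k n))
    have := hlip ζ0 ρ (fun u => toC (μ (s n (e u)))) hρ
      (fun u hu => ((hhol u).diff (hav' u hu).1).differentiableWithinAt)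
      (fun u hu => ⟨fun h => (hav' u hu).2.1 (by rw [← h, coe_toC (hav' u hu).1]),
        fun h => (hav' u hu).2.2 (by rw [← h, coe_toC (hav' u hu).1])⟩) z (hsub hz) z' (hsub hz')
    rw [coe_toC (hav' z (hsub' (hsub hz))).1, coe_toC (hav' z' (hsub' (hsub hz'))).1] at this
    refine this.trans_lt ?_
    rw [lt_div_iff₀ (by positivity)] at hd
    rwa [mul_comm])
  refine ⟨φ, hφ, fun z => g (toC (e z)), ?_⟩
  intro K hK _ ε hε
  filter_upwards [hlim ε hε] with n hn z hz
  obtain ⟨u, hu, rfl⟩ := hK hz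
  have := hn u (Metric.ball_subset_closedBall hu)
  simpa only [he.invol, toC_coe] using this

variable {p q} in
theorem julia_iter (hg : Good p q) {w : ℕ → Fin N} {ζ : Sphere} (h : ζ ∈ juliaW p q w) (d : ℕ) :
    SkewRational.itComp p q w d ζ ∈ juliaW p q (fun k => w (k + d)) := by
  induction d with
  | zero => exact h
  | succ d ih =>
    intro h'
    refine ih (fatou_bwd hg ?_)
    have e1 : shiftW (fun k => w (k + d)) = fun k => w (k + (d + 1)) := by
      funext k; simp only [shiftW]; rw [show k + 1 + d = k + (d + 1) by omega]
    rw [e1]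
    simpa [SkewRational.itComp] using h'

theorem cyl_nhds {w : ℕ → Fin N} {W : Set (ℕ → Fin N)} (hW : W ∈ 𝓝 w) :
    ∃ d, ∀ u : ℕ → Fin N, (∀ i < d, u i = w i) → u ∈ W := by
  by_contra! h
  choose u hu1 hu2 using h
  have : Tendsto u atTop (𝓝 w) := by
    rw [tendsto_pi_nhds]
    intro n
    refine tendsto_const_nhds.congr' ?_
    filter_upwards [eventually_gt_atTop n] with k hk
    exact (hu1 k n hk).symm
  obtain ⟨n, hn⟩ := (this.eventually_mem hW).exists
  exact hu2 n hn

theorem T_preW (w : ℕ → Fin N) (d : ℕ) (u : ℕ → Fin N) (v : Sphere) :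
    (Tmap p q)^[d] (preW w d u, v) = (u, itComp p q w d v) := by
  rw [Tmap_iter]
  have e1 : itComp p q (preW w d u) d = itComp p q w d := itComp_congr p q fun i hi => by simp [preW, hi]
  have e2 : (fun n => (preW w d u) (n + d)) = u := by funext n; simp [preW]
  simp only [e1, e2]

variable {p q} in
theorem itComp_open (hg : Good p q) (w : ℕ → Fin N) (n : ℕ) : IsOpenMap (itComp p q w n) := by
  induction n with
  | zero => exact IsOpenMap.id
  | succ n ih => exact (hg.rat _).openMap.comp ih

variable {p q} in
theorem exc_fin (hg : Good p q) (hA1 : NoSuperAttract p q) {A : Set Sphere} (hA : A.Finite)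
    (hinv : ∀ i z, ratEval (p i) (q i) z ∈ A → z ∈ A) {x : SymX N} (hx : x ∈ juliaSet p q) : x.2 ∉ A := by
  intro hz
  obtain ⟨i, hi⟩ := hg.2.2.2
  have hR := hg.rat i
  choose τ hτ using fun a : A => hR.surj (a : Sphere)
  have hτA : ∀ a : A, τ a ∈ A := fun a => hinv i _ (by rw [hτ a]; exact a.2)
  let t : A → A := fun a => ⟨τ a, hτA a⟩
  have tinj : Function.Injective t := by
    intro a b h
    have : τ a = τ b := congrArg Subtype.val h
    have h2 := hτ a
    rw [this, hτ b] at h2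
    exact Subtype.ext h2.symm
  have : Finite A := hA
  have tsurj : Function.Surjective t := Finite.surjective_of_injective tinj
  have hcrit : ∀ a : A, 2 ≤ cnt (p i) (q i) (t a : Sphere) := by
    intro a
    rw [cnt]
    have : fiber (p i) (q i) (ratEval (p i) (q i) (t a : Sphere)) = Multiset.replicate (fiber (p i) (q i) (ratEval (p i) (q i) (t a : Sphere))).card (t a : Sphere) := by
      rw [Multiset.eq_replicate_card]
      intro b hb
      rw [hR.mem_fiber] at hb
      have hb' : ratEval (p i) (q i) b = a := hb.trans (hτ a)
      have hbA : b ∈ A := hinv i b (by rw [hb']; exact a.2)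
      obtain ⟨a', ha'⟩ := tsurj ⟨b, hbA⟩
      have h1 : τ a' = b := congrArg Subtype.val ha'
      have h2 := hτ a'
      rw [h1, hb'] at h2
      have : a = a' := Subtype.ext h2
      rw [this]; exact h1.symm
    rw [this, Multiset.count_replicate_self, hR.card_fiber]
    exact hi
  let y : ℕ → SymX N := fun n => ((consW i)^[n] x.1, (t^[n] ⟨x.2, hz⟩ : A))
  have hy : ∀ n, Tmap p q (y (n + 1)) = y n := by
    intro n
    simp only [y, Function.iterate_succ_apply', Tmap_cons]
    rw [show ratEval (p i) (q i) (t (t^[n] ⟨x.2, hz⟩) : A) = (t^[n] ⟨x.2, hz⟩ : A) from hτ _]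
  have hyJ : ∀ n, y n ∈ juliaSet p q := by
    intro n
    induction n with
    | zero => exact hx
    | succ n ih => exact julia_bwd hg (by rw [hy]; exact ih)
  have hyk : ∀ k n, (Tmap p q)^[k] (y (n + k)) = y n := by
    intro k
    induction k with
    | zero => intro n; rfl
    | succ k ih => intro n; rw [Function.iterate_succ_apply, ← add_assoc, hy, ih]
  obtain ⟨a, b, hab, he⟩ := Finite.exists_ne_map_eq_of_infinite (fun n : ℕ => t^[n + 1] ⟨x.2, hz⟩)
  wlog hlt : a < b generalizing a b
  · exact this b a hab.symm he.symm (lt_of_le_of_ne (not_lt.1 hlt) hab.symm)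
  refine no_return hg hA1 (hyJ (b + 1)) ?_ (j := b - a) (by omega) ?_
  · rw [critSet_iff]
    simp only [y, Function.iterate_succ_apply', cons_zero]
    exact hcrit _
  · have := hyk (b - a) (a + 1)
    rw [show a + 1 + (b - a) = b + 1 by omega] at this
    rw [this]
    exact congrArg Subtype.val he

variable {p q} in
theorem reachPt (hg : Good p q) (hA1 : NoSuperAttract p q) {O : Set (SymX N)} (hO : IsOpen O)
    (hne : (O ∩ juliaSet p q).Nonempty) {x : SymX N} (hx : x ∈ juliaSet p q) :
    ∃ k, ∃ x' ∈ O, (Tmap p q)^[k] x' = x := by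
  obtain ⟨y, hyO, hyJ⟩ := hne
  obtain ⟨⟨w, ζ⟩, hwO, hw⟩ := mem_closure_iff.1 hyJ O hO hyO
  obtain ⟨w', hw'⟩ := Set.mem_iUnion.1 hw
  obtain ⟨rfl, hζ⟩ := hw'
  simp only at hζ hwO
  obtain ⟨W, hW, V', hV', hWV⟩ := mem_nhds_prod_iff.1 (hO.mem_nhds hwO)
  obtain ⟨d, hd⟩ := cyl_nhds hW
  obtain ⟨V, hVV', hV, hζV⟩ := mem_nhds_iff.1 hV'
  set A : Set Sphere := {a | ¬ ∃ (l : ℕ → Fin N) (n : ℕ), ∃ v ∈ V, itComp p q l n (itComp p q w d v) = a} with hA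
  by_cases hz : x.2 ∈ A
  · exfalso
    refine exc_fin hg hA1 (A := A) ?_ ?_ hx hz
    · by_contra hinf
      obtain ⟨t, htA, ht⟩ := Set.Infinite.exists_subset_card_eq hinf 3
      obtain ⟨a, b, c, hab, hac, hbc, rfl⟩ := Finset.card_eq_three.1 ht
      have hmem : ∀ a ∈ A, ∀ n, ∀ z ∈ itComp p q w d '' V, itComp p q (fun k => w (k + d)) n z ≠ a := by
        rintro a ha n _ ⟨v, hv, rfl⟩ h
        exact ha ⟨_, n, v, hv, h⟩
      refine julia_iter hg hζ d (montelFatou hg (itComp_open hg w d _ hV) ⟨ζ, hζV, rfl⟩ hab hac hbc ?_)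
      intro n z hz
      exact ⟨hmem a (htA (by simp)) n z hz, hmem b (htA (by simp)) n z hz, hmem c (htA (by simp)) n z hz⟩
    · rintro i z hzA ⟨l, n, v, hv, h⟩
      refine hzA ⟨fun k => if k < n then l k else i, n + 1, v, hv, ?_⟩
      have : itComp p q (fun k => if k < n then l k else i) n = itComp p q l n :=
        itComp_congr p q fun k hk => by simp [hk]
      simp only [itComp, Function.comp, this, h, lt_irrefl, if_false]
  · simp only [hA, Set.mem_ofPred_eq, not_not] at hz
    obtain ⟨l, n, v, hv, h⟩ := hz
    refine ⟨n + d, (preW w d (preW l n x.1), v), hWV ⟨hd _ fun i hi => by simp [preW, hi], hVV' hv⟩, ?_⟩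
    rw [Function.iterate_add_apply, T_preW, T_preW, h]

variable {p q} in
theorem reach (hg : Good p q) (hA1 : NoSuperAttract p q) {O : Set (SymX N)} (hO : IsOpen O)
    (hne : (O ∩ juliaSet p q).Nonempty) :
    ∃ k0, ∀ x ∈ juliaSet p q, ∃ k ≤ k0, ∃ x' ∈ O, (Tmap p q)^[k] x' = x := by
  have hop : ∀ k, IsOpen ((Tmap p q)^[k] '' O) := by
    intro k
    induction k with
    | zero => simpa using hO
    | succ k ih =>
      rw [Function.iterate_succ', Set.image_comp]
      exact Tmap_open hg _ ih
  obtain ⟨t, ht⟩ := (julia_compact p q).elim_finite_subcover _ hop (by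
    intro x hx
    obtain ⟨k, x', hx', h⟩ := reachPt hg hA1 hO hne hx
    exact Set.mem_iUnion.2 ⟨k, x', hx', h⟩)
  refine ⟨t.sup id, fun x hx => ?_⟩
  obtain ⟨k, hk, x', hx', h⟩ := Set.mem_iUnion₂.1 (ht hx)
  exact ⟨k, Finset.le_sup (f := id) hk, x', hx', h⟩

abbrev Br (N : ℕ) := List (Fin N) × (ℂ → ℂ)

def lw (l : List (Fin N)) (w : ℕ → Fin N) : ℕ → Fin N := l.foldr consW w

def ev (β : Br N) (w : ℕ → Fin N) (z : ℂ) : SymX N := (lw β.1 w, (β.2 z : Sphere))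

theorem lw_agree (l : List (Fin N)) {w w' : ℕ → Fin N} {d : ℕ} (h : ∀ i < d, w i = w' i) :
    ∀ i < d, lw l w i = lw l w' i := by
  induction l with
  | nil => exact h
  | cons v l ih =>
    intro i hi
    cases i with
    | zero => simp [lw, consW]
    | succ i => simpa [lw, consW] using ih i (by omega)

/-- invariants of a finite family of branches -/
structure TInv (b : ℂ) (ρ : ℝ) (k : ℕ) (Γ : Finset (Br N)) : Prop where
  len : ∀ β ∈ Γ, β.1.length = k
  diff : ∀ β ∈ Γ, DifferentiableOn ℂ β.2 (Metric.ball b ρ)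
  sec : ∀ β ∈ Γ, ∀ w, ∀ z ∈ Metric.ball b ρ, (Tmap p q)^[k] (ev β w z) = (w, (z : Sphere))
  dist : ∀ β ∈ Γ, ∀ β' ∈ Γ, β.1 = β'.1 → ∀ z ∈ Metric.ball b ρ, β.2 z = β'.2 z → β = β'

variable {p q} in
theorem tree_step (hg : Good p q) {b : ℂ} {ρ : ℝ} (hρ : 0 < ρ) {k : ℕ} {Γ : Finset (Br N)} {S : Finset ℂ}
    (hΓ : TInv p q b ρ k Γ) (hS : ∀ β ∈ Γ, ∀ z ∈ Metric.ball b ρ, β.2 z ∉ S)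
    (hS1 : ∀ v c, 2 ≤ cnt (p v) (q v) c → ∀ s : ℂ, ratEval (p v) (q v) c = (s : Sphere) → s ∈ S)
    (hS2 : ∀ v, ∀ s : ℂ, ratEval (p v) (q v) OnePoint.infty = (s : Sphere) → s ∈ S) :
    ∃ Γ' : Finset (Br N), TInv p q b ρ (k + 1) Γ' ∧
      (∀ β' ∈ Γ', ∃ β ∈ Γ, ∀ w, ∀ z ∈ Metric.ball b ρ, Tmap p q (ev β' w z) = ev β w z) ∧
      ∀ (f : SymX N → ℝ) (n : ℕ) (w : ℕ → Fin N), ∀ z ∈ Metric.ball b ρ,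
        ∑ β ∈ Γ, Real.exp (birk p q f k (ev β w z)) * LSum p q f (n + 1) (ev β w z) =
        ∑ β ∈ Γ', Real.exp (birk p q f (k + 1) (ev β w z)) * LSum p q f n (ev β w z) := by
  have hl : ∀ (β : Br N) (v : Fin N), β ∈ Γ → ∃ Λ : Finset (ℂ → ℂ), (∀ ψ ∈ Λ, DifferentiableOn ℂ ψ (Metric.ball b ρ)) ∧
      (∀ z ∈ Metric.ball b ρ, fiber (p v) (q v) (β.2 z : Sphere) = Λ.val.map (fun ψ => (ψ z : Sphere))) ∧
      (∀ z ∈ Metric.ball b ρ, ∀ ψ ∈ Λ, ∀ ψ' ∈ Λ, ψ z = ψ' z → ψ = ψ') := by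
    intro β v hβ
    refine (hg.rat v).lift hρ (hΓ.diff β hβ) ?_ ?_
    · intro z hz c hc h; exact hS β hβ z hz (hS1 v c hc _ h)
    · intro z hz h; exact hS β hβ z hz (hS2 v _ h)
  choose! Λ hΛd hΛf hΛi using hl
  have hR : ∀ β ∈ Γ, ∀ v, ∀ ψ ∈ Λ β v, ∀ z ∈ Metric.ball b ρ, ratEval (p v) (q v) (ψ z : Sphere) = (β.2 z : Sphere) := by
    intro β hβ v ψ hψ z hz
    rw [← (hg.rat v).mem_fiber, hΛf β v hβ z hz]
    exact Multiset.mem_map.2 ⟨ψ, hψ, rfl⟩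
  have hT : ∀ β ∈ Γ, ∀ v, ∀ ψ ∈ Λ β v, ∀ w, ∀ z ∈ Metric.ball b ρ, Tmap p q (ev (v :: β.1, ψ) w z) = ev β w z := by
    intro β hβ v ψ hψ w z hz
    simp only [ev, lw, List.foldr_cons, Tmap_cons, hR β hβ v ψ hψ z hz]
  have hb : b ∈ Metric.ball b ρ := Metric.mem_ball_self hρ
  have huniq : ∀ β ∈ Γ, ∀ β' ∈ Γ, ∀ v v' ψ ψ', ψ ∈ Λ β v → ψ' ∈ Λ β' v' → (v :: β.1) = (v' :: β'.1) →
      ∀ z ∈ Metric.ball b ρ, ψ z = ψ' z → β = β' ∧ v = v' ∧ ψ = ψ' := by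
    intro β hβ β' hβ' v v' ψ ψ' hψ hψ' hl z hz hzz
    obtain ⟨rfl, hll⟩ := List.cons_eq_cons.1 hl
    have : β = β' := by
      refine hΓ.dist β hβ β' hβ' hll z hz ?_
      apply OnePoint.coe_injective
      rw [← hR β hβ v ψ hψ z hz, ← hR β' hβ' v ψ' hψ' z hz, hzz]
    subst this
    exact ⟨rfl, rfl, hΛi β v hβ z hz ψ hψ ψ' hψ' hzz⟩
  set Γ' : Finset (Br N) := Γ.biUnion fun β => Finset.univ.biUnion fun v => (Λ β v).image fun ψ => (v :: β.1, ψ) with hΓ'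
  have hmem : ∀ β', β' ∈ Γ' ↔ ∃ β ∈ Γ, ∃ v, ∃ ψ ∈ Λ β v, (v :: β.1, ψ) = β' := by
    intro β'; simp [hΓ']
  refine ⟨Γ', ⟨?_, ?_, ?_, ?_⟩, ?_, ?_⟩
  · intro β' h
    obtain ⟨β, hβ, v, ψ, hψ, rfl⟩ := (hmem β').1 h
    simp [hΓ.len β hβ]
  · intro β' h
    obtain ⟨β, hβ, v, ψ, hψ, rfl⟩ := (hmem β').1 h
    exact hΛd β v hβ ψ hψ
  · intro β' h w z hz
    obtain ⟨β, hβ, v, ψ, hψ, rfl⟩ := (hmem β').1 h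
    rw [Function.iterate_succ_apply, hT β hβ v ψ hψ w z hz, hΓ.sec β hβ w z hz]
  · intro β₁ h₁ β₂ h₂ hl z hz hzz
    obtain ⟨β, hβ, v, ψ, hψ, rfl⟩ := (hmem _).1 h₁
    obtain ⟨β', hβ', v', ψ', hψ', rfl⟩ := (hmem _).1 h₂
    obtain ⟨rfl, rfl, rfl⟩ := huniq β hβ β' hβ' v v' ψ ψ' hψ hψ' hl z hz hzz
    rfl
  · intro β' h
    obtain ⟨β, hβ, v, ψ, hψ, rfl⟩ := (hmem β').1 h
    exact ⟨β, hβ, hT β hβ v ψ hψ⟩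
  · intro f n w z hz
    rw [hΓ', Finset.sum_biUnion]
    · refine Finset.sum_congr rfl fun β hβ => ?_
      rw [Finset.sum_biUnion]
      · rw [show n + 1 = 1 + n by omega, LSum_add hg, preimTn_one, preimT]
        rw [← Multiset.coe_mapAddMonoidHom, map_sum, ← Multiset.coe_sumAddMonoidHom, map_sum, Finset.mul_sum]
        refine Finset.sum_congr rfl fun v _ => ?_
        rw [Finset.sum_image (by intro ψ _ ψ' _ h; exact (Prod.ext_iff.1 h).2)]
        simp only [Multiset.coe_mapAddMonoidHom, Multiset.coe_sumAddMonoidHom, Multiset.map_map]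
        have e1 : fiber (p v) (q v) (ev β w z).2 = (Λ β v).val.map (fun ψ => (ψ z : Sphere)) := hΛf β v hβ z hz
        rw [e1, Multiset.map_map]
        change _ * (∑ ψ ∈ Λ β v, _) = _
        rw [Finset.mul_sum]
        refine Finset.sum_congr rfl fun ψ hψ => ?_
        have e2 : (consW v (ev β w z).1, (ψ z : Sphere)) = ev (v :: β.1, ψ) w z := rfl
        simp only [Function.comp, e2]
        rw [show k + 1 = 1 + k by omega, birk_add, Function.iterate_one, hT β hβ v ψ hψ w z hz, Real.exp_add]
        ring
      · intro v _ v' _ hne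
        rw [Function.onFun, Finset.disjoint_left]
        intro x hx hx'
        obtain ⟨ψ, _, rfl⟩ := Finset.mem_image.1 hx
        obtain ⟨ψ', _, h⟩ := Finset.mem_image.1 hx'
        exact hne (List.cons_eq_cons.1 (Prod.ext_iff.1 h).1).1.symm
    · intro β hβ β' hβ' hne
      rw [Function.onFun, Finset.disjoint_left]
      intro x hx hx'
      simp only [Finset.mem_biUnion, Finset.mem_univ, true_and, Finset.mem_image] at hx hx'
      obtain ⟨v, ψ, hψ, rfl⟩ := hx
      obtain ⟨v', ψ', hψ', h⟩ := hx'
      obtain ⟨h1, h2⟩ := Prod.ext_iff.1 h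
      exact hne (huniq β hβ β' hβ' v v' ψ ψ' hψ hψ' h1.symm b hb (by simp only at h2; rw [h2])).1

variable {p q} in
theorem dead_card {b : ℂ} {ρ : ℝ} {k : ℕ} {Γ : Finset (Br N)} {S : Finset ℂ} (hN : 1 ≤ N)
    (hΓ : TInv p q b ρ k Γ) :
    (Γ.filter fun β => ∃ z ∈ Metric.ball b ρ, β.2 z ∈ S).card ≤ S.card * N ^ k := by
  have hz : ∀ β : Br N, ∃ z : ℂ, (∃ z ∈ Metric.ball b ρ, β.2 z ∈ S) → z ∈ Metric.ball b ρ ∧ β.2 z ∈ S := by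
    intro β
    by_cases h : ∃ z ∈ Metric.ball b ρ, β.2 z ∈ S
    · obtain ⟨z, h1, h2⟩ := h; exact ⟨z, fun _ => ⟨h1, h2⟩⟩
    · exact ⟨0, fun h' => absurd h' h⟩
  choose ζ hζ using hz
  obtain ⟨Tg, hTg⟩ : ∃ Tg : Finset (List (Fin N) × ℂ), Tg = ((Finset.univ : Finset (Fin k → Fin N)).image List.ofFn) ×ˢ S := ⟨_, rfl⟩
  have hcard : Tg.card ≤ S.card * N ^ k := by
    rw [hTg, Finset.card_product, mul_comm]
    refine Nat.mul_le_mul_left _ (Finset.card_image_le.trans ?_)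
    rw [Finset.card_univ]; simp
  refine le_trans ?_ hcard
  refine Finset.card_le_card_of_injOn (fun β => (β.1, β.2 (ζ β))) ?_ ?_
  · intro β hβ
    simp only [Finset.coe_filter, Set.mem_ofPred_eq] at hβ
    rw [hTg]
    have hl := hΓ.len β hβ.1
    refine Finset.mem_coe.2 (Finset.mem_product.2 ⟨Finset.mem_image.2 ⟨fun i => β.1.get ⟨i, by rw [hl]; exact i.2⟩, Finset.mem_univ _, ?_⟩, (hζ β hβ.2).2⟩)
    refine List.ext_getElem (by simp [hl]) ?_
    intro i h1 h2
    simp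
  · intro β hβ β' hβ' h
    simp only [Finset.coe_filter, Set.mem_ofPred_eq] at hβ hβ'
    obtain ⟨h1, h2⟩ := Prod.ext_iff.1 h
    simp only at h1 h2
    have w : ℕ → Fin N := fun _ => ⟨0, hN⟩
    have s1 := hΓ.sec β hβ.1 w _ (hζ β hβ.2).1
    have s2 := hΓ.sec β' hβ'.1 w _ (hζ β' hβ'.2).1
    have : ev β w (ζ β) = ev β' w (ζ β') := by simp only [ev, h1, h2]
    rw [this, s2] at s1
    have hzz : ζ β' = ζ β := OnePoint.coe_injective (Prod.ext_iff.1 s1).2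
    refine hΓ.dist β hβ.1 β' hβ'.1 h1 _ (hζ β hβ.2).1 ?_
    rw [h2, hzz]

variable {p q} in
theorem tree (hg : Good p q) {b : ℂ} {ρ : ℝ} (hρ : 0 < ρ) {S : Finset ℂ}
    (hS1 : ∀ v c, 2 ≤ cnt (p v) (q v) c → ∀ s : ℂ, ratEval (p v) (q v) c = (s : Sphere) → s ∈ S)
    (hS2 : ∀ v, ∀ s : ℂ, ratEval (p v) (q v) OnePoint.infty = (s : Sphere) → s ∈ S)
    {η : ℝ} (hS3 : ∀ (φ : ℂ → ℂ), DifferentiableOn ℂ φ (Metric.ball b ρ) → (∀ z ∈ Metric.ball b ρ, φ z ∉ S) →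
      ∀ z ∈ Metric.ball b (ρ / 8), ∀ z' ∈ Metric.ball b (ρ / 8), sphDist (φ z) (φ z') ≤ η)
    {h : ℕ} (hh : 1 ≤ h) (hF : ∀ j < h, ∀ w, ∀ s ∈ S, ∀ z ∈ Metric.ball b ρ, itComp p q w j ((s : ℂ) : Sphere) ≠ (z : Sphere))
    {f : SymX N → ℝ} {sf : ℝ} (hsf : ∀ y ∈ juliaSet p q, f y ≤ sf) {a : ℕ → ℝ}
    (ha : ∀ n, ∀ y ∈ juliaSet p q, LSum p q f n y ≤ a n)
    {dep : ℕ} {ε : ℝ} (hε : ∀ y ∈ juliaSet p q, ∀ y' ∈ juliaSet p q, (∀ i < dep, y.1 i = y'.1 i) → sphDist y.2 y'.2 ≤ η → f y ≤ f y' + ε)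
    (n : ℕ) {w w' : ℕ → Fin N} (hww : ∀ i < dep, w i = w' i) {z z' : ℂ} (hz : z ∈ Metric.ball b (ρ / 8)) (hz' : z' ∈ Metric.ball b (ρ / 8))
    (hx : (w, (z : Sphere)) ∈ juliaSet p q) (hx' : (w', (z' : Sphere)) ∈ juliaSet p q) :
    LSum p q f n (w, (z : Sphere)) ≤ Real.exp (n * ε) * LSum p q f n (w', (z' : Sphere)) +
      ∑ j ∈ Finset.range n, if h ≤ j + 1 then S.card * (N * Real.exp sf) ^ (j + 1) * a (n - (j + 1)) else 0 := by
  have hsub : Metric.ball b (ρ / 8) ⊆ Metric.ball b ρ := Metric.ball_subset_ball (by linarith)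
  have hbz := hsub hz
  have hbz' := hsub hz'
  have apos : ∀ n, 0 ≤ a n := fun n => (LSum_pos hg f n _).le.trans (ha n _ hx)
  have hbirk : ∀ k, ∀ y ∈ juliaSet p q, birk p q f k y ≤ k * sf := by
    intro k y hy
    rw [birk]
    refine (Finset.sum_le_card_nsmul _ _ sf fun i _ => hsf _ (julia_fwd_iter hg i hy)).trans ?_
    simp
  have main : ∀ k ≤ n, ∃ Γ : Finset (Br N), TInv p q b ρ k Γ ∧ (∀ β ∈ Γ, ∀ z ∈ Metric.ball b ρ, β.2 z ∉ S) ∧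
      (LSum p q f n (w, (z : Sphere)) ≤ ∑ β ∈ Γ, Real.exp (birk p q f k (ev β w z)) * LSum p q f (n - k) (ev β w z) +
        ∑ j ∈ Finset.range k, if h ≤ j + 1 then S.card * (N * Real.exp sf) ^ (j + 1) * a (n - (j + 1)) else 0) ∧
      (∑ β ∈ Γ, Real.exp (birk p q f k (ev β w' z')) * LSum p q f (n - k) (ev β w' z') ≤ LSum p q f n (w', (z' : Sphere))) ∧
      (∀ β ∈ Γ, birk p q f k (ev β w z) ≤ birk p q f k (ev β w' z') + k * ε) := by
    intro k
    induction k with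
    | zero =>
      intro _
      refine ⟨{([], id)}, ⟨by simp, by simpa using differentiableOn_id, by simp [ev, lw], by simp⟩, ?_, ?_, ?_, ?_⟩
      · intro β hβ z hz hs
        rw [Finset.mem_singleton] at hβ
        subst hβ
        exact hF 0 (by omega) w z hs z hz rfl
      · simp [birk, ev, lw]
      · simp [birk, ev, lw]
      · simp [birk]
    | succ k ih =>
      intro hk
      obtain ⟨Γ, hΓ, hΓS, hle, hge, hcmp⟩ := ih (by omega)
      obtain ⟨Γ', hΓ', hpar, hsum⟩ := tree_step hg hρ hΓ hΓS hS1 hS2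
      have hJ : ∀ β ∈ Γ', ev β w z ∈ juliaSet p q := fun β hβ =>
        julia_bwd_iter hg (k + 1) (by rw [hΓ'.sec β hβ w z hbz]; exact hx)
      have hJ' : ∀ β ∈ Γ', ev β w' z' ∈ juliaSet p q := fun β hβ =>
        julia_bwd_iter hg (k + 1) (by rw [hΓ'.sec β hβ w' z' hbz']; exact hx')
      set P : Br N → Prop := fun β => ∃ z ∈ Metric.ball b ρ, β.2 z ∈ S with hP
      have hnk : n - k = (n - (k + 1)) + 1 := by omega
      refine ⟨Γ'.filter fun β => ¬ P β, ?_, ?_, ?_, ?_, ?_⟩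
      · exact ⟨fun β hβ => hΓ'.len β (Finset.mem_filter.1 hβ).1, fun β hβ => hΓ'.diff β (Finset.mem_filter.1 hβ).1,
          fun β hβ => hΓ'.sec β (Finset.mem_filter.1 hβ).1,
          fun β hβ β' hβ' => hΓ'.dist β (Finset.mem_filter.1 hβ).1 β' (Finset.mem_filter.1 hβ').1⟩
      · intro β hβ z hz hs
        exact (Finset.mem_filter.1 hβ).2 ⟨z, hz, hs⟩
      · rw [hnk, hsum f _ w z hbz, ← Finset.sum_filter_add_sum_filter_not Γ' P] at hle
        rw [Finset.sum_range_succ]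
        have hdead : ∑ β ∈ Γ' with P β, Real.exp (birk p q f (k + 1) (ev β w z)) * LSum p q f (n - (k + 1)) (ev β w z) ≤
            if h ≤ k + 1 then S.card * (N * Real.exp sf) ^ (k + 1) * a (n - (k + 1)) else 0 := by
          split_ifs with hhk
          · refine (Finset.sum_le_card_nsmul _ _ (Real.exp sf ^ (k + 1) * a (n - (k + 1))) fun β hβ => ?_).trans ?_
            · have hβ' := hJ β (Finset.mem_filter.1 hβ).1
              refine mul_le_mul ?_ (ha _ _ hβ') (LSum_pos hg f _ _).le (by positivity)
              rw [← Real.exp_nat_mul]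
              exact Real.exp_le_exp.2 (hbirk _ _ hβ')
            · rw [nsmul_eq_mul, mul_pow, ← mul_assoc, ← mul_assoc]
              refine mul_le_mul_of_nonneg_right (mul_le_mul_of_nonneg_right ?_ (by positivity)) (apos _)
              exact_mod_cast dead_card hg.1 hΓ'
          · rw [Finset.filter_eq_empty_iff.2, Finset.sum_empty]
            rintro β hβ ⟨u, hu, hs⟩
            have := hΓ'.sec β hβ w u hu
            rw [Tmap_iter] at this
            exact hF (k + 1) (by omega) _ _ hs u hu (Prod.ext_iff.1 this).2
        linarith
      · refine le_trans ?_ hge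
        rw [hnk, hsum f _ w' z' hbz']
        exact Finset.sum_le_sum_of_subset_of_nonneg (Finset.filter_subset _ _) fun β _ _ =>
          mul_nonneg (Real.exp_pos _).le (LSum_pos hg f _ _).le
      · intro β hβ
        obtain ⟨hβ', hβP⟩ := Finset.mem_filter.1 hβ
        obtain ⟨β₀, hβ₀, hT⟩ := hpar β hβ'
        have h1 := hcmp β₀ hβ₀
        have h2 : f (ev β w z) ≤ f (ev β w' z') + ε := by
          refine hε _ (hJ β hβ') _ (hJ' β hβ') (lw_agree β.1 hww) ?_
          exact hS3 β.2 (hΓ'.diff β hβ') (fun z hz hs => hβP ⟨z, hz, hs⟩) z hz z' hz'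
        rw [show k + 1 = 1 + k by omega, birk_add, birk_add, Function.iterate_one, hT w z hbz, hT w' z' hbz']
        simp only [birk, Finset.sum_range_one, Function.iterate_zero, id] at h1 h2 ⊢
        push_cast
        linarith
  obtain ⟨Γ, hΓ, hΓS, hle, hge, hcmp⟩ := main n le_rfl
  refine hle.trans (add_le_add_left ?_ _)
  refine le_trans ?_ (mul_le_mul_of_nonneg_left hge (Real.exp_pos _).le)
  rw [Finset.mul_sum]
  refine Finset.sum_le_sum fun β hβ => ?_
  rw [Nat.sub_self, LSum_zero, LSum_zero, mul_one, mul_one, ← Real.exp_add]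
  exact Real.exp_le_exp.2 (by linarith [hcmp β hβ])

theorem sub_exp {a : ℕ → ℝ} (h0 : a 0 = 1) (hpos : ∀ n, 0 < a n) (hsub : ∀ m n, a (m + n) ≤ a m * a n)
    {B : ℝ} (hB : ∀ n : ℕ, Real.exp (n * B) ≤ a n) :
    ∃ r : ℝ, (∀ n : ℕ, Real.exp (n * r) ≤ a n) ∧ ∀ ε > 0, ∀ᶠ n : ℕ in atTop, a n ≤ Real.exp (n * (r + ε)) := by
  have hS : Subadditive fun n => Real.log (a n) := by
    intro m n
    show Real.log (a (m + n)) ≤ _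
    rw [← Real.log_mul (hpos m).ne' (hpos n).ne']
    exact Real.log_le_log (hpos _) (hsub m n)
  have hbd : BddBelow (Set.range fun n => Real.log (a n) / n) := by
    refine ⟨min B 0, ?_⟩
    rintro _ ⟨n, rfl⟩
    rcases Nat.eq_zero_or_pos n with rfl | hn
    · simp
    · have hn' : (0 : ℝ) < n := by exact_mod_cast hn
      refine (min_le_left _ _).trans ?_
      show B ≤ Real.log (a n) / n
      rw [le_div_iff₀ hn', mul_comm, Real.le_log_iff_exp_le (hpos n)]
      exact hB n
  refine ⟨hS.lim, ?_, ?_⟩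
  · intro n
    rcases Nat.eq_zero_or_pos n with rfl | hn
    · simp [h0]
    · have hn' : (0 : ℝ) < n := by exact_mod_cast hn
      have := hS.lim_le_div hbd hn.ne'
      rw [le_div_iff₀ hn', mul_comm, Real.le_log_iff_exp_le (hpos n)] at this
      exact this
  · intro ε hε
    have h1 := (hS.tendsto_lim hbd).eventually (gt_mem_nhds (lt_add_of_pos_right hS.lim hε))
    filter_upwards [h1, eventually_gt_atTop 0] with n h hn
    have hn' : (0 : ℝ) < n := by exact_mod_cast hn
    rw [div_lt_iff₀ hn', mul_comm] at h
    exact (Real.log_le_iff_le_exp (hpos n)).1 h.le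

theorem record {a : ℕ → ℝ} {r s : ℝ} (hs : s < r) (ha : ∀ n : ℕ, Real.exp (n * r) ≤ a n) (n0 : ℕ) :
    ∃ n ≥ n0, ∀ k ≤ n, a (n - k) ≤ Real.exp (-(k * s)) * a n := by
  have h1 : Tendsto (fun n : ℕ => a n * Real.exp (-(n * s))) atTop atTop := by
    have h2 : Tendsto (fun n : ℕ => Real.exp ((n : ℝ) * (r - s))) atTop atTop :=
      Real.tendsto_exp_atTop.comp (tendsto_natCast_atTop_atTop.atTop_mul_const (by linarith))
    refine tendsto_atTop_mono (fun n => ?_) h2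
    have : Real.exp ((n : ℝ) * (r - s)) = Real.exp (n * r) * Real.exp (-(n * s)) := by
      rw [← Real.exp_add]; congr 1; ring
    rw [this]
    exact mul_le_mul_of_nonneg_right (ha n) (Real.exp_pos _).le
  obtain ⟨n, hn, h⟩ := Filter.high_scores h1 n0
  refine ⟨n, hn, fun k hk => ?_⟩
  rcases Nat.eq_zero_or_pos k with rfl | hk0
  · simp
  have h3 := (h (n - k) (by omega)).le
  have h4 := mul_le_mul_of_nonneg_right h3 (Real.exp_pos (((n - k : ℕ) : ℝ) * s)).le
  rw [mul_assoc, mul_assoc, ← Real.exp_add, ← Real.exp_add, Nat.cast_sub hk] at h4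
  rw [neg_add_cancel, Real.exp_zero, mul_one] at h4
  refine h4.trans (le_of_eq ?_)
  rw [mul_comm]; congr 2; ring

variable {p q} in
theorem covK (hg : Good p q) (hA1 : NoSuperAttract p q) (F : Finset Sphere) (hinf : OnePoint.infty ∈ F)
    {C : Set (SymX N)} (hC : IsCompact C) (hCJ : C ⊆ juliaSet p q) (hCF : ∀ u ∈ C, u.2 ∉ F) (dep : ℕ) :
    ∃ k0 : ℕ, ∀ u ∈ C, ∀ x ∈ juliaSet p q, ∃ k ≤ k0, ∃ (b : ℂ) (ρ : ℝ) (w w' : ℕ → Fin N) (z z' : ℂ),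
      0 < ρ ∧ (∀ y ∈ Metric.ball b ρ, ((y : ℂ) : Sphere) ∉ F) ∧ (∀ i < dep, w i = w' i) ∧
      z ∈ Metric.ball b (ρ / 8) ∧ z' ∈ Metric.ball b (ρ / 8) ∧ u = (w, (z : Sphere)) ∧
      (Tmap p q)^[k] (w', (z' : Sphere)) = x := by
  refine hC.induction_on (p := fun A => ∃ k0 : ℕ, ∀ u ∈ A, ∀ x ∈ juliaSet p q, ∃ k ≤ k0, ∃ (b : ℂ) (ρ : ℝ) (w w' : ℕ → Fin N) (z z' : ℂ),
      0 < ρ ∧ (∀ y ∈ Metric.ball b ρ, ((y : ℂ) : Sphere) ∉ F) ∧ (∀ i < dep, w i = w' i) ∧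
      z ∈ Metric.ball b (ρ / 8) ∧ z' ∈ Metric.ball b (ρ / 8) ∧ u = (w, (z : Sphere)) ∧
      (Tmap p q)^[k] (w', (z' : Sphere)) = x) ?_ ?_ ?_ ?_
  · exact ⟨0, fun u hu => absurd hu (Set.notMem_empty _)⟩
  · rintro A A' hAA' ⟨k0, h⟩
    exact ⟨k0, fun u hu => h u (hAA' hu)⟩
  · rintro A A' ⟨k0, h⟩ ⟨k1, h'⟩
    refine ⟨max k0 k1, fun u hu x hx => ?_⟩
    rcases hu with hu | hu
    · obtain ⟨k, hk, H⟩ := h u hu x hx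
      exact ⟨k, hk.trans (le_max_left _ _), H⟩
    · obtain ⟨k, hk, H⟩ := h' u hu x hx
      exact ⟨k, hk.trans (le_max_right _ _), H⟩
  · rintro ⟨w0, c⟩ hu
    have hcF := hCF _ hu
    simp only at hcF
    have hc : c ≠ OnePoint.infty := fun h => hcF (h ▸ hinf)
    obtain ⟨b, rfl⟩ : ∃ b : ℂ, c = (b : Sphere) := ⟨toC c, (coe_toC hc).symm⟩
    have hop : IsOpen ((fun y : ℂ => (y : Sphere)) ⁻¹' (F : Set Sphere)ᶜ) :=
      F.finite_toSet.isClosed.isOpen_compl.preimage OnePoint.continuous_coe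
    obtain ⟨ρ, hρ, hb⟩ := Metric.isOpen_iff.1 hop b (by simpa using hcF)
    have hVo : IsOpen ({w : ℕ → Fin N | ∀ i : Fin dep, w i = w0 i} ×ˢ ((fun y : ℂ => (y : Sphere)) '' Metric.ball b (ρ / 8))) :=
      (cyl_open dep fun i : Fin dep => w0 i).prod (OnePoint.isOpenEmbedding_coe.isOpenMap _ Metric.isOpen_ball)
    obtain ⟨V, hV⟩ : ∃ V, V = ({w : ℕ → Fin N | ∀ i : Fin dep, w i = w0 i} ×ˢ ((fun y : ℂ => (y : Sphere)) '' Metric.ball b (ρ / 8))) := ⟨_, rfl⟩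
    rw [← hV] at hVo
    have hmem : (w0, (b : Sphere)) ∈ V := by
      rw [hV]; exact ⟨fun i => rfl, b, Metric.mem_ball_self (by linarith), rfl⟩
    obtain ⟨k0, hk0⟩ := reach hg hA1 hVo ⟨_, hmem, hCJ hu⟩
    refine ⟨V, mem_nhdsWithin_of_mem_nhds (hVo.mem_nhds hmem), k0, ?_⟩
    rintro ⟨w, c⟩ hwc x hx
    rw [hV] at hwc
    obtain ⟨h1, z, hz, hzc⟩ := hwc
    obtain ⟨k, hk, ⟨w', c'⟩, hx', hT⟩ := hk0 x hx
    rw [hV] at hx'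
    obtain ⟨h1', z', hz', hzc'⟩ := hx'
    simp only at hzc hzc'
    subst hzc hzc'
    refine ⟨k, hk, b, ρ, w, w', z, z', hρ, fun y hy => by simpa using hb hy, fun i hi => ?_, hz, hz', rfl, hT⟩
    exact (h1 ⟨i, hi⟩).trans (h1' ⟨i, hi⟩).symm

variable {p q} in
theorem postF (S : Finset ℂ) (h : ℕ) : ∃ F : Finset Sphere, OnePoint.infty ∈ F ∧ F.card ≤ 1 + h * N ^ h * S.card ∧
    ∀ j < h, ∀ w : ℕ → Fin N, ∀ s ∈ S, itComp p q w j ((s : ℂ) : Sphere) ∈ F := by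
  by_cases hN : N = 0
  · subst hN
    exact ⟨{OnePoint.infty}, by simp, by simp, fun j _ w => (w 0).elim0⟩
  have hN' : 0 < N := Nat.pos_of_ne_zero hN
  let e : (Fin h → Fin N) → ℕ → Fin N := fun l i => if hi : i < h then l ⟨i, hi⟩ else ⟨0, hN'⟩
  refine ⟨insert OnePoint.infty (((Finset.range h ×ˢ (Finset.univ : Finset (Fin h → Fin N))) ×ˢ S).image
    fun t => itComp p q (e t.1.2) t.1.1 ((t.2 : ℂ) : Sphere)), Finset.mem_insert_self _ _, ?_, ?_⟩
  · refine (Finset.card_insert_le _ _).trans ?_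
    rw [add_comm]
    refine Nat.add_le_add_left (Finset.card_image_le.trans ?_) _
    rw [Finset.card_product, Finset.card_product, Finset.card_univ]
    simp
  · intro j hj w s hs
    refine Finset.mem_insert_of_mem (Finset.mem_image.2 ⟨((j, fun i => w i), s), ?_, ?_⟩)
    · simp [hj, hs]
    · refine congrFun (itComp_congr p q ?_) _
      intro i hi
      simp [e, hi.trans hj]

theorem geomTail {x : ℝ} (hx : 0 < x) (hx1 : x < 1) {h : ℕ} (hh : 1 ≤ h) (n : ℕ) :
    ∑ j ∈ Finset.range n, (if h ≤ j + 1 then x ^ (j + 1) else 0) ≤ x ^ h / (1 - x) := by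
  have key : ∀ n : ℕ, (1 - x) * ∑ j ∈ Finset.range n, (if h ≤ j + 1 then x ^ (j + 1) else 0) ≤ x ^ h - x ^ (max h (n + 1)) := by
    intro n
    induction n with
    | zero => simp [max_eq_left hh]
    | succ n ih =>
      rw [Finset.sum_range_succ, mul_add]
      by_cases hc : h ≤ n + 1
      · rw [max_eq_right hc] at ih
        rw [if_pos hc, max_eq_right (by omega)]
        have : x ^ (n + 1 + 1) = x ^ (n + 1) * x := pow_succ _ _
        rw [this]; linarith
      · rw [max_eq_left (by omega)] at ih
        rw [if_neg hc, max_eq_left (by omega)]; linarith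
  rw [le_div_iff₀ (by linarith), mul_comm]
  have := key n
  have : 0 < x ^ (max h (n + 1)) := pow_pos hx _
  linarith [key n]

theorem tailBound {a : ℕ → ℝ} {s θ x K : ℝ} {n m h : ℕ} (hmn : m ≤ n) (hh : 1 ≤ h)
    (hrec : ∀ k ≤ n, a (n - k) ≤ Real.exp (-(k * s)) * a n) (hK : 0 ≤ K) (han : 0 < a n)
    (hθ : 0 < θ) (hx1 : x < 1) (hθx : θ * Real.exp (-s) ≤ x) :
    ∑ j ∈ Finset.range (n - m), (if h ≤ j + 1 then K * θ ^ (j + 1) * a (n - m - (j + 1)) else 0) ≤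
      K * (Real.exp (-(m * s)) * a n) * (x ^ h / (1 - x)) := by
  have hx : 0 < x := lt_of_lt_of_le (mul_pos hθ (Real.exp_pos _)) hθx
  refine le_trans ?_ (mul_le_mul_of_nonneg_left (geomTail hx hx1 hh (n - m)) (by positivity))
  rw [Finset.mul_sum]
  refine Finset.sum_le_sum fun j hj => ?_
  have hj := Finset.mem_range.1 hj
  split_ifs with hc
  · have h1 := hrec (m + (j + 1)) (by omega)
    rw [← Nat.sub_sub] at h1
    have h2 : Real.exp (-(((m + (j + 1) : ℕ) : ℝ) * s)) = Real.exp (-(m * s)) * Real.exp (-s) ^ (j + 1) := by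
      rw [← Real.exp_nat_mul, ← Real.exp_add]; congr 1; push_cast; ring
    rw [h2] at h1
    have h3 : (θ * Real.exp (-s)) ^ (j + 1) ≤ x ^ (j + 1) := pow_le_pow_left₀ (by positivity) hθx _
    calc K * θ ^ (j + 1) * a (n - m - (j + 1)) ≤ K * θ ^ (j + 1) * (Real.exp (-(m * s)) * Real.exp (-s) ^ (j + 1) * a n) :=
          mul_le_mul_of_nonneg_left h1 (by positivity)
      _ = K * (Real.exp (-(m * s)) * a n) * (θ * Real.exp (-s)) ^ (j + 1) := by rw [mul_pow]; ring
      _ ≤ _ := mul_le_mul_of_nonneg_left h3 (by positivity)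
  · simp

theorem msum_split {α : Type*} (s : Multiset α) (P : α → Prop) [DecidablePred P] (g : α → ℝ) :
    (s.map g).sum = ((s.filter P).map g).sum + ((s.filter fun a => ¬ P a).map g).sum := by
  rw [← Multiset.sum_add, ← Multiset.map_add, Multiset.filter_add_not]

theorem msum_filter_le {α : Type*} (s : Multiset α) (P : α → Prop) [DecidablePred P] (g : α → ℝ) (hg : ∀ a ∈ s, 0 ≤ g a) :
    ((s.filter P).map g).sum ≤ (s.map g).sum := by
  rw [msum_split s P g]
  have := msum_nonneg (s := s.filter fun a => ¬ P a) (g := g) fun a ha => hg a (Multiset.mem_of_mem_filter ha)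
  linarith

variable {p q} in
theorem pickU (hg : Good p q) {O : Set (SymX N)} {f : SymX N → ℝ} {sf : ℝ} (hsf : ∀ y ∈ juliaSet p q, f y ≤ sf)
    {a : ℕ → ℝ} (ha : ∀ n, ∀ y ∈ juliaSet p q, LSum p q f n y ≤ a n) (ha0 : ∀ n, 0 < a n) {m n : ℕ} {y : SymX N} (hy : y ∈ juliaSet p q)
    {B : ℕ} (hB : ((preimTn p q m y).filter (· ∈ O)).card ≤ B) {c : ℝ} (hc : 0 ≤ c)
    (hu : ∀ u ∈ preimTn p q m y, u ∉ O → LSum p q f n u ≤ c) :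
    LSum p q f (m + n) y ≤ B * (Real.exp (m * sf) * a n) + a m * c := by
  rw [LSum_add hg, msum_split _ (· ∈ O)]
  have hb : ∀ u ∈ preimTn p q m y, birk p q f m u ≤ m * sf := by
    intro u hu
    have huJ := preimTn_mem hg hy hu
    rw [birk]
    have := Finset.sum_le_card_nsmul (Finset.range m) (fun k => f ((Tmap p q)^[k] u)) sf (fun k _ => hsf _ (julia_fwd_iter hg k huJ))
    simpa using this
  refine add_le_add ?_ ?_
  · refine (msum_le (c := Real.exp (m * sf) * a n) ?_).trans ?_
    · intro u hu
      have hu1 := Multiset.mem_of_mem_filter hu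
      exact mul_le_mul (Real.exp_le_exp.2 (hb u hu1)) (ha n u (preimTn_mem hg hy hu1)) (LSum_pos hg f n u).le (Real.exp_pos _).le
    · refine mul_le_mul_of_nonneg_right (by exact_mod_cast hB) ?_
      have := ha0 n
      positivity
  · refine (msum_mono (g' := fun u => Real.exp (birk p q f m u) * c) ?_).trans ?_
    · intro u hu'
      obtain ⟨h1, h2⟩ := Multiset.mem_filter.1 hu'
      exact mul_le_mul_of_nonneg_left (hu u h1 h2) (Real.exp_pos _).le
    · rw [Multiset.sum_map_mul_right]
      refine mul_le_mul_of_nonneg_right ?_ hc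
      exact (msum_filter_le _ _ _ fun _ _ => (Real.exp_pos _).le).trans (ha m y hy)

variable {p q} in
theorem netS (hg : Good p q) {η : ℝ} (hη : 0 < η) : ∃ S : Finset ℂ,
    (∀ v c, 2 ≤ cnt (p v) (q v) c → ∀ s : ℂ, ratEval (p v) (q v) c = (s : Sphere) → s ∈ S) ∧
    (∀ v, ∀ s : ℂ, ratEval (p v) (q v) OnePoint.infty = (s : Sphere) → s ∈ S) ∧
    ∀ (b : ℂ) (ρ : ℝ), 0 < ρ → ∀ (φ : ℂ → ℂ), DifferentiableOn ℂ φ (Metric.ball b ρ) → (∀ z ∈ Metric.ball b ρ, φ z ∉ S) →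
      ∀ z ∈ Metric.ball b (ρ / 8), ∀ z' ∈ Metric.ball b (ρ / 8), sphDist (φ z) (φ z') ≤ η := by
  obtain ⟨S, -, -, hS⟩ := netLemma η hη
  have hfin : (⋃ v : Fin N, (fun c => toC (ratEval (p v) (q v) c)) '' ({c : Sphere | 2 ≤ cnt (p v) (q v) c} ∪ {OnePoint.infty})).Finite :=
    Set.finite_iUnion fun v => (((hg.rat v).finite_crit).union (Set.finite_singleton _)).image _
  refine ⟨S ∪ hfin.toFinset, ?_, ?_, ?_⟩
  · intro v c hc s hs
    refine Finset.mem_union_right _ (hfin.mem_toFinset.2 (Set.mem_iUnion.2 ⟨v, c, Or.inl hc, ?_⟩))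
    simp only [hs, toC_coe]
  · intro v s hs
    refine Finset.mem_union_right _ (hfin.mem_toFinset.2 (Set.mem_iUnion.2 ⟨v, _, Or.inr rfl, ?_⟩))
    simp only [hs, toC_coe]
  · intro b ρ hρ φ hφ h
    exact hS b ρ φ hρ hφ fun z hz hm => h z hz (Finset.mem_union_left _ hm)

theorem chooseH {N : ℕ} (hN : 1 ≤ N) {a : ℕ → ℝ} {r : ℝ} (hup : ∀ ε > 0, ∀ᶠ n : ℕ in atTop, a n ≤ Real.exp (n * (r + ε)))
    {G : ℝ} (hG : 0 < G) {κ : ℕ} (hκ : 1 ≤ κ) (hκG : 4 * N ≤ Real.exp (κ * G)) (C M : ℕ) :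
    ∃ h : ℕ, 1 ≤ h ∧ (1 + h * N ^ h * C : ℝ) * M * Real.exp (-((κ * h : ℕ) * G)) ≤ 1 / 4 ∧
      4 * a (κ * h) * Real.exp (-((κ * h : ℕ) * (r - G / (4 * κ)))) * (C * (Real.exp (-G) ^ h / (1 - Real.exp (-G)))) ≤ 1 := by
  have hκ' : (0 : ℝ) < κ := by exact_mod_cast hκ
  have hN' : (0 : ℝ) < N := by exact_mod_cast hN
  have hN1 : (1 : ℝ) ≤ N := by exact_mod_cast hN
  have hx1 : Real.exp (-G) < 1 := (by rw [← Real.exp_zero]; exact Real.exp_lt_exp.2 (by linarith))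
  have e1 : ∀ᶠ h : ℕ in atTop, (1 + h * C : ℝ) * M * (1 / 4) ^ h ≤ 1 / 4 := by
    have h1 : Tendsto (fun h : ℕ => (h : ℝ) * (1 / 4 : ℝ) ^ h) atTop (𝓝 0) :=
      tendsto_self_mul_const_pow_of_lt_one (by norm_num) (by norm_num)
    have h2 : Tendsto (fun h : ℕ => (1 / 4 : ℝ) ^ h) atTop (𝓝 0) :=
      tendsto_pow_atTop_nhds_zero_of_lt_one (by norm_num) (by norm_num)
    have h3 := (h2.const_mul (M : ℝ)).add (h1.const_mul ((C : ℝ) * M))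
    simp only [mul_zero, add_zero] at h3
    filter_upwards [h3.eventually (gt_mem_nhds (show (0 : ℝ) < 1 / 4 by norm_num))] with h hh
    nlinarith [hh]
  have e2 : ∀ᶠ h : ℕ in atTop, 4 * C * Real.exp (-(G / 2)) ^ h ≤ 1 - Real.exp (-G) := by
    have h2 : Tendsto (fun h : ℕ => Real.exp (-(G / 2)) ^ h) atTop (𝓝 0) :=
      tendsto_pow_atTop_nhds_zero_of_lt_one (Real.exp_pos _).le ((by rw [← Real.exp_zero]; exact Real.exp_lt_exp.2 (by linarith)))
    have h3 := h2.const_mul (4 * C : ℝ)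
    rw [mul_zero] at h3
    filter_upwards [h3.eventually (gt_mem_nhds (show (0 : ℝ) < 1 - Real.exp (-G) by linarith))] with h hh using hh.le
  have ht : Tendsto (fun h : ℕ => κ * h) atTop atTop := tendsto_id.const_mul_atTop' hκ
  have e3 := ht.eventually (hup (G / (4 * κ)) (by positivity))
  obtain ⟨h, h1, h2, h3, hh⟩ := (e1.and (e2.and (e3.and (eventually_ge_atTop 1)))).exists
  refine ⟨h, hh, ?_, ?_⟩
  · have hpe : Real.exp (-((κ * h : ℕ) * G)) ≤ (1 / 4) ^ h * (1 / N) ^ h := by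
      have : Real.exp (-((κ * h : ℕ) * G)) = (Real.exp (κ * G))⁻¹ ^ h := by
        rw [← Real.exp_neg, ← Real.exp_nat_mul]; congr 1; push_cast; ring
      rw [this, ← mul_pow]
      refine pow_le_pow_left₀ (by positivity) ?_ _
      have h5 : (Real.exp (κ * G))⁻¹ ≤ (4 * (N : ℝ))⁻¹ := inv_anti₀ (by positivity) hκG
      refine h5.trans (le_of_eq ?_)
      field_simp
    have hNh : (N : ℝ) ^ h * (1 / N) ^ h = 1 := by rw [← mul_pow]; simp [hN'.ne']
    have hle1 : (1 / (N : ℝ)) ^ h ≤ 1 := pow_le_one₀ (by positivity) (by rw [div_le_one hN']; exact hN1)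
    calc (1 + h * N ^ h * C : ℝ) * M * Real.exp (-((κ * h : ℕ) * G)) ≤ (1 + h * N ^ h * C : ℝ) * M * ((1 / 4) ^ h * (1 / N) ^ h) :=
          mul_le_mul_of_nonneg_left hpe (by positivity)
      _ = ((1 / N) ^ h + h * (N ^ h * (1 / N) ^ h) * C : ℝ) * M * (1 / 4) ^ h := by ring
      _ ≤ (1 + h * C : ℝ) * M * (1 / 4) ^ h := by
          rw [hNh, mul_one]; gcongr
      _ ≤ _ := h1
  · have h5 : a (κ * h) * Real.exp (-((κ * h : ℕ) * (r - G / (4 * κ)))) ≤ Real.exp (G / 2) ^ h := by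
      refine (mul_le_mul_of_nonneg_right h3 (Real.exp_pos _).le).trans (le_of_eq ?_)
      rw [← Real.exp_add, ← Real.exp_nat_mul]; congr 1; push_cast; field_simp; ring
    have hx : 0 < 1 - Real.exp (-G) := by linarith
    have hpos : (0 : ℝ) ≤ C * (Real.exp (-G) ^ h / (1 - Real.exp (-G))) := by positivity
    calc 4 * a (κ * h) * Real.exp (-((κ * h : ℕ) * (r - G / (4 * κ)))) * (C * (Real.exp (-G) ^ h / (1 - Real.exp (-G))))
        = 4 * ((a (κ * h) * Real.exp (-((κ * h : ℕ) * (r - G / (4 * κ))))) * (C * (Real.exp (-G) ^ h / (1 - Real.exp (-G))))) := by ring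
      _ ≤ 4 * (Real.exp (G / 2) ^ h * (C * (Real.exp (-G) ^ h / (1 - Real.exp (-G))))) := by
          have := mul_le_mul_of_nonneg_right h5 hpos
          linarith
      _ = 4 * C * (Real.exp (G / 2) * Real.exp (-G)) ^ h / (1 - Real.exp (-G)) := by rw [mul_pow]; ring
      _ = 4 * C * Real.exp (-(G / 2)) ^ h / (1 - Real.exp (-G)) := by
          rw [← Real.exp_add]; congr 4; ring
      _ ≤ 1 := by rw [div_le_one hx]; exact h2

set_option maxHeartbeats 1000000 in
variable {p q} in
theorem key1 (hg : Good p q) (hA1 : NoSuperAttract p q) {f : SymX N → ℝ} {M0 : ℝ} (hM : ∀ x, |f x| ≤ M0)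
    {sf : ℝ} (hsf : ∀ y ∈ juliaSet p q, f y ≤ sf)
    (hcont : ∀ ε > 0, ∃ (dep : ℕ) (η : ℝ), 0 < η ∧ ∀ y ∈ juliaSet p q, ∀ y' ∈ juliaSet p q,
      (∀ i < dep, y.1 i = y'.1 i) → sphDist y.2 y'.2 ≤ η → f y ≤ f y' + ε)
    {a : ℕ → ℝ} (ha : ∀ n, ∀ y ∈ juliaSet p q, LSum p q f n y ≤ a n) (ha0 : ∀ n, 0 < a n)
    (hatt : ∀ n, ∃ y ∈ juliaSet p q, 3 / 4 * a n < LSum p q f n y)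
    {r : ℝ} (hlo : ∀ n : ℕ, Real.exp (n * r) ≤ a n) (hup : ∀ ε > 0, ∀ᶠ n : ℕ in atTop, a n ≤ Real.exp (n * (r + ε)))
    (hr : Real.log N + sf < r) {β : ℝ} (hβ : β < r) :
    ∃ T0 : ℕ, ∀ x ∈ juliaSet p q, ∃ t : ℕ, 1 ≤ t ∧ t ≤ T0 ∧ Real.exp (t * β) ≤ LSum p q f t x := by
  have hN : (0 : ℝ) < N := by exact_mod_cast hg.1
  obtain ⟨G, hG⟩ : ∃ G, G = (r - (Real.log N + sf)) / 2 := ⟨_, rfl⟩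
  have hG0 : 0 < G := by rw [hG]; linarith
  obtain ⟨κ, hκ, hκG⟩ : ∃ κ : ℕ, 1 ≤ κ ∧ 4 * N ≤ Real.exp (κ * G) := by
    obtain ⟨κ, hκ⟩ := exists_nat_gt (Real.log (4 * N) / G)
    refine ⟨κ + 1, by omega, ?_⟩
    rw [← Real.log_le_iff_le_exp (by positivity)]
    rw [div_lt_iff₀ hG0] at hκ
    push_cast; nlinarith
  have hκ' : (1 : ℝ) ≤ κ := by exact_mod_cast hκ
  obtain ⟨s, hs⟩ : ∃ s, s = r - G / (4 * κ) := ⟨_, rfl⟩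
  have hd : G / (4 * κ) ≤ G := div_le_self hG0.le (by linarith)
  have hsr : s < r := by rw [hs]; have : 0 < G / (4 * κ) := by positivity
                         linarith
  have hθ : N * Real.exp sf * Real.exp (-s) ≤ Real.exp (-G) := by
    rw [mul_assoc, ← Real.exp_add]
    conv_lhs => rw [← Real.exp_log hN]
    rw [← Real.exp_add]
    refine Real.exp_le_exp.2 ?_
    rw [hs]; linarith
  obtain ⟨ε, hε⟩ : ∃ ε, ε = (r - β) / 2 := ⟨_, rfl⟩
  have hε0 : 0 < ε := by rw [hε]; linarith
  obtain ⟨dep, η, hη, hfe⟩ := hcont ε hε0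
  obtain ⟨S, hS1, hS2, hS3⟩ := netS hg hη
  obtain ⟨M, hM1, hexc⟩ := exc hg hA1
  obtain ⟨h, hh, hi, hii⟩ := chooseH hg.1 hup hG0 hκ hκG S.card M
  obtain ⟨m, hm⟩ : ∃ m, m = κ * h := ⟨_, rfl⟩
  rw [← hm] at hi hii
  rw [← hs] at hii
  obtain ⟨F, hinf, hFc, hF⟩ := postF (p := p) (q := q) S h
  obtain ⟨O, hO, hOF, hOc⟩ := hexc F m
  obtain ⟨k0, hk0⟩ := covK hg hA1 F hinf (C := juliaSet p q \ O) ((julia_compact p q).diff hO)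
    Set.sdiff_subset (by
      rintro ⟨w, c⟩ hu hc
      exact hu.2 (hOF w c hc hu.1)) dep
  have hM0 : 0 ≤ M0 := (abs_nonneg _).trans (hM ((fun _ => ⟨0, hg.1⟩), OnePoint.infty))
  obtain ⟨n1, hn1⟩ := exists_nat_gt ((k0 * (M0 + |β|) + Real.log (4 * a m) + |r| * m) / ε)
  obtain ⟨n, hn, hrec⟩ := record hsr hlo (m + n1 + 1)
  have han := ha0 n
  have ham := ha0 m
  obtain ⟨n', hn'⟩ : ∃ n', n' = n - m := ⟨_, rfl⟩
  have hnm : m + n' = n := by omega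
  obtain ⟨y, hy, hyL⟩ := hatt n
  -- choose a good preimage
  obtain ⟨u, huy, huO, huL⟩ : ∃ u ∈ preimTn p q m y, u ∉ O ∧ a n / (2 * a m) < LSum p q f n' u := by
    by_contra hcon
    push Not at hcon
    have h1 := pickU hg hsf ha ha0 (n := n') hy (hOc y) (c := a n / (2 * a m)) (by positivity) hcon
    rw [hnm] at h1
    have h2 : a m * (a n / (2 * a m)) = a n / 2 := by field_simp
    have h3 : ((N ^ m * F.card * M : ℕ) : ℝ) * (Real.exp (m * sf) * a n') ≤ 1 / 4 * a n := by
      have h4 := hrec m (by omega)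
      rw [← hn'] at h4
      have h5 : (N : ℝ) ^ m * (Real.exp (m * sf) * Real.exp (-(m * s))) ≤ Real.exp (-(m * G)) := by
        have := pow_le_pow_left₀ (by positivity) hθ m
        rw [mul_pow, mul_pow, ← Real.exp_nat_mul, ← Real.exp_nat_mul, ← Real.exp_nat_mul] at this
        calc (N : ℝ) ^ m * (Real.exp (m * sf) * Real.exp (-(m * s))) = (N : ℝ) ^ m * Real.exp (m * sf) * Real.exp (m * -s) := by
              rw [mul_neg]; ring
          _ ≤ _ := this
          _ = _ := by rw [mul_neg]
      have h6 : (F.card : ℝ) ≤ 1 + h * N ^ h * S.card := by exact_mod_cast hFc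
      calc ((N ^ m * F.card * M : ℕ) : ℝ) * (Real.exp (m * sf) * a n')
          ≤ ((N ^ m * F.card * M : ℕ) : ℝ) * (Real.exp (m * sf) * (Real.exp (-(m * s)) * a n)) := by gcongr
        _ = (F.card : ℝ) * M * ((N : ℝ) ^ m * (Real.exp (m * sf) * Real.exp (-(m * s)))) * a n := by push_cast; ring
        _ ≤ (1 + h * N ^ h * S.card : ℝ) * M * Real.exp (-(m * G)) * a n := by gcongr
        _ ≤ 1 / 4 * a n := by gcongr
    linarith
  have huJ := preimTn_mem hg hy huy
  refine ⟨n' + k0, fun x hx => ?_⟩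
  obtain ⟨k, hk, b, ρ, w, w', z, z', hρ, hbF, hww, hz, hz', rfl, hT⟩ := hk0 u ⟨huJ, huO⟩ x hx
  have hx'J : (w', (z' : Sphere)) ∈ juliaSet p q := julia_bwd_iter hg k (hT.symm ▸ hx)
  have htree := tree hg hρ hS1 hS2 (hS3 b ρ hρ) hh
    (fun j hj w s hs z hz heq => hbF z hz (heq ▸ hF j hj w s hs)) hsf ha hfe n' hww hz hz' huJ hx'J
  have hx1 : Real.exp (-G) < 1 := (by rw [← Real.exp_zero]; exact Real.exp_lt_exp.2 (by linarith))
  have htail := tailBound (K := (S.card : ℝ)) (θ := N * Real.exp sf) (x := Real.exp (-G)) (m := m) (by omega) hh hrec (by positivity) han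
    (by positivity) hx1 hθ
  rw [← hn'] at htail
  have htail2 : (S.card : ℝ) * (Real.exp (-(m * s)) * a n) * (Real.exp (-G) ^ h / (1 - Real.exp (-G))) ≤ a n / (4 * a m) := by
    rw [le_div_iff₀ (by positivity)]
    have := mul_le_mul_of_nonneg_right hii han.le
    rw [one_mul] at this
    refine le_trans (le_of_eq ?_) this
    ring
  have h7 : a n / (4 * a m) ≤ Real.exp (n' * ε) * LSum p q f n' (w', (z' : Sphere)) := by
    have : a n / (2 * a m) = 2 * (a n / (4 * a m)) := by field_simp; norm_num
    linarith
  have h8 : Real.exp (-(k * M0)) * LSum p q f n' (w', (z' : Sphere)) ≤ LSum p q f (k + n') x := by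
    rw [LSum_add hg]
    refine le_trans ?_ (le_msum_mem (g := fun y => Real.exp (birk p q f k y) * LSum p q f n' y) ?_ ((mem_preimTn hg k x _).2 hT))
    · refine mul_le_mul_of_nonneg_right (Real.exp_le_exp.2 ?_) (LSum_pos hg f n' _).le
      have := (abs_le.1 (birk_abs p q hM k (w', (z' : Sphere)))).1
      linarith
    · intro y _
      exact mul_nonneg (Real.exp_pos _).le (LSum_pos hg f n' y).le
  refine ⟨k + n', by omega, by omega, le_trans ?_ h8⟩
  have h9 : Real.exp (-(n' * ε)) * (a n / (4 * a m)) ≤ LSum p q f n' (w', (z' : Sphere)) := by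
    have := mul_le_mul_of_nonneg_left h7 (Real.exp_pos (-(n' * ε))).le
    rwa [← mul_assoc, ← Real.exp_add, neg_add_cancel, Real.exp_zero, one_mul] at this
  refine le_trans ?_ (mul_le_mul_of_nonneg_left h9 (Real.exp_pos _).le)
  have h10 : Real.exp (n * r - Real.log (4 * a m)) ≤ a n / (4 * a m) := by
    rw [Real.exp_sub, Real.exp_log (by positivity)]
    exact div_le_div_of_nonneg_right (hlo n) (by positivity)
  refine le_trans ?_ (mul_le_mul_of_nonneg_left (mul_le_mul_of_nonneg_left h10 (Real.exp_pos _).le) (Real.exp_pos _).le)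
  rw [← Real.exp_add, ← Real.exp_add]
  refine Real.exp_le_exp.2 ?_
  rw [div_lt_iff₀ hε0] at hn1
  have hnn : (n : ℝ) = m + n' := by rw [← hnm]; push_cast; ring
  have hn'1 : (n1 : ℝ) ≤ n' := by exact_mod_cast (by omega : n1 ≤ n')
  have hkk : (k : ℝ) * (M0 + |β|) ≤ k0 * (M0 + |β|) := by
    refine mul_le_mul_of_nonneg_right (by exact_mod_cast hk) (by positivity)
  have hkb : (k : ℝ) * β ≤ k * |β| := mul_le_mul_of_nonneg_left (le_abs_self _) (by positivity)
  have hmr : -(|r| * m) ≤ m * r := by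
    have := mul_le_mul_of_nonneg_left (neg_abs_le r) (Nat.cast_nonneg (α := ℝ) m)
    linarith
  have h11 : (n1 : ℝ) * ε ≤ n' * ε := mul_le_mul_of_nonneg_right hn'1 hε0.le
  have hrb : r = β + 2 * ε := by rw [hε]; ring
  have h12 : (n' : ℝ) * r = n' * β + 2 * (n' * ε) := by rw [hrb]; ring
  push_cast
  rw [hnn]
  linarith

variable {p q} in
theorem expLSum (hg : Good p q) {f : SymX N → ℝ} {M0 : ℝ} (hM : ∀ x, |f x| ≤ M0) (n : ℕ) (x : SymX N) :
    Real.exp (n * -M0) ≤ LSum p q f n x := by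
  refine le_trans ?_ (le_LSum hg hM n x)
  rw [Real.exp_nat_mul]
  refine pow_le_pow_left₀ (Real.exp_pos _).le ?_ n
  have : (1 : ℝ) ≤ Dtot p q := by exact_mod_cast Dtot_pos hg
  have h := Real.exp_pos (-M0)
  nlinarith

variable {p q} in
theorem LSumexp (hg : Good p q) {f : SymX N → ℝ} {M0 : ℝ} (hM : ∀ x, |f x| ≤ M0) (n : ℕ) (x : SymX N) :
    LSum p q f n x ≤ Real.exp (n * (Real.log (Dtot p q) + M0)) := by
  refine (LSum_le hg hM n x).trans (le_of_eq ?_)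
  have : (0 : ℝ) < Dtot p q := by exact_mod_cast Dtot_pos hg
  rw [Real.exp_nat_mul, Real.exp_add, Real.exp_log this]

variable {p q} in
theorem key2 (hg : Good p q) {f : SymX N → ℝ} {M0 : ℝ} (hM : ∀ x, |f x| ≤ M0) {β : ℝ} {T0 : ℕ}
    (hT : ∀ x ∈ juliaSet p q, ∃ t : ℕ, 1 ≤ t ∧ t ≤ T0 ∧ Real.exp (t * β) ≤ LSum p q f t x) :
    ∃ c : ℝ, 0 < c ∧ ∀ n : ℕ, ∀ x ∈ juliaSet p q, c * Real.exp (n * β) ≤ LSum p q f n x := by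
  have hM0 : 0 ≤ M0 := (abs_nonneg _).trans (hM ((fun _ => ⟨0, hg.1⟩), OnePoint.infty))
  refine ⟨Real.exp (-(T0 * (M0 + |β|))), Real.exp_pos _, fun n => ?_⟩
  induction n using Nat.strong_induction_on with
  | _ n ih =>
    intro x hx
    by_cases hn : n ≤ T0
    · refine le_trans ?_ (expLSum hg hM n x)
      rw [← Real.exp_add]
      refine Real.exp_le_exp.2 ?_
      have h1 : (n : ℝ) * (M0 + |β|) ≤ T0 * (M0 + |β|) := mul_le_mul_of_nonneg_right (by exact_mod_cast hn) (by positivity)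
      have h2 : (n : ℝ) * β ≤ n * |β| := mul_le_mul_of_nonneg_left (le_abs_self _) (by positivity)
      nlinarith
    · obtain ⟨t, ht1, ht2, ht⟩ := hT x hx
      obtain ⟨k, rfl⟩ : ∃ k, n = t + k := ⟨n - t, by omega⟩
      rw [LSum_add hg]
      have hk := ih k (by omega)
      refine le_trans ?_ (msum_mono (g := fun y => Real.exp (birk p q f t y) * (Real.exp (-(T0 * (M0 + |β|))) * Real.exp (k * β))) ?_)
      · rw [Multiset.sum_map_mul_right]
        refine le_trans (le_of_eq ?_) (mul_le_mul_of_nonneg_right ht (by positivity))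
        simp only [← Real.exp_add]; congr 1; push_cast; ring
      · intro y hy
        exact mul_le_mul_of_nonneg_left (hk y (preimTn_mem hg hx hy)) (Real.exp_pos _).le

variable {p q} in
theorem lsup_bdd (hg : Good p q) {f : SymX N → ℝ} {M0 : ℝ} (hM : ∀ x, |f x| ≤ M0) (x : SymX N) (n : ℕ) (hn : 0 < n) :
    -M0 ≤ (n : ℝ)⁻¹ * Real.log (LSum p q f n x) ∧ (n : ℝ)⁻¹ * Real.log (LSum p q f n x) ≤ Real.log (Dtot p q) + M0 := by
  have hn' : (0 : ℝ) < n := by exact_mod_cast hn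
  have h1 := (Real.le_log_iff_exp_le (LSum_pos hg f n x)).2 (expLSum hg hM n x)
  have h2 := (Real.log_le_iff_le_exp (LSum_pos hg f n x)).2 (LSumexp hg hM n x)
  constructor
  · rw [inv_mul_eq_div, le_div_iff₀ hn']; linarith
  · rw [inv_mul_eq_div, div_le_iff₀ hn']; linarith

variable {p q} in
theorem press_up (hg : Good p q) {f : SymX N → ℝ} {M0 : ℝ} (hM : ∀ x, |f x| ≤ M0) {x : SymX N} (hx : x ∈ juliaSet p q)
    {ε : ℝ} (hε : 0 < ε) : ∀ᶠ n : ℕ in atTop, LSum p q f n x ≤ Real.exp (n * (pressure p q f + ε)) := by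
  have hub : ∀ x : SymX N, IsBoundedUnder (· ≤ ·) atTop (fun n : ℕ => (n : ℝ)⁻¹ * Real.log (LSum p q f n x)) := fun x =>
    ⟨Real.log (Dtot p q) + M0, eventually_map.2 ((eventually_gt_atTop 0).mono fun n hn => (lsup_bdd hg hM x n hn).2)⟩
  have hlb : ∀ x : SymX N, IsCoboundedUnder (· ≤ ·) atTop (fun n : ℕ => (n : ℝ)⁻¹ * Real.log (LSum p q f n x)) := fun x =>
    IsBoundedUnder.isCoboundedUnder_le ⟨-M0, eventually_map.2 ((eventually_gt_atTop 0).mono fun n hn => (lsup_bdd hg hM x n hn).1)⟩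
  have hle : limsup (fun n : ℕ => (n : ℝ)⁻¹ * Real.log (LSum p q f n x)) atTop ≤ pressure p q f := by
    refine le_ciSup (f := fun x : ↥(juliaSet p q) => limsup (fun n : ℕ => (n : ℝ)⁻¹ * Real.log (LSum p q f n ↑x)) atTop) ?_ ⟨x, hx⟩
    refine ⟨Real.log (Dtot p q) + M0, ?_⟩
    rintro _ ⟨y, rfl⟩
    exact limsup_le_of_le (hlb y) ((eventually_gt_atTop 0).mono fun n hn => (lsup_bdd hg hM y n hn).2)
  have h1 := eventually_lt_of_limsup_lt (lt_of_le_of_lt hle (lt_add_of_pos_right _ hε)) (hub x)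
  filter_upwards [h1, eventually_gt_atTop 0] with n h hn
  have hn' : (0 : ℝ) < n := by exact_mod_cast hn
  rw [inv_mul_eq_div, div_lt_iff₀ hn', mul_comm] at h
  exact (Real.log_le_iff_le_exp (LSum_pos hg f n x)).1 h.le

variable {p q} in
theorem press_le (hg : Good p q) {f : SymX N → ℝ} {M0 : ℝ} (hM : ∀ x, |f x| ≤ M0) (hne : (juliaSet p q).Nonempty)
    {a : ℕ → ℝ} (ha : ∀ n, ∀ y ∈ juliaSet p q, LSum p q f n y ≤ a n)
    {r : ℝ} (hup : ∀ ε > 0, ∀ᶠ n : ℕ in atTop, a n ≤ Real.exp (n * (r + ε))) : pressure p q f ≤ r := by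
  have hlb : ∀ x : SymX N, IsCoboundedUnder (· ≤ ·) atTop (fun n : ℕ => (n : ℝ)⁻¹ * Real.log (LSum p q f n x)) := fun x =>
    IsBoundedUnder.isCoboundedUnder_le ⟨-M0, eventually_map.2 ((eventually_gt_atTop 0).mono fun n hn => (lsup_bdd hg hM x n hn).1)⟩
  have : Nonempty ↥(juliaSet p q) := hne.to_subtype
  refine ciSup_le fun x => le_of_forall_pos_le_add fun ε hε => limsup_le_of_le (hlb x) ?_
  filter_upwards [hup ε hε, eventually_gt_atTop 0] with n h hn
  have hn' : (0 : ℝ) < n := by exact_mod_cast hn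
  rw [inv_mul_eq_div, div_le_iff₀ hn', mul_comm]
  exact (Real.log_le_iff_le_exp (LSum_pos hg f n x)).2 ((ha n x x.2).trans h)

variable {p q} in
theorem key3 (hg : Good p q) (hA1 : NoSuperAttract p q) {f : SymX N → ℝ} {M0 : ℝ} (hM : ∀ x, |f x| ≤ M0)
    {sf : ℝ} (hsf : ∀ y ∈ juliaSet p q, f y ≤ sf)
    (hcont : ∀ ε > 0, ∃ (dep : ℕ) (η : ℝ), 0 < η ∧ ∀ y ∈ juliaSet p q, ∀ y' ∈ juliaSet p q,
      (∀ i < dep, y.1 i = y'.1 i) → sphDist y.2 y'.2 ≤ η → f y ≤ f y' + ε)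
    (hne : (juliaSet p q).Nonempty) (hP : sf + Real.log N < pressure p q f) {β : ℝ} (hβ : β < pressure p q f) :
    ∃ c : ℝ, 0 < c ∧ ∀ n : ℕ, ∀ x ∈ juliaSet p q, c * Real.exp (n * β) ≤ LSum p q f n x := by
  have : Nonempty ↥(juliaSet p q) := hne.to_subtype
  obtain ⟨a, haD⟩ : ∃ a : ℕ → ℝ, a = fun n => ⨆ x : ↥(juliaSet p q), LSum p q f n x := ⟨_, rfl⟩
  have ha : ∀ n, ∀ y ∈ juliaSet p q, LSum p q f n y ≤ a n := by
    intro n y hy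
    rw [haD]
    refine le_ciSup (f := fun x : ↥(juliaSet p q) => LSum p q f n x) ⟨Real.exp (n * (Real.log (Dtot p q) + M0)), ?_⟩ ⟨y, hy⟩
    rintro _ ⟨x, rfl⟩
    exact LSumexp hg hM n x
  obtain ⟨x0, hx0⟩ := hne
  have hlow : ∀ n : ℕ, Real.exp (n * -M0) ≤ a n := fun n => (expLSum hg hM n x0).trans (ha n x0 hx0)
  have ha0 : ∀ n, 0 < a n := fun n => (Real.exp_pos _).trans_le (hlow n)
  have h0 : a 0 = 1 := by rw [haD]; simp [LSum_zero]
  have hsub : ∀ m n, a (m + n) ≤ a m * a n := by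
    intro m n
    have : a (m + n) = ⨆ x : ↥(juliaSet p q), LSum p q f (m + n) x := by rw [haD]
    rw [this]
    refine ciSup_le fun x => ?_
    rw [LSum_add hg]
    refine (msum_mono (g' := fun y => Real.exp (birk p q f m y) * a n) ?_).trans ?_
    · intro y hy
      exact mul_le_mul_of_nonneg_left (ha n y (preimTn_mem hg x.2 hy)) (Real.exp_pos _).le
    · rw [Multiset.sum_map_mul_right]
      exact mul_le_mul_of_nonneg_right (ha m x x.2) (ha0 n).le
  have hatt : ∀ n, ∃ y ∈ juliaSet p q, 3 / 4 * a n < LSum p q f n y := by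
    intro n
    have h1 : 3 / 4 * a n < ⨆ x : ↥(juliaSet p q), LSum p q f n x := by
      have h2 : a n = ⨆ x : ↥(juliaSet p q), LSum p q f n x := by rw [haD]
      rw [← h2]; linarith [ha0 n]
    obtain ⟨y, hy⟩ := exists_lt_of_lt_ciSup h1
    exact ⟨y, y.2, hy⟩
  obtain ⟨r, hlo, hup⟩ := sub_exp h0 ha0 hsub hlow
  have hPr := press_le hg hM ⟨x0, hx0⟩ ha hup
  obtain ⟨T0, hT0⟩ := key1 hg hA1 hM hsf hcont ha ha0 hatt hlo hup (by linarith) (hβ.trans_le hPr)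
  exact key2 hg hM hT0

theorem shiftDist_le {w w' : ℕ → Fin N} {d : ℕ} (h : ∀ i < d, w i = w' i) : shiftDist w w' ≤ (2 : ℝ)⁻¹ ^ d := by
  rw [shiftDist]
  split_ifs with hn
  · refine pow_le_pow_of_le_one (by norm_num) (by norm_num) ?_
    have h1 := Nat.find_spec hn
    by_contra hc
    exact h1 (h _ (by omega))
  · positivity

theorem shiftDist_nonneg (w w' : ℕ → Fin N) : 0 ≤ shiftDist w w' := by
  rw [shiftDist]; split_ifs <;> positivity

variable {p q} in
theorem holder_cont {f : ↥(juliaSet p q) → ℝ} (hf : HolderOnJ p q f) :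
    ∀ ε > 0, ∃ (dep : ℕ) (η : ℝ), 0 < η ∧ ∀ y ∈ juliaSet p q, ∀ y' ∈ juliaSet p q,
      (∀ i < dep, y.1 i = y'.1 i) → sphDist y.2 y'.2 ≤ η → jextend p q f y ≤ jextend p q f y' + ε := by
  intro ε hε
  obtain ⟨C, hC, α, hα, h⟩ := hf
  obtain ⟨η, hη, hηε⟩ : ∃ η : ℝ, 0 < η ∧ C * η ^ α ≤ ε := by
    refine ⟨(ε / C) ^ (α⁻¹), by positivity, ?_⟩
    rw [← Real.rpow_mul (by positivity), inv_mul_cancel₀ hα.1.ne', Real.rpow_one]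
    exact (mul_div_cancel₀ ε hC.ne').le
  obtain ⟨dep, hdep⟩ := exists_pow_lt_of_lt_one hη (show (2 : ℝ)⁻¹ < 1 by norm_num)
  refine ⟨dep, η, hη, fun y hy y' hy' h1 h2 => ?_⟩
  have h3 := h ⟨y, hy⟩ ⟨y', hy'⟩
  have h4 : dX y y' ≤ η := max_le ((shiftDist_le h1).trans hdep.le) h2
  have h5 : dX y y' ^ α ≤ η ^ α := Real.rpow_le_rpow (le_max_of_le_left (shiftDist_nonneg _ _)) h4 hα.1.le
  have h6 := mul_le_mul_of_nonneg_left h5 hC.le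
  simp only [jextend, hy, hy', dif_pos]
  have h7 := (le_abs_self _).trans h3
  simp only at h7
  linarith

variable {p q} in
theorem holder_bdd {f : ↥(juliaSet p q) → ℝ} (hf : HolderOnJ p q f) : ∃ M : ℝ, ∀ x, |f x| ≤ M := by
  obtain ⟨C, hC, α, hα, h⟩ := hf
  obtain ⟨B, hB⟩ := (isCompact_univ.image sphDist_continuous).bddAbove
  have hB' : ∀ a b, sphDist a b ≤ B := fun a b => hB ⟨(a, b), trivial, rfl⟩
  by_cases hne : Nonempty ↥(juliaSet p q)
  · obtain ⟨x0⟩ := hne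
    refine ⟨|f x0| + C * (max 1 B) ^ α, fun x => ?_⟩
    have h1 := h x x0
    have h4 : dX (x : SymX N) (x0 : SymX N) ≤ max 1 B :=
      max_le_max (by simpa using shiftDist_le (d := 0) (w := (x : SymX N).1) (w' := (x0 : SymX N).1) (by simp)) (hB' _ _)
    have h5 : dX (x : SymX N) (x0 : SymX N) ^ α ≤ (max 1 B) ^ α := Real.rpow_le_rpow (le_max_of_le_left (shiftDist_nonneg _ _)) h4 hα.1.le
    have h6 := mul_le_mul_of_nonneg_left h5 hC.le
    have h7 := abs_sub_abs_le_abs_sub (f x) (f x0)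
    linarith
  · exact ⟨0, fun x => (hne ⟨x⟩).elim⟩

variable {p q} in
theorem jext_bdd {f : ↥(juliaSet p q) → ℝ} {M : ℝ} (hM : ∀ x, |f x| ≤ M) (x : SymX N) : |jextend p q f x| ≤ |M| := by
  rw [jextend]
  split_ifs with h
  · exact (hM _).trans (le_abs_self _)
  · simp

variable {p q} in
theorem key4 (hg : Good p q) (hA1 : NoSuperAttract p q)
    (f : ↥(juliaSet p q) → ℝ) (hf : HolderOnJ p q f)
    (hP : pressure p q (jextend p q f) > (⨆ x : ↥(juliaSet p q), f x) + Real.log N)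
    {x : SymX N} (hx : x ∈ juliaSet p q) {β : ℝ} (hβ : β < pressure p q (jextend p q f)) :
    ∃ c : ℝ, 0 < c ∧ ∀ n : ℕ, c * Real.exp (n * β) ≤ LSum p q (jextend p q f) n x := by
  obtain ⟨M, hM⟩ := holder_bdd hf
  obtain ⟨c, hc, h⟩ := key3 hg hA1 (jext_bdd hM) (sf := ⨆ x : ↥(juliaSet p q), f x) (by
    intro y hy
    simp only [jextend, hy, dif_pos]
    exact le_ciSup (f := f) ⟨M, by rintro _ ⟨z, rfl⟩; exact (le_abs_self _).trans (hM z)⟩ ⟨y, hy⟩) (holder_cont hf) ⟨x, hx⟩ hP hβ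
  exact ⟨c, hc, fun n => h n x hx⟩

variable {p q} in
theorem orb_eq (hg : Good p q) {y : SymX N} (hy : y ∈ juliaSet p q) (n : ℕ) :
    orbMeas p q y n = (n : ℝ≥0∞)⁻¹ • ∑ k ∈ Finset.range n,
      Measure.dirac (⟨(Tmap p q)^[k] y, julia_fwd_iter hg k hy⟩ : ↥(juliaSet p q)) := by
  have hemb : MeasurableEmbedding (Subtype.val : ↥(juliaSet p q) → SymX N) :=
    (julia_compact p q).isClosed.isClosedEmbedding_subtypeVal.measurableEmbedding
  refine Measure.ext fun s hs => ?_
  rw [orbMeas, hemb.comap_apply]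
  simp only [Measure.smul_apply, Measure.finsetSum_apply]
  congr 1
  refine Finset.sum_congr rfl fun k _ => ?_
  rw [Measure.dirac_apply' _ (hemb.measurableSet_image.2 hs), Measure.dirac_apply' _ hs]
  by_cases h : (⟨(Tmap p q)^[k] y, julia_fwd_iter hg k hy⟩ : ↥(juliaSet p q)) ∈ s
  · rw [Set.indicator_of_mem h, Set.indicator_of_mem (Set.mem_image_of_mem Subtype.val h)]; rfl
  · rw [Set.indicator_of_notMem h, Set.indicator_of_notMem]
    rintro ⟨z, hz, hzz⟩
    exact h (by convert hz; exact hzz.symm)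

variable {p q} in
theorem orb_int (hg : Good p q) {y : SymX N} (hy : y ∈ juliaSet p q) (n : ℕ) (g : C(↥(juliaSet p q), ℝ)) :
    ∫ z, g z ∂(orbMeas p q y n) = (n : ℝ)⁻¹ * birk p q (jextend p q g) n y := by
  have hc : CompactSpace ↥(juliaSet p q) := isCompact_iff_compactSpace.1 (julia_compact p q)
  rw [orb_eq hg hy, integral_smul_measure, integral_finsetSum_measure]
  · rw [ENNReal.toReal_inv, ENNReal.toReal_natCast, smul_eq_mul, birk]
    congr 1
    refine Finset.sum_congr rfl fun k _ => ?_
    rw [integral_dirac' _ _ g.continuous.measurable.stronglyMeasurable]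
    simp only [jextend, julia_fwd_iter hg k hy, dif_pos]
  · intro k _
    exact (BoundedContinuousFunction.mkOfCompact g).integrable _

variable {p q} in
theorem birk_jadd (f g : ↥(juliaSet p q) → ℝ) (n : ℕ) (y : SymX N) :
    birk p q (jextend p q fun x => f x + g x) n y = birk p q (jextend p q f) n y + birk p q (jextend p q g) n y := by
  rw [birk, birk, birk, ← Finset.sum_add_distrib]
  refine Finset.sum_congr rfl fun k _ => ?_
  simp only [jextend]
  split_ifs <;> simp

theorem msum_finset {α β : Type*} (s : Multiset α) (t : Finset β) (F : β → α → ℝ) :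
    (s.map fun y => ∑ g ∈ t, F g y).sum = ∑ g ∈ t, (s.map (F g)).sum := by
  induction s using Multiset.induction_on with
  | empty => simp
  | cons a s ih => simp [ih, Finset.sum_add_distrib]

variable {p q} in
theorem num_bound (hg : Good p q) (f : ↥(juliaSet p q) → ℝ) {x : SymX N} (hx : x ∈ juliaSet p q)
    {K : Set (ProbabilityMeasure ↥(juliaSet p q))} {c : ℝ} {t : Finset C(↥(juliaSet p q), ℝ)}
    (ht : ∀ ν ∈ K, ∃ g ∈ t, c + Qfun p q f g < ∫ z, g z ∂(ν : Measure ↥(juliaSet p q))) {n : ℕ} (hn : 0 < n) :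
    (((preimTn p q n x).filter fun y => inK p q (orbMeas p q y n) K).map
        fun y => Real.exp (birk p q (jextend p q f) n y)).sum ≤
      ∑ g ∈ t, Real.exp (-(n * (c + Qfun p q f g))) * LSum p q (jextend p q fun x => f x + g x) n x := by
  have hn' : (0 : ℝ) < n := by exact_mod_cast hn
  have h1 : ∀ y ∈ (preimTn p q n x).filter (fun y => inK p q (orbMeas p q y n) K),
      Real.exp (birk p q (jextend p q f) n y) ≤
        ∑ g ∈ t, Real.exp (-(n * (c + Qfun p q f g))) * Real.exp (birk p q (jextend p q fun x => f x + g x) n y) := by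
    intro y hy
    obtain ⟨hy1, ν, hν, hνK⟩ := Multiset.mem_filter.1 hy
    obtain ⟨g, hgt, hgc⟩ := ht ν hνK
    rw [hν, orb_int hg (preimTn_mem hg hx hy1), inv_mul_eq_div, lt_div_iff₀ hn'] at hgc
    refine le_trans ?_ (Finset.single_le_sum (f := fun g : C(↥(juliaSet p q), ℝ) => Real.exp (-(n * (c + Qfun p q f g))) * Real.exp (birk p q (jextend p q fun x => f x + g x) n y))
      (fun g _ => by positivity) hgt)
    rw [← Real.exp_add, birk_jadd f g]
    refine Real.exp_le_exp.2 ?_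
    linarith
  refine (msum_mono h1).trans ?_
  refine (msum_filter_le _ _ _ fun y _ => Finset.sum_nonneg fun g _ => by positivity).trans ?_
  rw [msum_finset]
  refine Finset.sum_le_sum fun g _ => ?_
  rw [Multiset.sum_map_mul_left, LSum]

theorem large_deviation_upper_bound_preimages
    (hg : Good p q) (hA1 : NoSuperAttract p q)
    (f : ↥(juliaSet p q) → ℝ) (hf : HolderOnJ p q f)
    (hP : pressure p q (jextend p q f) > (⨆ x : ↥(juliaSet p q), f x) + Real.log N)
    (x : SymX N) (hx : x ∈ juliaSet p q)
    (K : Set (ProbabilityMeasure ↥(juliaSet p q))) (hK : IsClosed K) :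
    limsup (preimLDSeq p q f x K) atTop ≤ -(rho p q f K) := by
  have hcs : CompactSpace ↥(juliaSet p q) := isCompact_iff_compactSpace.1 (julia_compact p q)
  refine EReal.le_of_forall_lt_iff_le.1 fun z hz => ?_
  have hz' : ((-z : ℝ) : EReal) < rho p q f K := by
    rw [EReal.coe_neg]; exact EReal.neg_lt_comm.1 hz
  obtain ⟨c, hzc, hcρ⟩ := EReal.lt_iff_exists_real_btwn.1 hz'
  have hzc : -z < c := EReal.coe_lt_coe_iff.1 hzc
  obtain ⟨δ, hδ⟩ : ∃ δ, δ = (c + z) / 3 := ⟨_, rfl⟩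
  have hδ0 : 0 < δ := by rw [hδ]; linarith
  obtain ⟨t, ht⟩ : ∃ t : Finset C(↥(juliaSet p q), ℝ), ∀ ν ∈ K, ∃ g ∈ t,
      c + Qfun p q f g < ∫ z, g z ∂(ν : Measure ↥(juliaSet p q)) := by
    obtain ⟨t, ht⟩ := hK.isCompact.elim_finite_subcover
      (fun g : C(↥(juliaSet p q), ℝ) => {ν : ProbabilityMeasure ↥(juliaSet p q) |
        c + Qfun p q f g < ∫ z, g z ∂(ν : Measure ↥(juliaSet p q))}) (by
        intro g
        exact isOpen_lt continuous_const
          (ProbabilityMeasure.continuous_integral_boundedContinuousFunction (BoundedContinuousFunction.mkOfCompact g))) (by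
        intro ν hν
        have h1 : (c : EReal) < LLfun p q f ν := hcρ.trans_le (iInf₂_le ν hν)
        obtain ⟨g, hgc⟩ := lt_iSup_iff.1 h1
        refine Set.mem_iUnion.2 ⟨g, ?_⟩
        have := EReal.coe_lt_coe_iff.1 hgc
        show c + Qfun p q f g < ∫ z, g z ∂(ν : Measure ↥(juliaSet p q))
        linarith)
    refine ⟨t, fun ν hν => ?_⟩
    obtain ⟨g, hgt, h⟩ := Set.mem_iUnion₂.1 (ht hν)
    exact ⟨g, hgt, h⟩
  obtain ⟨P, hPd⟩ : ∃ P, P = pressure p q (jextend p q f) := ⟨_, rfl⟩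
  obtain ⟨c0, hc0, hlow⟩ := key4 hg hA1 f hf hP hx (β := P - δ) (by rw [hPd]; linarith)
  obtain ⟨M, hM⟩ := holder_bdd hf
  have hup : ∀ g ∈ t, ∀ᶠ n : ℕ in atTop, LSum p q (jextend p q fun x => f x + g x) n x ≤
      Real.exp (n * (pressure p q (jextend p q fun x => f x + g x) + δ)) := by
    intro g _
    refine press_up hg (jext_bdd (M := M + ‖g‖) fun y => ?_) hx hδ0
    refine (abs_add_le _ _).trans (add_le_add (hM y) ?_)
    exact g.norm_coe_le_norm y
  have hup' := (Finset.eventually_all t).2 hup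
  have hlim : ∀ᶠ n : ℕ in atTop, (n : ℝ)⁻¹ * Real.log ((t.card + 1) / c0) ≤ δ := by
    have := (tendsto_inv_atTop_nhds_zero_nat (𝕜 := ℝ)).mul_const (Real.log ((t.card + 1) / c0))
    rw [zero_mul] at this
    exact (this.eventually (gt_mem_nhds hδ0)).mono fun n h => h.le
  refine limsup_le_of_le (by isBoundedDefault) ?_
  filter_upwards [hup', hlim, eventually_gt_atTop 0] with n h1 h2 hn
  have hn' : (0 : ℝ) < n := by exact_mod_cast hn
  have hnum := num_bound hg f hx ht hn
  rw [preimLDSeq]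
  obtain ⟨A, hA⟩ : ∃ A, A = (((preimTn p q n x).filter fun y => inK p q (orbMeas p q y n) K).map
        fun y => Real.exp (birk p q (jextend p q f) n y)).sum := ⟨_, rfl⟩
  have hA0 : 0 ≤ A := by rw [hA]; exact msum_nonneg fun y _ => (Real.exp_pos _).le
  rw [← hA] at hnum ⊢
  split_ifs with h0
  · exact bot_le
  · have hApos : 0 < A := lt_of_le_of_ne hA0 (Ne.symm h0)
    have hL := LSum_pos hg (jextend p q f) n x
    have hA1 : A ≤ (t.card + 1) * Real.exp (n * (-c + P + δ)) := by
      refine hnum.trans ?_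
      refine (Finset.sum_le_card_nsmul t _ (Real.exp (n * (-c + P + δ))) fun g hgt => ?_).trans ?_
      · refine (mul_le_mul_of_nonneg_left (h1 g hgt) (Real.exp_pos _).le).trans (le_of_eq ?_)
        rw [← Real.exp_add, hPd, Qfun]; congr 1; ring
      · rw [nsmul_eq_mul]
        exact mul_le_mul_of_nonneg_right (by linarith) (Real.exp_pos _).le
    have hq : A / LSum p q (jextend p q f) n x ≤ (t.card + 1) / c0 * Real.exp (n * (-c + 2 * δ)) := by
      rw [div_le_iff₀ hL]
      refine hA1.trans ?_
      refine le_trans (le_of_eq ?_) (mul_le_mul_of_nonneg_left (hlow n) (by positivity))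
      have : Real.exp (n * (-c + P + δ)) = Real.exp (n * (-c + 2 * δ)) * Real.exp (n * (P - δ)) := by
        rw [← Real.exp_add]; congr 1; ring
      rw [this]; field_simp
    refine EReal.coe_le_coe_iff.2 ?_
    have h3 := Real.log_le_log (div_pos hApos hL) hq
    rw [Real.log_mul (by positivity) (Real.exp_pos _).ne', Real.log_exp] at h3
    have h4 := mul_le_mul_of_nonneg_left h3 (inv_nonneg.2 hn'.le)
    rw [mul_add, inv_mul_cancel_left₀ hn'.ne'] at h4
    refine h4.trans ?_
    have : -c + 2 * δ + δ = z := by rw [hδ]; ring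
    linarith

end SkewRational
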